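/- Let Ξ ⊆ Ω be a prediction set satisfying Assumption A. Define the superhedging price Φ(ξ) := inf{ λ ∈ ℝ : there are sequences (H^n) and (G^n) in ℋ such that λ + (H^n·S)_t + (G^n·𝕊)_t ≥ 0 on Ξ for all n and all t ∈ [0,T], and λ + liminf_{n→∞} ((H^n·S)_T + (G^n·𝕊)_T) ≥ ξ on Ξ }. Then for every function ξ : C[0,T] → [0,∞] of the form ξ(ω) = liminf_{n→∞} ξ̄_n(ω, ⟨ω⟩), where each ξ̄_n : C[0,T]×C[0,T] → [0,∞) is bounded and upper semicontinuous, one has Φ(ξ) = sup_{Q ∈ M(Ξ)} E_Q[ξ]. -/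

import Mathlib

open MeasureTheory Filter Set Topology
open scoped ENNReal Classical

noncomputable section

namespace PathwiseSuperhedging

/-- The path space `C[0,T]`: continuous functions on `[0,T]` with the sup-norm. -/
abbrev Path (T : ℝ) := C(Set.Icc (0:ℝ) T, ℝ)

variable (T : ℝ)

instance : MeasurableSpace (Path T) := borel _
instance : BorelSpace (Path T) := ⟨rfl⟩

variable (hT : 0 ≤ T)

/-- time `0` as an element of `[0,T]`. -/
def t0 : Set.Icc (0:ℝ) T := ⟨0, le_refl 0, hT⟩

/-- clamp a real time into `[0,T]`. -/
def clamp (t : ℝ) : Set.Icc (0:ℝ) T := Set.projIcc 0 T hT t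

/-- evaluation of a path at a (clamped) real time. -/
def ev (ω : Path T) (t : ℝ) : ℝ := ω (clamp T hT t)

/-- The stopping times `σ^m_k`:  `σ^m_0 = 0` and
`σ^m_{k+1} = inf { t ≥ σ^m_k : |S_t - S_{σ^m_k}| ≥ 2^{-m} }` (equal to `T+1` if no such
time `t ≤ T` exists). -/
def sig (m : ℕ) : ℕ → Path T → ℝ
  | 0 => fun _ => 0
  | k + 1 => fun ω =>
      sInf ({t : ℝ | sig m k ω ≤ t ∧ t ≤ T ∧
        (2:ℝ) ^ (-(m:ℤ)) ≤ |ev T hT ω t - ev T hT ω (sig m k ω)|} ∪ {T + 1})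

/-- The discretized integral `𝕊^m_t = ∑_k S_{σ^m_k} (S_{σ^m_{k+1} ∧ t} - S_{σ^m_k ∧ t})`. -/
def Sm (m : ℕ) (t : ℝ) (ω : Path T) : ℝ :=
  ∑' k : ℕ, ev T hT ω (sig T hT m k ω) *
    (ev T hT ω (min (sig T hT m (k + 1) ω) t) - ev T hT ω (min (sig T hT m k ω) t))

/-- The pathwise integral `𝕊_t = liminf_m 𝕊^m_t`. -/
def SS (t : ℝ) (ω : Path T) : ℝ := Filter.liminf (fun m => Sm T hT m t ω) Filter.atTop

/-- The candidate quadratic variation `S_t² - S_0² - 2 𝕊_t`. -/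
def qvRaw (ω : Path T) (t : ℝ) : ℝ := (ev T hT ω t) ^ 2 - (ev T hT ω 0) ^ 2 - 2 * SS T hT t ω

/-- The set `Ω` of paths for which `𝕊^m → 𝕊` uniformly and
`t ↦ S_t² - S_0² - 2𝕊_t` is nondecreasing. -/
def BigOmega : Set (Path T) :=
  {ω | TendstoUniformly (fun m (t : Set.Icc (0:ℝ) T) => Sm T hT m (t : ℝ) ω)
        (fun t => SS T hT (t : ℝ) ω) Filter.atTop ∧
      MonotoneOn (qvRaw T hT ω) (Set.Icc (0:ℝ) T)}

/-- The pathwise quadratic variation `⟨ω⟩`, as an element of `C[0,T]`; it equals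
`S² - S_0² - 2𝕊` for `ω ∈ Ω` (this function being continuous there) and `0` otherwise. -/
def qv (ω : Path T) : Path T :=
  if h : ω ∈ BigOmega T hT ∧ Continuous fun t : Set.Icc (0:ℝ) T => qvRaw T hT ω (t : ℝ)
  then ⟨fun t => qvRaw T hT ω (t : ℝ), h.2⟩ else 0

/-- The raw filtration `F_t = σ(S_s : s ≤ t)` generated by the canonical process. -/
def Fraw (t : ℝ) : MeasurableSpace (Path T) :=
  ⨆ (s : Set.Icc (0:ℝ) T) (_ : (s : ℝ) ≤ t),
    MeasurableSpace.comap (fun ω : Path T => ω s) inferInstance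

/-- The right-continuous filtration `F_{t+} = ⋂_{s > t} F_{s ∧ T}`. -/
def Fplus (t : ℝ) : MeasurableSpace (Path T) :=
  ⨅ (s : ℝ) (_ : t < s), Fraw T (min s T)

/-- `τ` is a stopping time for the raw filtration `𝔽`. -/
def IsStopRaw (τ : Path T → ℝ) : Prop :=
  ∀ t ∈ Set.Icc (0:ℝ) T, MeasurableSet[Fraw T t] {ω | τ ω ≤ t}

/-- `τ` is a stopping time for the right-continuous filtration `𝔽₊`. -/
def IsStopPlus (τ : Path T → ℝ) : Prop :=
  ∀ t ∈ Set.Icc (0:ℝ) T, MeasurableSet[Fplus T t] {ω | τ ω ≤ t}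

/-- `f` is measurable with respect to the σ-field `F_{τ+}`. -/
def MeasAtStopPlus (τ f : Path T → ℝ) : Prop :=
  ∀ B : Set ℝ, MeasurableSet B → ∀ t ∈ Set.Icc (0:ℝ) T,
    MeasurableSet[Fplus T t] (f ⁻¹' B ∩ {ω | τ ω ≤ t})

/-- The set `ℋ` of simple trading strategies `H = ∑_{l=1}^L h_l 1_{(τ_l, τ_{l+1}]}`
with `𝔽₊`-stopping times `0 ≤ τ_1 ≤ ⋯ ≤ τ_{L+1} ≤ T` and bounded `F_{τ_l+}`-measurable
coefficients `h_l`. -/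
structure SimpleStrategy where
  L : ℕ
  τ : Fin (L + 1) → Path T → ℝ
  coeff : Fin L → Path T → ℝ
  τ_nonneg : ∀ ω, 0 ≤ τ 0 ω
  τ_mono : ∀ (l : Fin L) (ω), τ l.castSucc ω ≤ τ l.succ ω
  τ_le : ∀ ω, τ (Fin.last L) ω ≤ T
  τ_stop : ∀ l, IsStopPlus T (τ l)
  coeff_bdd : ∀ l, ∃ C : ℝ, ∀ ω, |coeff l ω| ≤ C
  coeff_meas : ∀ l : Fin L, MeasAtStopPlus T (τ l.castSucc) (coeff l)

/-- The pathwise stochastic integral `(H · X)_t(ω)` of a simple strategy against a process. -/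
def integ (H : SimpleStrategy T) (X : ℝ → Path T → ℝ) (t : ℝ) (ω : Path T) : ℝ :=
  ∑ l : Fin H.L, H.coeff l ω *
    (X (min (H.τ l.succ ω) t) ω - X (min (H.τ l.castSucc ω) t) ω)

/-- The canonical process `S_t(ω) = ω(t)`. -/
def Sproc (t : ℝ) (ω : Path T) : ℝ := ev T hT ω t

/-- `X` is a `Q`-`𝔽`-martingale (on the time interval `[0,T]`). -/
def IsMart (Q : Measure (Path T)) (X : ℝ → Path T → ℝ) : Prop :=
  (∀ t ∈ Set.Icc (0:ℝ) T, Integrable (X t) Q) ∧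
  ∀ s t : ℝ, s ∈ Set.Icc (0:ℝ) T → t ∈ Set.Icc (0:ℝ) T → s ≤ t →
    ∀ A : Set (Path T), MeasurableSet[Fraw T s] A →
      ∫ ω in A, X t ω ∂Q = ∫ ω in A, X s ω ∂Q

/-- `X` is a `Q`-`𝔽`-local martingale: there are `𝔽`-stopping times increasing `Q`-a.s.
to `∞` such that each stopped process is a `Q`-`𝔽`-martingale. -/
def IsLocalMart (Q : Measure (Path T)) (X : ℝ → Path T → ℝ) : Prop :=
  ∃ τ : ℕ → Path T → ℝ,
    (∀ m, IsStopRaw T (τ m)) ∧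
    (∀ᵐ ω ∂Q, Monotone (fun m => τ m ω) ∧ Tendsto (fun m => τ m ω) atTop atTop) ∧
    (∀ m, IsMart T Q (fun t ω => X (min (τ m ω) t) ω))

/-- The set `M(Ξ)` of local martingale measures concentrated on `Ξ`. -/
def MSet (Ξ : Set (Path T)) : Set (Measure (Path T)) :=
  {Q | IsProbabilityMeasure Q ∧ IsLocalMart T Q (Sproc T hT) ∧ Q Ξ = 1}

/-- The set `M_Z(Ξ)` of local martingale measures concentrated on `Ξ` with `E_Q[Z] < ∞`. -/
def MZSet (Ξ : Set (Path T)) (Z : Path T → ℝ≥0∞) : Set (Measure (Path T)) :=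
  {Q | IsProbabilityMeasure Q ∧ IsLocalMart T Q (Sproc T hT) ∧ Q Ξ = 1 ∧
       ∫⁻ ω, Z ω ∂Q ≠ ⊤}

/-- The stopped path `ω^t(s) = ω(t ∧ s)`. -/
def stopPath (ω : Path T) (t : Set.Icc (0:ℝ) T) : Path T :=
  ⟨fun s => ω ⟨min t.1 s.1, le_min t.2.1 s.2.1, (min_le_left _ _).trans t.2.2⟩,
    ω.continuous.comp ((continuous_const.min continuous_subtype_val).subtype_mk _)⟩

/-- Assumption A on the prediction set `Ξ` and its lift `Ξ̄`. -/
structure AssumptionA (Ξ : Set (Path T)) (Xibar : Set (Path T × Path T)) : Prop where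
  xi_nonempty : Ξ.Nonempty
  xibar_nonempty : Xibar.Nonempty
  xi_eq : Ξ = {ω ∈ BigOmega T hT | (ω, qv T hT ω) ∈ Xibar}
  A1 : ∃ K : ℕ → Set (Path T × Path T), (∀ n, IsCompact (K n)) ∧ Xibar = ⋃ n, K n
  A2 : ∀ p ∈ Xibar, p.2 (t0 T hT) = 0 ∧ Monotone p.2
  A3 : ∀ p ∈ Xibar, ∀ t : Set.Icc (0:ℝ) T, (stopPath T p.1 t, stopPath T p.2 t) ∈ Xibar

/-! ### The enlarged space -/

/-- The enlarged space `Ω̄ = C[0,T] × C[0,T]`. -/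
abbrev PathPair (T : ℝ) := Path T × Path T

/-- The embedding `ψ(ω) = (ω, ⟨ω⟩)`. -/
def psiMap (ω : Path T) : PathPair T := (ω, qv T hT ω)

/-- The diagonal set `Δ̄ = ψ(Ω)`. -/
def Delta : Set (PathPair T) := psiMap T hT '' BigOmega T hT

/-- The first canonical process `S̄_t(ω,ν) = ω(t)` on the enlarged space. -/
def SbarProc (t : ℝ) (p : PathPair T) : ℝ := ev T hT p.1 t

/-- The second canonical process `V̄_t(ω,ν) = ν(t)` on the enlarged space. -/
def VbarProc (t : ℝ) (p : PathPair T) : ℝ := ev T hT p.2 t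

/-- The process `𝕊̄ = (S̄² - S̄_0² - V̄)/2` on the enlarged space. -/
def SSbarProc (t : ℝ) (p : PathPair T) : ℝ :=
  ((ev T hT p.1 t) ^ 2 - (ev T hT p.1 0) ^ 2 - ev T hT p.2 t) / 2

/-- The raw filtration `F̄_t = σ(S̄_s, V̄_s : s ≤ t)` on the enlarged space. -/
def FbarRaw (t : ℝ) : MeasurableSpace (PathPair T) :=
  ⨆ (s : Set.Icc (0:ℝ) T) (_ : (s : ℝ) ≤ t),
    MeasurableSpace.comap (fun p : PathPair T => (p.1 s, p.2 s)) inferInstance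

/-- The right-continuous filtration `F̄_{t+} = ⋂_{s>t} F̄_{s ∧ T}` on the enlarged space. -/
def FbarPlus (t : ℝ) : MeasurableSpace (PathPair T) :=
  ⨅ (s : ℝ) (_ : t < s), FbarRaw T (min s T)

/-- The σ-field generated by all subsets of `Δ̄ᶜ`. -/
def nullDelta : MeasurableSpace (PathPair T) :=
  MeasurableSpace.generateFrom {N : Set (PathPair T) | N ⊆ (Delta T hT)ᶜ}

/-- The `Δ̄`-augmented raw filtration `F̄^Δ_t`. -/
def FbarDelta (t : ℝ) : MeasurableSpace (PathPair T) := FbarRaw T t ⊔ nullDelta T hT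

/-- The `Δ̄`-augmented right-continuous filtration `F̄^Δ_{t+}`. -/
def FbarDeltaPlus (t : ℝ) : MeasurableSpace (PathPair T) := FbarPlus T t ⊔ nullDelta T hT

/-- `τ` is a stopping time for the raw filtration `𝔽̄` on the enlarged space. -/
def IsStopBarRaw (τ : PathPair T → ℝ) : Prop :=
  ∀ t ∈ Set.Icc (0:ℝ) T, MeasurableSet[FbarRaw T t] {p | τ p ≤ t}

/-- `τ` is a stopping time for the filtration `𝔽̄₊^Δ`. -/
def IsStopBarDeltaPlus (τ : PathPair T → ℝ) : Prop :=
  ∀ t ∈ Set.Icc (0:ℝ) T, MeasurableSet[FbarDeltaPlus T hT t] {p | τ p ≤ t}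

/-- `f` is measurable with respect to `F̄^Δ_{τ+}`. -/
def MeasAtStopBarDeltaPlus (τ f : PathPair T → ℝ) : Prop :=
  ∀ B : Set ℝ, MeasurableSet B → ∀ t ∈ Set.Icc (0:ℝ) T,
    MeasurableSet[FbarDeltaPlus T hT t] (f ⁻¹' B ∩ {p | τ p ≤ t})

/-- The set `ℋ̄` of simple strategies on the enlarged space. -/
structure SimpleStrategyBar where
  L : ℕ
  τ : Fin (L + 1) → PathPair T → ℝ
  coeff : Fin L → PathPair T → ℝ
  τ_nonneg : ∀ p, 0 ≤ τ 0 p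
  τ_mono : ∀ (l : Fin L) (p), τ l.castSucc p ≤ τ l.succ p
  τ_le : ∀ p, τ (Fin.last L) p ≤ T
  τ_stop : ∀ l, IsStopBarDeltaPlus T hT (τ l)
  coeff_bdd : ∀ l, ∃ C : ℝ, ∀ p, |coeff l p| ≤ C
  coeff_meas : ∀ l : Fin L, MeasAtStopBarDeltaPlus T hT (τ l.castSucc) (coeff l)

/-- The pathwise stochastic integral on the enlarged space. -/
def integBar (H : SimpleStrategyBar T hT) (X : ℝ → PathPair T → ℝ) (t : ℝ)
    (p : PathPair T) : ℝ :=
  ∑ l : Fin H.L, H.coeff l p *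
    (X (min (H.τ l.succ p) t) p - X (min (H.τ l.castSucc p) t) p)

/-- `X` is a `Q̄`-`𝔽̄`-martingale on the enlarged space. -/
def IsMartBar (Q : Measure (PathPair T)) (X : ℝ → PathPair T → ℝ) : Prop :=
  (∀ t ∈ Set.Icc (0:ℝ) T, Integrable (X t) Q) ∧
  ∀ s t : ℝ, s ∈ Set.Icc (0:ℝ) T → t ∈ Set.Icc (0:ℝ) T → s ≤ t →
    ∀ A : Set (PathPair T), MeasurableSet[FbarRaw T s] A →
      ∫ p in A, X t p ∂Q = ∫ p in A, X s p ∂Q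

/-- `X` is a `Q̄`-`𝔽̄`-local martingale on the enlarged space. -/
def IsLocalMartBar (Q : Measure (PathPair T)) (X : ℝ → PathPair T → ℝ) : Prop :=
  ∃ τ : ℕ → PathPair T → ℝ,
    (∀ m, IsStopBarRaw T (τ m)) ∧
    (∀ᵐ p ∂Q, Monotone (fun m => τ m p) ∧ Tendsto (fun m => τ m p) atTop atTop) ∧
    (∀ m, IsMartBar T Q (fun t p => X (min (τ m p) t) p))

/-- The set `M̄(Ξ̄)` of measures on the enlarged space under which `S̄` and `𝕊̄` are local
martingales and which are concentrated on `Ξ̄`. -/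
def MbarSet (Xibar : Set (PathPair T)) : Set (Measure (PathPair T)) :=
  {Q | IsProbabilityMeasure Q ∧ IsLocalMartBar T Q (SbarProc T hT) ∧
       IsLocalMartBar T Q (SSbarProc T hT) ∧ Q Xibar = 1}

/-- The set `M̄_{Z̄}(Ξ̄)`. -/
def MbarZSet (Xibar : Set (PathPair T)) (Zbar : PathPair T → ℝ≥0∞) :
    Set (Measure (PathPair T)) :=
  {Q | IsProbabilityMeasure Q ∧ IsLocalMartBar T Q (SbarProc T hT) ∧
       IsLocalMartBar T Q (SSbarProc T hT) ∧ Q Xibar = 1 ∧ ∫⁻ p, Zbar p ∂Q ≠ ⊤}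

/-! ### Expectations and superhedging functionals -/

/-- The positive part of an extended real number, as an element of `[0,∞]`. -/
def erealPos (x : EReal) : ℝ≥0∞ := if x = ⊤ then ⊤ else ENNReal.ofReal x.toReal

/-- The expectation `E_Q[ξ]` of an extended-real-valued random variable, as an
extended real number (positive part minus negative part). -/
def expEReal {α : Type*} [MeasurableSpace α] (Q : Measure α) (ξ : α → EReal) : EReal :=
  ((∫⁻ x, erealPos (ξ x) ∂Q : ℝ≥0∞) : EReal) - ((∫⁻ x, erealPos (-ξ x) ∂Q : ℝ≥0∞) : EReal)

/-- The set of initial capitals `λ` that allow superhedging `ξ` on `Ξ`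
(trading in `S` and `𝕊` with simple strategies, in the liminf sense). -/
def PhiSet (Ξ : Set (Path T)) (ξ : Path T → EReal) : Set ℝ :=
  {lam : ℝ | ∃ H G : ℕ → SimpleStrategy T,
    (∀ n : ℕ, ∀ t ∈ Set.Icc (0:ℝ) T, ∀ ω ∈ Ξ,
      0 ≤ lam + integ T (H n) (Sproc T hT) t ω + integ T (G n) (SS T hT) t ω) ∧
    (∀ ω ∈ Ξ, ξ ω ≤ (lam : EReal) +
      Filter.liminf (fun n =>
        ((integ T (H n) (Sproc T hT) T ω + integ T (G n) (SS T hT) T ω : ℝ) : EReal))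
        Filter.atTop)}

/-- The superhedging price `Φ(ξ)`. -/
def Phi (Ξ : Set (Path T)) (ξ : Path T → EReal) : EReal :=
  sInf ((fun lam : ℝ => (lam : EReal)) '' PhiSet T hT Ξ ξ)

/-- The supremum of the pricing functionals `E_Q[ξ]` over `Q ∈ M(Ξ)`,
for a nonnegative claim `ξ`. -/
def supMart (Ξ : Set (Path T)) (ξ : Path T → ℝ≥0∞) : ℝ≥0∞ :=
  ⨆ Q ∈ MSet T hT Ξ, ∫⁻ ω, ξ ω ∂Q

/-- The liminf-closure `𝒢^Ξ_λ`: the smallest set of functions `C[0,T] → [-∞,∞]`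
containing `λ + (H·S)_T` for admissible simple `H` and closed under countable liminf. -/
inductive GG (Ξ : Set (Path T)) (lam : ℝ) : (Path T → EReal) → Prop
  | base (H : SimpleStrategy T)
      (hadm : ∀ t ∈ Set.Icc (0:ℝ) T, ∀ ω ∈ Ξ, 0 ≤ lam + integ T H (Sproc T hT) t ω) :
      GG Ξ lam (fun ω => ((lam + integ T H (Sproc T hT) T ω : ℝ) : EReal))
  | lim (X : ℕ → Path T → EReal) (h : ∀ n, GG Ξ lam (X n)) :
      GG Ξ lam (fun ω => Filter.liminf (fun n => X n ω) Filter.atTop)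

/-- The superhedging price `Φ^cl(ξ)` defined via the liminf-closure. -/
def PhiCl (Ξ : Set (Path T)) (ξ : Path T → EReal) : EReal :=
  sInf {x : EReal | ∃ lam : ℝ, x = (lam : EReal) ∧
    ∃ Y : Path T → EReal, GG T hT Ξ lam Y ∧ ∀ ω ∈ Ξ, ξ ω ≤ Y ω}


/-- The set of initial capitals allowing superhedging on the enlarged space
(superhedging on `Δ̄ ∩ Ξ̄`). -/
def PhiBarSet (Xibar : Set (PathPair T)) (ξ : PathPair T → EReal) : Set ℝ :=
  {lam : ℝ | ∃ H G : ℕ → SimpleStrategyBar T hT,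
    (∀ n : ℕ, ∀ t ∈ Set.Icc (0:ℝ) T, ∀ p ∈ Delta T hT ∩ Xibar,
      0 ≤ lam + integBar T hT (H n) (SbarProc T hT) t p
            + integBar T hT (G n) (SSbarProc T hT) t p) ∧
    (∀ p ∈ Delta T hT ∩ Xibar, ξ p ≤ (lam : EReal) +
      Filter.liminf (fun n =>
        ((integBar T hT (H n) (SbarProc T hT) T p
          + integBar T hT (G n) (SSbarProc T hT) T p : ℝ) : EReal)) Filter.atTop)}

/-- The superhedging price `Φ̄(ξ̄)` on the enlarged space. -/
def PhiBar (Xibar : Set (PathPair T)) (ξ : PathPair T → EReal) : EReal :=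
  sInf ((fun lam : ℝ => (lam : EReal)) '' PhiBarSet T hT Xibar ξ)

/-- The supremum of pricing functionals over `M̄(Ξ̄)` for a nonnegative claim. -/
def supMartBar (Xibar : Set (PathPair T)) (ξ : PathPair T → ℝ≥0∞) : ℝ≥0∞ :=
  ⨆ Q ∈ MbarSet T hT Xibar, ∫⁻ p, ξ p ∂Q

/-- Assumption B on the prediction set `Ξ`, determined by a growth function `Z̄`
(with values in `[1,∞]`). -/
structure AssumptionB (Ξ : Set (Path T)) (Zbar : PathPair T → ℝ≥0∞) : Prop where
  xi_nonempty : Ξ.Nonempty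
  one_le : ∀ p, 1 ≤ Zbar p
  xi_eq : Ξ = {ω ∈ BigOmega T hT | Zbar (ω, qv T hT ω) ≠ ⊤}
  B1 : ∀ c : ℝ≥0∞, c ≠ ⊤ → IsCompact {p : PathPair T | Zbar p ≤ c}
  B2 : ∀ p : PathPair T, Zbar p ≠ ⊤ → p.2 (t0 T hT) = 0 ∧ Monotone p.2
  B3 : ∀ p : PathPair T, ENNReal.ofReal (‖p.1‖ + ‖p.2‖) ≤ Zbar p

/-- The set of initial capitals allowing `Z`-admissible superhedging of `ξ` on `Ξ`. -/
def PhiZSet (Ξ : Set (Path T)) (Z : Path T → ℝ≥0∞) (ξ : Path T → EReal) : Set ℝ :=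
  {lam : ℝ | ∃ c : ℝ, 0 ≤ c ∧ ∃ H G : ℕ → SimpleStrategy T,
    (∀ n : ℕ, ∀ ω ∈ Ξ,
      -(c * (Z ω).toReal) ≤
        lam + integ T (H n) (Sproc T hT) T ω + integ T (G n) (SS T hT) T ω) ∧
    (∀ ω ∈ Ξ, ξ ω ≤ (lam : EReal) +
      Filter.liminf (fun n =>
        ((integ T (H n) (Sproc T hT) T ω + integ T (G n) (SS T hT) T ω : ℝ) : EReal))
        Filter.atTop)}

/-- The superhedging price `Φ^Z(ξ)`. -/
def PhiZ (Ξ : Set (Path T)) (Z : Path T → ℝ≥0∞) (ξ : Path T → EReal) : EReal :=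
  sInf ((fun lam : ℝ => (lam : EReal)) '' PhiZSet T hT Ξ Z ξ)

/-- The `α`-Hölder norm `‖ω‖_α = |ω(0)| + sup_{s ≠ t} |ω(t) - ω(s)| / |t-s|^α`,
with values in `[0,∞]`. -/
def holderNormE (α : ℝ) (ω : Path T) : ℝ≥0∞ :=
  ENNReal.ofReal |ω (t0 T hT)| +
    ⨆ (s : Set.Icc (0:ℝ) T) (t : Set.Icc (0:ℝ) T) (_ : s ≠ t),
      ENNReal.ofReal (|ω t - ω s| / |t.1 - s.1| ^ α)

/-- The set of Hölder continuous paths `⋃_n { ω : ‖ω‖_{1/n} ≤ n }`. -/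
def CHolder : Set (Path T) :=
  ⋃ n : ℕ, {ω : Path T | 0 < n ∧ holderNormE T hT (1 / n) ω ≤ (n : ℝ≥0∞)}

end PathwiseSuperhedging

namespace PathwiseSuperhedging

section basics
variable {T : ℝ} (hT : 0 ≤ T)

/-- path stopped at a real time -/
def stp (s : ℝ) (ω : Path T) : Path T := stopPath T ω (clamp T hT s)

lemma clamp_val (t : ℝ) : ((clamp T hT t : Set.Icc (0:ℝ) T) : ℝ) = max 0 (min T t) := by
  simp [clamp, Set.coe_projIcc]

lemma clamp_of_mem {t : ℝ} (h : t ∈ Set.Icc (0:ℝ) T) : clamp T hT t = ⟨t, h⟩ :=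
  Set.projIcc_of_mem hT h

lemma clamp_coe (t : Set.Icc (0:ℝ) T) : clamp T hT (t : ℝ) = t := Set.projIcc_val hT t

lemma continuous_clamp : Continuous (clamp T hT) := continuous_projIcc (h := hT)

lemma clamp_of_ge {t : ℝ} (h : T ≤ t) : clamp T hT t = clamp T hT T := by
  apply Subtype.ext; simp [clamp_val, h]

lemma clamp_of_le {t : ℝ} (h : t ≤ 0) : clamp T hT t = clamp T hT 0 := by
  apply Subtype.ext; simp [clamp_val, h, hT]

lemma ev_of_ge (ω : Path T) {t : ℝ} (h : T ≤ t) : ev T hT ω t = ev T hT ω T := by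
  simp only [ev, clamp_of_ge hT h]

lemma ev_of_le (ω : Path T) {t : ℝ} (h : t ≤ 0) : ev T hT ω t = ev T hT ω 0 := by
  simp only [ev, clamp_of_le hT h]

lemma ev_coe (ω : Path T) (t : Set.Icc (0:ℝ) T) : ev T hT ω (t:ℝ) = ω t := by
  simp only [ev, clamp_coe]

lemma ev_clamp (ω : Path T) (t : ℝ) : ev T hT ω (clamp T hT t : ℝ) = ev T hT ω t := by
  simp only [ev, clamp_coe]

lemma continuous_ev (ω : Path T) : Continuous (ev T hT ω) :=
  ω.continuous.comp (continuous_clamp hT)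

lemma continuous_ev_left (t : ℝ) : Continuous (fun ω : Path T => ev T hT ω t) :=
  continuous_eval_const (clamp T hT t)

lemma continuous_ev_joint : Continuous (fun p : Path T × ℝ => ev T hT p.1 p.2) := by
  have : Continuous (fun p : Path T × ℝ => p.1 (clamp T hT p.2)) :=
    continuous_fst.eval ((continuous_clamp hT).comp continuous_snd)
  exact this

lemma ev_stp (s : ℝ) (ω : Path T) (t : ℝ) : ev T hT (stp hT s ω) t = ev T hT ω (min s t) := by
  simp only [ev, stp, stopPath, ContinuousMap.coe_mk]
  congr 1
  apply Subtype.ext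
  simp only [clamp_val]
  rcases le_total s t with h | h <;> simp only [min_eq_left h, min_eq_right h] <;>
  [ (rw [min_eq_left]); (rw [min_eq_right])] <;> gcongr

lemma path_ext {ω ω' : Path T} (h : ∀ t, ev T hT ω t = ev T hT ω' t) : ω = ω' := by
  ext t
  have := h t
  simpa only [ev_coe] using this

lemma path_ext' {ω ω' : Path T} (h : ∀ t ∈ Set.Icc (0:ℝ) T, ev T hT ω t = ev T hT ω' t) :
    ω = ω' := by
  ext t
  have := h t t.2
  simpa only [ev_coe] using this

lemma stp_stp (s t : ℝ) (ω : Path T) : stp hT s (stp hT t ω) = stp hT (min s t) ω := by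
  apply path_ext hT
  intro u
  simp only [ev_stp]
  congr 1
  rw [← min_assoc, min_comm t s]

lemma stp_of_ge {s : ℝ} (h : T ≤ s) (ω : Path T) : stp hT s ω = ω := by
  apply path_ext' hT
  intro t ht
  rw [ev_stp, min_eq_right (ht.2.trans h)]

lemma continuous_stp_joint : Continuous (fun p : Path T × ℝ => stp hT p.2 p.1) := by
  apply ContinuousMap.continuous_of_continuous_uncurry
  have : (Function.uncurry fun (p : Path T × ℝ) (t : Set.Icc (0:ℝ) T) => stp hT p.2 p.1 t)
      = fun q : (Path T × ℝ) × Set.Icc (0:ℝ) T => ev T hT q.1.1 (min q.1.2 q.2) := by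
    funext q
    rw [← ev_stp, ev_coe]; rfl
  rw [this]
  exact (continuous_ev_joint hT).comp (by fun_prop : Continuous
    (fun q : (Path T × ℝ) × Set.Icc (0:ℝ) T => (q.1.1, min q.1.2 (q.2:ℝ))))

lemma continuous_stp (s : ℝ) : Continuous (stp hT s : Path T → Path T) :=
  (continuous_stp_joint hT).comp (by fun_prop : Continuous (fun ω : Path T => (ω, s)))

lemma measurable_path {α : Type*} {m : MeasurableSpace α} {f : α → Path T}
    (h : ∀ t, Measurable (fun a => f a t)) : Measurable f := by
  have hball : ∀ (c : Path T) (r : ℝ), 0 ≤ r → MeasurableSet (f ⁻¹' Metric.closedBall c r) := by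
    intro c r hr
    by_cases hne : Nonempty (Set.Icc (0:ℝ) T)
    · have : f ⁻¹' Metric.closedBall c r =
          ⋂ n : ℕ, {a | dist (f a (TopologicalSpace.denseSeq (Set.Icc (0:ℝ) T) n))
            (c (TopologicalSpace.denseSeq (Set.Icc (0:ℝ) T) n)) ≤ r} := by
        ext a
        simp only [mem_preimage, Metric.mem_closedBall, mem_iInter, mem_setOf_eq]
        rw [ContinuousMap.dist_le hr]
        refine ⟨fun h n => h _, fun h t => ?_⟩
        have hcl : IsClosed {t | dist (f a t) (c t) ≤ r} :=
          isClosed_le (by fun_prop) continuous_const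
        have hd := TopologicalSpace.denseRange_denseSeq (Set.Icc (0:ℝ) T)
        have : closure (range (TopologicalSpace.denseSeq (Set.Icc (0:ℝ) T))) ⊆
            {t | dist (f a t) (c t) ≤ r} :=
          hcl.closure_subset_iff.2 (by rintro _ ⟨n, rfl⟩; exact h n)
        exact this (hd t)
      rw [this]
      refine MeasurableSet.iInter fun n => ?_
      exact measurableSet_le ((h _).dist measurable_const) measurable_const
    · have : f ⁻¹' Metric.closedBall c r = univ := by
        ext a
        simp only [mem_preimage, Metric.mem_closedBall, mem_univ, iff_true]
        rw [ContinuousMap.dist_le hr]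
        intro t; exact (hne ⟨t⟩).elim
      rw [this]; exact MeasurableSet.univ
  apply measurable_of_isOpen
  intro U hU
  have : U = ⋃ (p : ℕ × ℕ) (_ : Metric.closedBall
      (TopologicalSpace.denseSeq (Path T) p.1) (1/((p.2:ℝ)+1)) ⊆ U),
      Metric.closedBall (TopologicalSpace.denseSeq (Path T) p.1) (1/((p.2:ℝ)+1)) := by
    apply Subset.antisymm
    · intro x hx
      obtain ⟨ε, hε, hsub⟩ := Metric.isOpen_iff.1 hU x hx
      obtain ⟨n, hn⟩ := exists_nat_one_div_lt (half_pos hε)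
      obtain ⟨i, hi⟩ := (TopologicalSpace.denseRange_denseSeq (Path T)).exists_dist_lt x
        (show (0:ℝ) < 1/((n:ℝ)+1) by positivity)
      refine mem_iUnion₂.2 ⟨(i, n), ?_, ?_⟩
      · intro y hy
        apply hsub
        simp only [Metric.mem_closedBall, Metric.mem_ball] at hy ⊢
        have := dist_triangle y (TopologicalSpace.denseSeq (Path T) i) x
        rw [dist_comm] at hi
        linarith
      · exact hi.le
    · exact iUnion₂_subset fun p hp => hp
  rw [this, preimage_iUnion₂]
  exact MeasurableSet.iUnion fun p => MeasurableSet.iUnion fun _ => hball _ _ (by positivity)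

lemma fraw_le (t : ℝ) : Fraw T t ≤ (inferInstance : MeasurableSpace (Path T)) := by
  refine iSup₂_le fun s _ => ?_
  rw [← measurable_iff_comap_le]
  exact (continuous_eval_const s).measurable

lemma fraw_mono {s t : ℝ} (h : s ≤ t) : Fraw T s ≤ Fraw T t :=
  iSup₂_le fun u hu => le_iSup₂_of_le u (hu.trans h) le_rfl

lemma fraw_eval {t : ℝ} (s : Set.Icc (0:ℝ) T) (h : (s:ℝ) ≤ t) :
    Measurable[Fraw T t] (fun ω : Path T => ω s) := by
  rw [measurable_iff_comap_le]
  exact le_iSup₂_of_le (f := fun (s : Set.Icc (0:ℝ) T) (_ : (s : ℝ) ≤ t) =>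
    MeasurableSpace.comap (fun ω : Path T => ω s) inferInstance) s h le_rfl

lemma fraw_stp {s : ℝ} (hs : 0 ≤ s) :
    Measurable[Fraw T s] (stp hT s : Path T → Path T) := by
  apply measurable_path
  intro t
  refine fraw_eval _ ?_
  simp only [clamp_val]
  exact (min_le_left _ _).trans (max_le hs (min_le_right _ _))

lemma fraw_of_stp {β : Type*} [MeasurableSpace β] {s : ℝ} (hs : 0 ≤ s) {f : Path T → β}
    (hf : Measurable f) (h : ∀ ω, f (stp hT s ω) = f ω) : Measurable[Fraw T s] f := by
  have : f = f ∘ (stp hT s) := by funext ω; exact (h ω).symm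
  rw [this]
  exact hf.comp (fraw_stp hT hs)

lemma stp_mem_iff {s : ℝ} {A : Set (Path T)} (hA : MeasurableSet[Fraw T s] A)
    (ω : Path T) : stp hT s ω ∈ A ↔ ω ∈ A := by
  have key : Fraw T s ≤ MeasurableSpace.mk (fun A => ∀ ω : Path T, stp hT s ω ∈ A ↔ ω ∈ A)
      (by simp) (fun A h ω => not_congr (h ω)) (fun f h ω => by simp [h]) := by
    refine iSup₂_le fun u hu => ?_
    rintro _ ⟨B, hB, rfl⟩ ω
    have : stp hT s ω u = ω u := by
      rw [← ev_coe hT, ← ev_coe hT ω, ev_stp, min_eq_right hu]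
    simp only [mem_preimage, this]
  exact key A hA ω

end basics


section sigma
variable {T : ℝ} (hT : 0 ≤ T)

def hitE (ε : ℝ) (ω : Path T) (s : ℝ) : ℝ :=
  sInf ({t : ℝ | s ≤ t ∧ t ≤ T ∧ ε ≤ |ev T hT ω t - ev T hT ω s|} ∪ {T + 1})

lemma hit_bdd (ε : ℝ) (ω : Path T) (s : ℝ) :
    BddBelow ({t : ℝ | s ≤ t ∧ t ≤ T ∧ ε ≤ |ev T hT ω t - ev T hT ω s|} ∪ {T + 1}) := by
  refine ⟨min s (T+1), ?_⟩
  rintro t (⟨h, -, -⟩ | h)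
  · exact (min_le_left _ _).trans h
  · rw [mem_singleton_iff.1 h]; exact min_le_right _ _

lemma hit_mem (ε : ℝ) (ω : Path T) (s : ℝ) :
    hitE hT ε ω s ∈ ({t : ℝ | s ≤ t ∧ t ≤ T ∧ ε ≤ |ev T hT ω t - ev T hT ω s|} ∪ {T + 1}) := by
  apply IsClosed.csInf_mem _ ⟨T+1, Or.inr rfl⟩ (hit_bdd hT ε ω s)
  refine IsClosed.union ?_ isClosed_singleton
  refine IsClosed.and (isClosed_le continuous_const continuous_id)
    (IsClosed.and (isClosed_le continuous_id continuous_const)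
      (isClosed_le continuous_const ?_))
  exact ((continuous_ev hT ω).sub continuous_const).abs

lemma hit_le (ε : ℝ) (ω : Path T) (s : ℝ) : hitE hT ε ω s ≤ T + 1 :=
  csInf_le (hit_bdd hT ε ω s) (Or.inr rfl)

lemma hit_le_of {ε : ℝ} {ω : Path T} {s t : ℝ} (h1 : s ≤ t) (h2 : t ≤ T)
    (h3 : ε ≤ |ev T hT ω t - ev T hT ω s|) : hitE hT ε ω s ≤ t :=
  csInf_le (hit_bdd hT ε ω s) (Or.inl ⟨h1, h2, h3⟩)

lemma hit_ge {ε : ℝ} {ω : Path T} {s : ℝ} (h : s ≤ T + 1) : s ≤ hitE hT ε ω s := by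
  rcases hit_mem hT ε ω s with h' | h'
  · exact h'.1
  · rw [mem_singleton_iff.1 h']; exact h

lemma hit_cases (ε : ℝ) (ω : Path T) (s : ℝ) :
    (s ≤ hitE hT ε ω s ∧ hitE hT ε ω s ≤ T ∧
      ε ≤ |ev T hT ω (hitE hT ε ω s) - ev T hT ω s|) ∨ hitE hT ε ω s = T + 1 := by
  rcases hit_mem hT ε ω s with h' | h'
  · exact Or.inl h'
  · exact Or.inr (mem_singleton_iff.1 h')

lemma hit_measurable {ε : ℝ} {f : Path T → ℝ} (hf : Measurable f) (h0 : ∀ ω, 0 ≤ f ω) :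
    Measurable (fun ω => hitE hT ε ω (f ω)) := by
  apply measurable_of_Iic
  intro c
  by_cases hc : T + 1 ≤ c
  · convert MeasurableSet.univ
    ext ω
    simpa using (hit_le hT ε ω (f ω)).trans hc
  · let D : Set ((Path T × ℝ) × Set.Icc (0:ℝ) T) :=
      {q | q.1.2 ≤ q.2 ∧ (q.2:ℝ) ≤ c ∧ ε ≤ |ev T hT q.1.1 q.2 - ev T hT q.1.1 q.1.2|}
    have hD : IsClosed D := by
      refine IsClosed.and (isClosed_le (by fun_prop) (by fun_prop))
        (IsClosed.and (isClosed_le (by fun_prop) (by fun_prop)) (isClosed_le continuous_const ?_))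
      refine Continuous.abs (Continuous.sub ?_ ?_)
      · exact (continuous_ev_joint hT).comp (by fun_prop : Continuous
          (fun q : (Path T × ℝ) × Set.Icc (0:ℝ) T => (q.1.1, (q.2:ℝ))))
      · exact (continuous_ev_joint hT).comp (by fun_prop : Continuous
          (fun q : (Path T × ℝ) × Set.Icc (0:ℝ) T => (q.1.1, q.1.2)))
    have hP : IsClosed (Prod.fst '' D) := isClosedMap_fst_of_compactSpace D hD
    have : (fun ω => hitE hT ε ω (f ω)) ⁻¹' Iic c = (fun ω => (ω, f ω)) ⁻¹' (Prod.fst '' D) := by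
      ext ω
      simp only [mem_preimage, mem_Iic]
      constructor
      · intro h
        rcases hit_cases hT ε ω (f ω) with ⟨h1, h2, h3⟩ | h'
        · exact ⟨((ω, f ω), ⟨hitE hT ε ω (f ω), (h0 ω).trans h1, h2⟩), ⟨h1, h, h3⟩, rfl⟩
        · exact absurd (h' ▸ h) hc
      · rintro ⟨⟨⟨ω', s⟩, t⟩, ⟨h1, h2, h3⟩, h4⟩
        simp only [Prod.mk.injEq] at h4
        obtain ⟨rfl, rfl⟩ := h4
        exact (hit_le_of hT h1 t.2.2 h3).trans h2
    rw [this]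
    exact (measurable_id.prodMk hf) hP.measurableSet

/-- the mesh `2^{-m}` -/
def eps (m : ℕ) : ℝ := (2:ℝ) ^ (-(m:ℤ))

lemma eps_pos (m : ℕ) : 0 < eps m := by unfold eps; positivity

lemma eps_eq (m : ℕ) : eps m = (1/2:ℝ)^m := by
  unfold eps; rw [zpow_neg, zpow_natCast, one_div, inv_pow]

lemma sig_succ (m k : ℕ) (ω : Path T) :
    sig T hT m (k+1) ω = hitE hT (eps m) ω (sig T hT m k ω) := rfl

lemma sig_zero (m : ℕ) (ω : Path T) : sig T hT m 0 ω = 0 := rfl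

lemma sig_le (m k : ℕ) (ω : Path T) : sig T hT m k ω ≤ T + 1 := by
  cases k with
  | zero => rw [sig_zero]; linarith
  | succ k => exact hit_le _ _ _ _

lemma sig_le_succ (m k : ℕ) (ω : Path T) : sig T hT m k ω ≤ sig T hT m (k+1) ω :=
  hit_ge hT (sig_le hT m k ω)

lemma sig_mono (m : ℕ) (ω : Path T) : Monotone (fun k => sig T hT m k ω) :=
  monotone_nat_of_le_succ (fun k => sig_le_succ hT m k ω)

lemma sig_nonneg (m k : ℕ) (ω : Path T) : 0 ≤ sig T hT m k ω :=
  sig_mono hT m ω (Nat.zero_le k)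

lemma sig_measurable (m k : ℕ) : Measurable (sig T hT m k) := by
  induction k with
  | zero => exact measurable_const
  | succ k ih => exact hit_measurable hT ih (sig_nonneg hT m k)

lemma sig_between (m k : ℕ) (ω : Path T) {t : ℝ} (h1 : sig T hT m k ω ≤ t)
    (h2 : t ≤ sig T hT m (k+1) ω) :
    |ev T hT ω t - ev T hT ω (sig T hT m k ω)| ≤ eps m := by
  set s := sig T hT m k ω
  set u := sig T hT m (k+1) ω with hu
  -- claim on Ico
  have hlt : ∀ v, s ≤ v → v < u → v ≤ T → |ev T hT ω v - ev T hT ω s| ≤ eps m := by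
    intro v hv hvu hvT
    by_contra hcon
    push Not at hcon
    exact absurd (hit_le_of hT hv hvT hcon.le) (not_le.2 hvu)
  have hlt2 : ∀ v, s ≤ v → v < u → |ev T hT ω v - ev T hT ω s| ≤ eps m := by
    intro v hv hvu
    by_cases hvT : v ≤ T
    · exact hlt v hv hvu hvT
    · push Not at hvT
      by_cases hsT : s ≤ T
      · rw [ev_of_ge hT ω hvT.le]
        exact hlt T hsT (hvT.trans hvu) le_rfl
      · push Not at hsT
        rw [ev_of_ge hT ω hvT.le, ev_of_ge hT ω hsT.le]
        simpa using (eps_pos m).le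
  rcases h2.lt_or_eq with h | h
  · exact hlt2 t h1 h
  · rcases h1.lt_or_eq with h' | h'
    · have hcl : IsClosed {v | |ev T hT ω v - ev T hT ω s| ≤ eps m} :=
        isClosed_le (((continuous_ev hT ω).sub continuous_const).abs) continuous_const
      have hsub : Set.Ico s t ⊆ {v | |ev T hT ω v - ev T hT ω s| ≤ eps m} :=
        fun v hv => hlt2 v hv.1 (h ▸ hv.2)
      have := hcl.closure_subset_iff.2 hsub
      rw [closure_Ico h'.ne] at this
      exact this ⟨h1, le_rfl⟩
    · rw [← h']; simpa using (eps_pos m).le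

lemma sig_eventually (m : ℕ) (ω : Path T) :
    ∃ K, ∀ k, K ≤ k → sig T hT m k ω = T + 1 := by
  have huc : UniformContinuous (ω : Set.Icc (0:ℝ) T → ℝ) :=
    CompactSpace.uniformContinuous_of_continuous ω.continuous
  obtain ⟨δ, hδ, hd⟩ := Metric.uniformContinuous_iff.1 huc (eps m) (eps_pos m)
  have step : ∀ k, sig T hT m k ω = T + 1 ∨ k * δ ≤ sig T hT m k ω := by
    intro k
    induction k with
    | zero => right; simp [sig_zero]
    | succ k ih =>
      rcases ih with ih | ih
      · left
        exact le_antisymm (sig_le _ _ _ _) (ih ▸ sig_le_succ hT m k ω)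
      · rcases hit_cases hT (eps m) ω (sig T hT m k ω) with ⟨h1, h2, h3⟩ | h
        · right
          rw [sig_succ]
          have h0 := sig_nonneg hT m k ω
          have : δ ≤ hitE hT (eps m) ω (sig T hT m k ω) - sig T hT m k ω := by
            by_contra hcon
            push Not at hcon
            have := hd (a := ⟨hitE hT (eps m) ω (sig T hT m k ω), h0.trans h1, h2⟩)
              (b := ⟨sig T hT m k ω, h0, h1.trans h2⟩) (by
                rw [Subtype.dist_eq, Real.dist_eq, abs_of_nonneg (by simpa using h1)]
                exact hcon)
            rw [Real.dist_eq, ← ev_coe hT, ← ev_coe hT] at this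
            exact absurd h3 (not_le.2 this)
          push_cast
          linarith
        · exact Or.inl h
  obtain ⟨K, hK⟩ := exists_nat_gt ((T+1)/δ)
  refine ⟨K, fun k hk => ?_⟩
  rcases step k with h | h
  · exact h
  · exfalso
    rw [div_lt_iff₀ hδ] at hK
    have : (K:ℝ) * δ ≤ k * δ := by gcongr
    have := sig_le hT m k ω
    linarith

lemma sig_stp (m : ℕ) {s : ℝ} (hs : s ≤ T) (ω : Path T) (k : ℕ) :
    (sig T hT m k ω ≤ s → sig T hT m k (stp hT s ω) = sig T hT m k ω) ∧
    (s < sig T hT m k ω → s < sig T hT m k (stp hT s ω)) := by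
  induction k with
  | zero => simp [sig_zero]
  | succ k ih =>
    by_cases h : sig T hT m k ω ≤ s
    · have e := ih.1 h
      rw [sig_succ, sig_succ, e]
      set a := sig T hT m k ω
      have ha : ev T hT (stp hT s ω) a = ev T hT ω a := by rw [ev_stp, min_eq_right h]
      have key : ∀ t ≤ s, ev T hT (stp hT s ω) t = ev T hT ω t := fun t ht => by
        rw [ev_stp, min_eq_right ht]
      constructor
      · intro h'
        rcases hit_cases hT (eps m) ω a with ⟨h1, h2, h3⟩ | h''
        · apply le_antisymm
          · apply hit_le_of hT h1 h2
            rw [ha, key _ h']; exact h3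
          · rcases hit_cases hT (eps m) (stp hT s ω) a with ⟨g1, g2, g3⟩ | g
            · by_contra hcon
              push Not at hcon
              have gs := hcon.le.trans h'
              rw [ha, key _ gs] at g3
              exact absurd (hit_le_of hT g1 g2 g3) (not_le.2 hcon)
            · rw [g]; exact hit_le _ _ _ _
        · rw [h''] at h'; linarith
      · intro h'
        rcases hit_cases hT (eps m) (stp hT s ω) a with ⟨g1, g2, g3⟩ | g
        · by_contra hcon
          push Not at hcon
          rw [ha, key _ hcon] at g3
          exact absurd (hit_le_of hT g1 g2 g3) (not_le.2 (hcon.trans_lt h'))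
        · rw [g]; linarith
    · push Not at h
      have e := ih.2 h
      refine ⟨fun h' => absurd (h.trans_le (sig_le_succ hT m k ω)) (not_lt.2 h'), fun _ => ?_⟩
      exact e.trans_le (sig_le_succ hT m k _)

end sigma


section Smsec
variable {T : ℝ} (hT : 0 ≤ T)

lemma Sm_eq (m : ℕ) (ω : Path T) : ∃ K0, ∀ K, K0 ≤ K → ∀ t, Sm T hT m t ω =
    ∑ k ∈ Finset.range K, ev T hT ω (sig T hT m k ω) *
    (ev T hT ω (min (sig T hT m (k + 1) ω) t) - ev T hT ω (min (sig T hT m k ω) t)) := by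
  obtain ⟨K0, h⟩ := sig_eventually hT m ω
  refine ⟨K0, fun K hK t => ?_⟩
  rw [Sm]
  apply tsum_eq_sum
  intro k hk
  have hk' : K0 ≤ k := hK.trans (by simpa using hk)
  rw [h k hk', h (k+1) (by omega), sub_self, mul_zero]

lemma Sm_cont (m : ℕ) (ω : Path T) : Continuous (fun t => Sm T hT m t ω) := by
  obtain ⟨K, hK⟩ := Sm_eq hT m ω
  rw [show (fun t => Sm T hT m t ω) = _ from funext (hK K le_rfl)]
  refine continuous_finsetSum _ fun k _ => continuous_const.mul (Continuous.sub ?_ ?_)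
  · exact (continuous_ev hT ω).comp (continuous_const.min continuous_id)
  · exact (continuous_ev hT ω).comp (continuous_const.min continuous_id)

lemma Sm_of_nonpos (m : ℕ) (ω : Path T) {t : ℝ} (ht : t ≤ 0) : Sm T hT m t ω = 0 := by
  obtain ⟨K, hK⟩ := Sm_eq hT m ω
  rw [hK K le_rfl]
  refine Finset.sum_eq_zero fun k _ => ?_
  rw [min_eq_right (ht.trans (sig_nonneg hT m _ ω)), min_eq_right (ht.trans (sig_nonneg hT m _ ω)),
    sub_self, mul_zero]

lemma Sm_stp (m : ℕ) (ω : Path T) {s : ℝ} (hs : s ≤ T) (t : ℝ) :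
    Sm T hT m t (stp hT s ω) = Sm T hT m (min s t) ω := by
  rw [Sm, Sm]
  congr 1
  funext k
  simp only [ev_stp]
  obtain ⟨a1, a2⟩ := sig_stp hT m hs ω k
  obtain ⟨b1, b2⟩ := sig_stp hT m hs ω (k+1)
  have hmono := sig_le_succ hT m k ω
  have hmono' := sig_le_succ hT m k (stp hT s ω)
  by_cases h1 : sig T hT m k ω ≤ s
  · rw [a1 h1, min_eq_right h1]
    have e1 : ∀ x : ℝ, min s (min x t) = min x (min s t) := fun x => by
      rw [← min_assoc, min_comm s x, min_assoc]
    by_cases h2 : sig T hT m (k+1) ω ≤ s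
    · rw [b1 h2, e1, e1]
    · push Not at h2
      rw [e1, e1, min_eq_right ((min_le_left s t).trans (b2 h2).le),
        min_eq_right ((min_le_left s t).trans h2.le)]
  · push Not at h1
    have h1' := a2 h1
    have e1 : ∀ x : ℝ, s < x → min s (min x t) = min s t := fun x hx => by
      rw [← min_assoc, min_eq_left hx.le]
    have e2 : ∀ x : ℝ, s < x → min x (min s t) = min s t := fun x hx => by
      rw [min_eq_right ((min_le_left _ _).trans hx.le)]
    rw [e1 _ h1', e1 _ (h1'.trans_le hmono'), e2 _ h1, e2 _ (h1.trans_le hmono)]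
    simp

/-- `R^m_t` : the last level visited -/
def Rm (m : ℕ) (t : ℝ) (ω : Path T) : ℝ :=
  ∑' k : ℕ, ev T hT ω (sig T hT m k ω) *
    ((if sig T hT m k ω ≤ t then 1 else 0) - (if sig T hT m (k + 1) ω ≤ t then 1 else 0))

lemma Rm_eq (m : ℕ) (ω : Path T) : ∃ K0, ∀ K, K0 ≤ K → ∀ t, Rm hT m t ω =
    ∑ k ∈ Finset.range K, ev T hT ω (sig T hT m k ω) *
    ((if sig T hT m k ω ≤ t then 1 else 0) - (if sig T hT m (k + 1) ω ≤ t then 1 else 0)) := by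
  obtain ⟨K0, h⟩ := sig_eventually hT m ω
  refine ⟨K0, fun K hK t => ?_⟩
  rw [Rm]
  apply tsum_eq_sum
  intro k hk
  have hk' : K0 ≤ k := hK.trans (by simpa using hk)
  rw [h k hk', h (k+1) (by omega), sub_self, mul_zero]

lemma ev_meas_comp {f : Path T → ℝ} (hf : Measurable f) :
    Measurable (fun ω => ev T hT ω (f ω)) :=
  (continuous_ev_joint hT).measurable.comp (measurable_id.prodMk hf)

lemma Rm_measurable (m : ℕ) (t : ℝ) : Measurable (Rm hT m t) := by
  have hm : ∀ K : ℕ, Measurable (fun ω => ∑ k ∈ Finset.range K, ev T hT ω (sig T hT m k ω) *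
    (((if sig T hT m k ω ≤ t then 1 else 0) - (if sig T hT m (k + 1) ω ≤ t then 1 else 0)) : ℝ)) := by
    intro K
    refine Finset.measurable_sum _ fun k _ => (ev_meas_comp hT (sig_measurable hT m k)).mul ?_
    exact (Measurable.ite (measurableSet_le (sig_measurable hT m k) measurable_const)
      measurable_const measurable_const).sub
      (Measurable.ite (measurableSet_le (sig_measurable hT m (k+1)) measurable_const)
      measurable_const measurable_const)
  refine measurable_of_tendsto_metrizable hm ?_
  rw [tendsto_pi_nhds]
  intro ω
  obtain ⟨K0, h⟩ := Rm_eq hT m ω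
  refine tendsto_const_nhds.congr' ?_
  filter_upwards [eventually_ge_atTop K0] with K hK
  exact h K hK t

lemma sig_index (m : ℕ) (ω : Path T) {t : ℝ} (h0 : 0 ≤ t) (ht : t ≤ T) :
    ∃ κ, sig T hT m κ ω ≤ t ∧ t < sig T hT m (κ+1) ω := by
  obtain ⟨K, hK⟩ := sig_eventually hT m ω
  have hex : ∃ k, t < sig T hT m k ω := ⟨K, by rw [hK K le_rfl]; linarith⟩
  have h1 := Nat.find_spec hex
  have h2 : Nat.find hex ≠ 0 := by
    intro h
    rw [h, sig_zero] at h1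
    linarith
  obtain ⟨κ, hκ⟩ := Nat.exists_eq_succ_of_ne_zero h2
  refine ⟨κ, ?_, ?_⟩
  · have := Nat.find_min hex (m := κ) (by omega)
    exact not_lt.1 this
  · rw [hκ] at h1; exact h1

lemma Rm_val (m : ℕ) (ω : Path T) {t : ℝ} {κ : ℕ} (h1 : sig T hT m κ ω ≤ t)
    (h2 : t < sig T hT m (κ+1) ω) : Rm hT m t ω = ev T hT ω (sig T hT m κ ω) := by
  rw [Rm, tsum_eq_single κ]
  · rw [if_pos h1, if_neg (not_le.2 h2)]; ring
  · intro k hk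
    rcases lt_or_gt_of_ne hk with h | h
    · rw [if_pos, if_pos]
      · ring
      · exact (sig_mono hT m ω (by omega : k + 1 ≤ κ)).trans h1
      · exact (sig_mono hT m ω (by omega : k ≤ κ)).trans h1
    · rw [if_neg, if_neg]
      · ring
      · exact not_le.2 (h2.trans_le (sig_mono hT m ω (by omega : κ + 1 ≤ k + 1)))
      · exact not_le.2 (h2.trans_le (sig_mono hT m ω (by omega : κ + 1 ≤ k)))

lemma Rm_near (m : ℕ) (ω : Path T) {t : ℝ} (h0 : 0 ≤ t) (ht : t ≤ T) :
    |Rm hT m t ω - ev T hT ω t| ≤ eps m := by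
  obtain ⟨κ, h1, h2⟩ := sig_index hT m ω h0 ht
  rw [Rm_val hT m ω h1 h2, abs_sub_comm]
  exact sig_between hT m κ ω h1 h2.le

lemma Rm_bound (m : ℕ) (ω : Path T) {t C : ℝ} (h0 : 0 ≤ t) (ht : t ≤ T)
    (hC : ∀ s, 0 ≤ s → s ≤ t → |ev T hT ω s| ≤ C) : |Rm hT m t ω| ≤ C := by
  obtain ⟨κ, h1, h2⟩ := sig_index hT m ω h0 ht
  rw [Rm_val hT m ω h1 h2]
  exact hC _ (sig_nonneg _ _ _ _) h1

lemma Rm_stp (m : ℕ) (ω : Path T) {t : ℝ} (ht : t ≤ T) :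
    Rm hT m t (stp hT t ω) = Rm hT m t ω := by
  rw [Rm, Rm]
  congr 1
  funext k
  have key : ∀ k, (sig T hT m k (stp hT t ω) ≤ t ↔ sig T hT m k ω ≤ t) := fun k => by
    obtain ⟨a1, a2⟩ := sig_stp hT m ht ω k
    constructor
    · intro h; by_contra h'; exact absurd h (not_le.2 (a2 (not_le.1 h')))
    · intro h; rw [a1 h]; exact h
  simp only [key]
  by_cases h : sig T hT m k ω ≤ t
  · rw [(sig_stp hT m ht ω k).1 h, ev_stp, min_eq_right h]
  · rw [if_neg h, if_neg (fun h' => h ((sig_le_succ hT m k ω).trans h'))]; simp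

lemma Rm_fraw (m : ℕ) {t : ℝ} (h0 : 0 ≤ t) (ht : t ≤ T) : Measurable[Fraw T t] (Rm hT m t) :=
  fraw_of_stp hT h0 (Rm_measurable hT m t) (fun ω => Rm_stp hT m ω ht)

/-- dyadic grid -/
def tg (T : ℝ) (n j : ℕ) : ℝ := j * T / 2 ^ n

lemma tg_zero (n : ℕ) : tg T n 0 = 0 := by simp [tg]
lemma tg_last (n : ℕ) : tg T n (2^n) = T := by
  simp [tg]
include hT in
lemma tg_nonneg (n j : ℕ) : 0 ≤ tg T n j := by unfold tg; positivity
include hT in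
lemma tg_mono (n : ℕ) : Monotone (tg T n) := by
  intro i j h; unfold tg; gcongr
include hT in
lemma tg_le {n j : ℕ} (h : j ≤ 2^n) : tg T n j ≤ T :=
  (tg_mono hT n h).trans_eq (tg_last n)
lemma tg_succ (n j : ℕ) : tg T n (j+1) = tg T n j + T / 2^n := by
  unfold tg; push_cast; ring
lemma mesh_tendsto (T : ℝ) : Tendsto (fun n : ℕ => T / 2^n) atTop (𝓝 0) := by
  have := (tendsto_pow_atTop_nhds_zero_of_lt_one (r := (1/2:ℝ)) (by norm_num) (by norm_num)).const_mul T
  simpa [div_eq_mul_inv] using this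

lemma sum_tail (y : ℕ → ℝ) (a N : ℕ) (h : a ≤ N) :
    ∑ j ∈ Finset.range N, (if a ≤ j then (1:ℝ) else 0) * (y (j+1) - y j) = y N - y a := by
  induction N with
  | zero => simp [Nat.le_zero.1 h]
  | succ N ih =>
    rw [Finset.sum_range_succ]
    rcases Nat.lt_or_ge N a with h' | h'
    · have : a = N + 1 := by omega
      subst this
      rw [Finset.sum_eq_zero]
      · simp
      · intro j hj
        have := Finset.mem_range.1 hj
        rw [if_neg (by omega), zero_mul]
    · rw [ih h', if_pos h']; ring

include hT in
lemma cut_tendsto (y : ℝ → ℝ) (hy : Continuous y) (hyT : ∀ t, T ≤ t → y t = y T)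
    (hy0 : ∀ t, t ≤ 0 → y t = y 0) (P : ℝ → Prop) (a : ℝ)
    (hP1 : ∀ t, a < t → P t) (hP2 : ∀ t, t < a → ¬ P t) :
    Tendsto (fun n => ∑ j ∈ Finset.range (2^n), (if P (tg T n j) then (1:ℝ) else 0) *
      (y (tg T n (j+1)) - y (tg T n j))) atTop (𝓝 (y T - y a)) := by
  -- choose cut index
  have hex : ∀ n, ∃ c, c ≤ 2^n ∧ (∀ j < 2^n, (P (tg T n j) ↔ c ≤ j)) ∧
      |tg T n c - max 0 (min T a)| ≤ T/2^n := by
    intro n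
    have hmesh : 0 ≤ T/2^n := by positivity
    have hup : ∀ i j, i ≤ j → P (tg T n i) → ¬ P (tg T n j) → tg T n i = a ∧ tg T n j = a := by
      intro i j hij h1 h2
      have e1 : a ≤ tg T n i := by by_contra h; exact hP2 _ (not_le.1 h) h1
      have e2 : tg T n j ≤ a := by by_contra h; exact h2 (hP1 _ (not_le.1 h))
      have := tg_mono hT n hij
      constructor <;> linarith
    by_cases hE : ∃ j, j < 2^n ∧ P (tg T n j)
    · refine ⟨Nat.find hE, (Nat.find_spec hE).1.le, fun j hj => ⟨fun h => Nat.find_min' hE ⟨hj, h⟩,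
        fun h => ?_⟩, ?_⟩
      · by_contra hcon
        obtain ⟨h1, h2⟩ := hup _ _ h (Nat.find_spec hE).2 hcon
        rw [h2, ← h1] at hcon
        exact hcon (Nat.find_spec hE).2
      · have hs := Nat.find_spec hE
        have e1 : a ≤ tg T n (Nat.find hE) := by by_contra h; exact hP2 _ (not_le.1 h) hs.2
        have e4 := tg_le hT hs.1.le
        rcases Nat.eq_zero_or_pos (Nat.find hE) with h0 | h0
        · rw [h0, tg_zero] at e1 ⊢
          rw [min_eq_right (e1.trans hT), max_eq_left e1]; simpa using hmesh
        · obtain ⟨i, hi⟩ := Nat.exists_eq_succ_of_ne_zero h0.ne'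
          have hm := Nat.find_min hE (m := i) (by omega)
          have e2 : tg T n i ≤ a := by
            by_contra h
            exact hm ⟨by omega, hP1 _ (not_le.1 h)⟩
          have e3 := tg_nonneg hT n i
          rw [min_eq_right (e1.trans e4), max_eq_right (e3.trans e2)]
          rw [hi, Nat.succ_eq_add_one] at e1 ⊢
          rw [tg_succ] at e1 ⊢
          rw [abs_le]; constructor <;> linarith
    · push Not at hE
      refine ⟨2^n, le_rfl, fun j hj => ⟨fun h => absurd h (hE j hj), fun h => absurd hj (by omega)⟩, ?_⟩
      rw [tg_last]
      have hpos : 0 < 2^n := by positivity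
      obtain ⟨i, hi⟩ := Nat.exists_eq_succ_of_ne_zero hpos.ne'
      have e2 : tg T n i ≤ a := by
        by_contra h
        exact hE i (by omega) (hP1 _ (not_le.1 h))
      have e3 := tg_nonneg hT n i
      have e5 : T = tg T n i + T/2^n := by rw [← tg_succ, ← Nat.succ_eq_add_one, ← hi, tg_last]
      rw [max_eq_right (le_min hT (e3.trans e2)), abs_of_nonneg (by simp)]
      rcases le_total T a with h | h
      · rw [min_eq_left h]; simpa using hmesh
      · rw [min_eq_right h]; linarith
  choose c hc1 hc2 hc3 using hex
  have hsum : ∀ n, ∑ j ∈ Finset.range (2^n), (if P (tg T n j) then (1:ℝ) else 0) *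
      (y (tg T n (j+1)) - y (tg T n j)) = y T - y (tg T n (c n)) := by
    intro n
    have h := sum_tail (fun j => y (tg T n j)) (c n) (2^n) (hc1 n)
    simp only [tg_last] at h
    rw [← h]
    refine Finset.sum_congr rfl fun j hj => ?_
    simp only [hc2 n j (Finset.mem_range.1 hj)]
  simp only [hsum]
  have hlim : Tendsto (fun n => tg T n (c n)) atTop (𝓝 (max 0 (min T a))) := by
    rw [tendsto_iff_dist_tendsto_zero]
    exact squeeze_zero (fun n => dist_nonneg) (fun n => hc3 n) (mesh_tendsto T)
  have hya : y a = y (max 0 (min T a)) := by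
    rcases le_total a 0 with h | h
    · rw [hy0 a h, min_eq_right (h.trans hT), max_eq_left h]
    · rcases le_total T a with h' | h'
      · rw [hyT a h', min_eq_left h', max_eq_right hT]
      · rw [min_eq_right h', max_eq_right h]
  rw [hya]
  exact tendsto_const_nhds.sub ((hy.tendsto _).comp hlim)

/-- grid integrals of `S` -/
lemma grid_S (ω : Path T) (ρ u : ℝ) (hρ0 : 0 ≤ ρ) (hρ : ρ ≤ T) :
    Tendsto (fun n => ∑ j ∈ Finset.range (2^n), (if u < tg T n j then (1:ℝ) else 0) *
      (ev T hT ω (min (tg T n (j+1)) ρ) - ev T hT ω (min (tg T n j) ρ))) atTop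
      (𝓝 (ev T hT ω ρ - ev T hT ω (min u ρ))) := by
  have := cut_tendsto hT (fun v => ev T hT ω (min v ρ))
    ((continuous_ev hT ω).comp (continuous_id.min continuous_const))
    (fun t ht => by simp only [min_eq_right (hρ.trans ht), min_eq_right hρ])
    (fun t ht => by
      simp only [min_eq_left (ht.trans hρ0), min_eq_left hρ0]
      exact ev_of_le hT ω ht) (fun t => u < t) u (fun t h => h) (fun t h => not_lt.2 h.le)
  simpa only [min_eq_right hρ] using this

lemma grid_R (m : ℕ) (ω : Path T) (ρ u : ℝ) (hρ0 : 0 ≤ ρ) (hρ : ρ ≤ T) :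
    Tendsto (fun n => ∑ j ∈ Finset.range (2^n),
      ((if u < tg T n j then (1:ℝ) else 0) * Rm hT m (tg T n j) ω) *
      (ev T hT ω (min (tg T n (j+1)) ρ) - ev T hT ω (min (tg T n j) ρ))) atTop
      (𝓝 (Sm T hT m ρ ω - Sm T hT m (min u ρ) ω)) := by
  obtain ⟨K1, hK1⟩ := Sm_eq hT m ω
  obtain ⟨K2, hK2⟩ := Rm_eq hT m ω
  set K := max K1 K2
  set y : ℝ → ℝ := fun v => ev T hT ω (min v ρ) with hy
  have hyc : Continuous y := (continuous_ev hT ω).comp (continuous_id.min continuous_const)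
  have hyT : ∀ t, T ≤ t → y t = y T :=
    (fun t ht => by simp only [hy, min_eq_right (hρ.trans ht), min_eq_right hρ])
  have hy0 : ∀ t, t ≤ 0 → y t = y 0 := (fun t ht => by
      simp only [hy, min_eq_left (ht.trans hρ0), min_eq_left hρ0]
      exact ev_of_le hT ω ht)
  have hcut : ∀ k, Tendsto (fun n => ∑ j ∈ Finset.range (2^n),
      (if u < tg T n j ∧ sig T hT m k ω ≤ tg T n j then (1:ℝ) else 0) *
      (y (tg T n (j+1)) - y (tg T n j))) atTop (𝓝 (y T - y (max u (sig T hT m k ω)))) := by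
    intro k
    have := cut_tendsto hT y hyc hyT hy0 (fun t => u < t ∧ sig T hT m k ω ≤ t)
      (max u (sig T hT m k ω)) ?_ ?_
    · convert this
    · intro t ht
      exact ⟨(le_max_left _ _).trans_lt ht, ((le_max_right _ _).trans_lt ht).le⟩
    · rintro t ht ⟨h1, h2⟩
      exact absurd ht (not_lt.2 (max_le h1.le h2))
  have htot := tendsto_finsetSum (Finset.range K) fun k _ =>
    ((hcut k).sub (hcut (k+1))).const_mul (ev T hT ω (sig T hT m k ω))
  have hswap : ∀ x : ℝ, y (max u x) = y u + y x - y (min u x) := fun x => by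
    rcases le_total u x with h | h
    · rw [max_eq_right h, min_eq_left h]; ring
    · rw [max_eq_left h, min_eq_right h]; ring
  convert htot using 1
  · funext n
    simp only [← Finset.sum_sub_distrib, Finset.mul_sum]
    rw [Finset.sum_comm]
    refine Finset.sum_congr rfl fun j _ => ?_
    rw [hK2 K (le_max_right _ _), Finset.mul_sum, Finset.sum_mul]
    refine Finset.sum_congr rfl fun k _ => ?_
    by_cases h : u < tg T n j
    · simp only [h, true_and, if_true, hy]; ring
    · simp only [h, false_and, if_false, hy]; ring
  · rw [hK1 K (le_max_left _ _), hK1 K (le_max_left _ _), ← Finset.sum_sub_distrib]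
    congr 1
    refine Finset.sum_congr rfl fun k _ => ?_
    rw [hswap, hswap]
    have e : ∀ x : ℝ, y (min u x) = ev T hT ω (min x (min u ρ)) := fun x => by
      simp only [hy]; rw [min_comm u x, min_assoc]
    rw [e, e]
    simp only [hy]; ring

end Smsec


section Lim
variable {T : ℝ} (hT : 0 ≤ T)

lemma Sm_measurable (m : ℕ) {t : ℝ} (h0 : 0 ≤ t) (ht : t ≤ T) :
    Measurable (Sm T hT m t) := by
  refine measurable_of_tendsto_metrizable (f := fun n ω => ∑ j ∈ Finset.range (2^n),
      ((if (-1:ℝ) < tg T n j then (1:ℝ) else 0) * Rm hT m (tg T n j) ω) *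
      (ev T hT ω (min (tg T n (j+1)) t) - ev T hT ω (min (tg T n j) t))) (fun n => ?_) ?_
  · refine Finset.measurable_sum _ fun j _ => ?_
    refine ((Rm_measurable hT m _).const_mul _).mul ?_
    exact ((continuous_ev_left hT _).sub (continuous_ev_left hT _)).measurable
  · rw [tendsto_pi_nhds]
    intro ω
    have := grid_R hT m ω t (-1) h0 ht
    rwa [Sm_of_nonpos hT m ω (t := min (-1) t) ((min_le_left _ _).trans (by norm_num)),
      sub_zero] at this

def SmP (m : ℕ) (ω : Path T) : Path T :=
  ⟨fun t => Sm T hT m (t:ℝ) ω, (Sm_cont hT m ω).comp continuous_subtype_val⟩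

lemma SmP_apply (m : ℕ) (ω : Path T) (t : Set.Icc (0:ℝ) T) : SmP hT m ω t = Sm T hT m t ω := rfl

lemma ev_SmP (m : ℕ) (ω : Path T) {t : ℝ} (ht : t ∈ Set.Icc (0:ℝ) T) :
    ev T hT (SmP hT m ω) t = Sm T hT m t ω := by
  simp only [ev, SmP_apply, clamp_of_mem hT ht]

lemma SmP_measurable (m : ℕ) : Measurable (SmP hT m) := by
  apply measurable_path
  intro t
  exact Sm_measurable hT m t.2.1 t.2.2

lemma SmP_stp (m : ℕ) (ω : Path T) {s : ℝ} (hs0 : 0 ≤ s) (hs : s ≤ T) :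
    SmP hT m (stp hT s ω) = stp hT s (SmP hT m ω) := by
  apply path_ext' hT
  intro t ht
  rw [ev_SmP hT m _ ht, ev_stp, ev_SmP hT m ω ⟨le_min hs0 ht.1, (min_le_left _ _).trans hs⟩,
    Sm_stp hT m ω hs]

instance : SecondCountableTopology (Path T) := inferInstance
instance : CompleteSpace (Path T) := inferInstance

def SSP (ω : Path T) : Path T := limUnder atTop (fun m => SmP hT m ω)

def Cv : Set (Path T) := {ω | ∃ L, Tendsto (fun m => SmP hT m ω) atTop (𝓝 L)}

lemma Cv_measurable : MeasurableSet (Cv hT) :=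
  measurableSet_exists_tendsto (fun m => SmP_measurable hT m)

lemma SSP_measurable : Measurable (SSP hT) :=
  (StronglyMeasurable.limUnder (l := atTop) (f := fun m => SmP hT m)
    (fun m => (SmP_measurable hT m).stronglyMeasurable)).measurable

lemma SSP_tendsto {ω : Path T} (h : ω ∈ Cv hT) :
    Tendsto (fun m => SmP hT m ω) atTop (𝓝 (SSP hT ω)) := tendsto_nhds_limUnder h

lemma SSP_eq {ω L : Path T} (h : Tendsto (fun m => SmP hT m ω) atTop (𝓝 L)) : SSP hT ω = L :=
  h.limUnder_eq

lemma Sm_tendsto_SSP {ω : Path T} (h : ω ∈ Cv hT) {t : ℝ} (ht : t ∈ Set.Icc (0:ℝ) T) :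
    Tendsto (fun m => Sm T hT m t ω) atTop (𝓝 (ev T hT (SSP hT ω) t)) := by
  have := ((continuous_ev_left hT t).tendsto _).comp (SSP_tendsto hT h)
  refine this.congr fun m => ?_
  exact ev_SmP hT m ω ht

lemma SS_eq {ω : Path T} (h : ω ∈ Cv hT) {t : ℝ} (ht : t ∈ Set.Icc (0:ℝ) T) :
    SS T hT t ω = ev T hT (SSP hT ω) t := (Sm_tendsto_SSP hT h ht).liminf_eq

def GP (ω : Path T) : Path T :=
  ω * ω - ContinuousMap.const _ (ev T hT ω 0 ^ 2) - (2:ℝ) • SSP hT ω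

lemma ev_GP (ω : Path T) (t : ℝ) :
    ev T hT (GP hT ω) t = ev T hT ω t ^ 2 - ev T hT ω 0 ^ 2 - 2 * ev T hT (SSP hT ω) t := by
  simp [GP, ev]; ring

lemma GP_measurable : Measurable (GP hT) := by
  apply measurable_path
  intro t
  have h : ∀ ω : Path T, GP hT ω t = ω t ^ 2 - ev T hT ω 0 ^ 2 - 2 * SSP hT ω t := fun ω => by
    have := ev_GP hT ω t
    simpa only [ev_coe] using this
  simp only [h]
  have h1 : Measurable (fun ω : Path T => ω t) := (continuous_eval_const t).measurable
  have h2 := (continuous_ev_left hT (T := T) 0).measurable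
  exact ((h1.pow_const 2).sub (h2.pow_const 2)).sub ((h1.comp (SSP_measurable hT)).const_mul 2)

lemma mem_Omega_iff (ω : Path T) : ω ∈ BigOmega T hT ↔ ω ∈ Cv hT ∧ Monotone (GP hT ω) := by
  have key : ω ∈ Cv hT → (MonotoneOn (qvRaw T hT ω) (Set.Icc (0:ℝ) T) ↔ Monotone (GP hT ω)) := by
    intro h
    have e : ∀ t (ht : t ∈ Set.Icc (0:ℝ) T), qvRaw T hT ω t = GP hT ω ⟨t, ht⟩ := by
      intro t ht
      rw [qvRaw, SS_eq hT h ht, ← ev_GP, ev, clamp_of_mem hT ht]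
    constructor
    · intro hm s t hst
      rw [← e s.1 s.2, ← e t.1 t.2]
      exact hm s.2 t.2 hst
    · intro hm s hs t ht hst
      rw [e s hs, e t ht]
      exact hm hst
  constructor
  · rintro ⟨h1, h2⟩
    have hc : ω ∈ Cv hT := by
      have hcont : Continuous (fun t : Set.Icc (0:ℝ) T => SS T hT (t : ℝ) ω) :=
        h1.continuous (Frequently.of_forall fun m => (SmP hT m ω).continuous)
      refine ⟨⟨_, hcont⟩, ?_⟩
      rw [ContinuousMap.tendsto_iff_tendstoUniformly]
      exact h1
    exact ⟨hc, (key hc).1 h2⟩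
  · rintro ⟨h1, h2⟩
    refine ⟨?_, (key h1).2 h2⟩
    have := (ContinuousMap.tendsto_iff_tendstoUniformly).1 (SSP_tendsto hT h1)
    have e : (fun t : Set.Icc (0:ℝ) T => SS T hT (t : ℝ) ω) = SSP hT ω := by
      funext t
      rw [SS_eq hT h1 t.2, ev_coe]
    rw [e]
    exact this

lemma isClosed_monotone : IsClosed {ν : Path T | Monotone ν} := by
  have : {ν : Path T | Monotone ν} = ⋂ (s : Set.Icc (0:ℝ) T) (t : Set.Icc (0:ℝ) T) (_ : s ≤ t),
      {ν : Path T | ν s ≤ ν t} := by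
    ext ν; simp only [mem_iInter]; exact ⟨fun h s t => @h s t, fun h s t => h s t⟩
  rw [this]
  exact isClosed_iInter fun s => isClosed_iInter fun t => isClosed_iInter fun _ =>
    isClosed_le (continuous_eval_const s) (continuous_eval_const t)

lemma Omega_measurable : MeasurableSet (BigOmega T hT) := by
  have : BigOmega T hT = Cv hT ∩ GP hT ⁻¹' {ν : Path T | Monotone ν} := by
    ext ω; exact mem_Omega_iff hT ω
  rw [this]
  exact (Cv_measurable hT).inter (GP_measurable hT isClosed_monotone.measurableSet)

lemma qv_eq {ω : Path T} (h : ω ∈ BigOmega T hT) : qv T hT ω = GP hT ω := by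
  have hc := ((mem_Omega_iff hT ω).1 h).1
  have e : (fun t : Set.Icc (0:ℝ) T => qvRaw T hT ω (t : ℝ)) = GP hT ω := by
    funext t
    rw [qvRaw, SS_eq hT hc t.2, ← ev_GP, ev_coe]
  have h' : ω ∈ BigOmega T hT ∧ Continuous fun t : Set.Icc (0:ℝ) T => qvRaw T hT ω (t : ℝ) :=
    ⟨h, by rw [e]; exact (GP hT ω).continuous⟩
  rw [qv, dif_pos h']
  ext t
  exact congrFun e t

lemma Cv_stp {ω : Path T} (h : ω ∈ Cv hT) {s : ℝ} (hs0 : 0 ≤ s) (hs : s ≤ T) :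
    SSP hT (stp hT s ω) = stp hT s (SSP hT ω) := by
  apply SSP_eq
  simp only [SmP_stp hT _ ω hs0 hs]
  exact ((continuous_stp hT s).tendsto _).comp (SSP_tendsto hT h)

lemma GP_stp {ω : Path T} (h : ω ∈ Cv hT) {s : ℝ} (hs0 : 0 ≤ s) (hs : s ≤ T) :
    GP hT (stp hT s ω) = stp hT s (GP hT ω) := by
  apply path_ext hT
  intro t
  rw [ev_GP, Cv_stp hT h hs0 hs]
  simp only [ev_stp, ev_GP, min_eq_right hs0]

lemma SSP_SSbar (ω : Path T) (t : ℝ) :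
    SSbarProc T hT t (ω, GP hT ω) = ev T hT (SSP hT ω) t := by
  simp only [SSbarProc, ev_GP]; ring

lemma psi_measurable_on : ∀ ω ∈ BigOmega T hT, psiMap T hT ω = (ω, GP hT ω) := fun ω h => by
  rw [psiMap, qv_eq hT h]

lemma pairGP_measurable : Measurable (fun ω : Path T => ((ω, GP hT ω) : PathPair T)) :=
  measurable_id.prodMk (GP_measurable hT)

lemma Xi_measurable {Ξ : Set (Path T)} {Xibar : Set (PathPair T)}
    (hA : AssumptionA T hT Ξ Xibar) : MeasurableSet Ξ := by
  obtain ⟨K, hK, hU⟩ := hA.A1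
  have hX : MeasurableSet Xibar := by
    rw [hU]; exact MeasurableSet.iUnion fun n => (hK n).isClosed.measurableSet
  have : Ξ = BigOmega T hT ∩ (fun ω : Path T => ((ω, GP hT ω) : PathPair T)) ⁻¹' Xibar := by
    rw [hA.xi_eq]
    ext ω
    constructor
    · rintro ⟨h1, h2⟩
      rw [qv_eq hT h1] at h2
      exact ⟨h1, h2⟩
    · rintro ⟨h1, h2⟩
      refine ⟨h1, ?_⟩
      rw [qv_eq hT h1]
      exact h2
  rw [this]
  exact (Omega_measurable hT).inter (pairGP_measurable hT hX)

end Lim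


section Opt
variable {T : ℝ} (hT : 0 ≤ T)

include hT in
lemma fraw_T {A : Set (Path T)} (hA : MeasurableSet A) : MeasurableSet[Fraw T T] A := by
  have h := fraw_stp hT hT hA
  have e : (stp hT T : Path T → Path T) = id := funext fun ω => stp_of_ge hT le_rfl ω
  rwa [e, preimage_id] at h

include hT in
lemma plus_of_lt {E : Set (Path T)} {τ : Path T → ℝ}
    (hE : MeasurableSet (E ∩ {ω | τ ω ≤ T}))
    (h : ∀ t, 0 < t → t ≤ T → MeasurableSet[Fraw T t] (E ∩ {ω | τ ω < t})) :
    ∀ t ∈ Set.Icc (0:ℝ) T, MeasurableSet[Fplus T t] (E ∩ {ω | τ ω ≤ t}) := by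
  intro t ht
  rw [Fplus, MeasurableSpace.measurableSet_iInf]
  intro s
  rw [MeasurableSpace.measurableSet_iInf]
  intro hts
  rcases ht.2.lt_or_eq with htT | htT
  · have hlt : t < min s T := lt_min hts htT
    obtain ⟨N, hN⟩ := exists_nat_one_div_lt (sub_pos.2 hlt)
    have e : E ∩ {ω | τ ω ≤ t} = ⋂ n : ℕ, (E ∩ {ω | τ ω < t + 1/((N + n : ℕ) + 1 : ℝ)}) := by
      ext ω
      simp only [mem_inter_iff, mem_iInter, mem_ofPred_eq]
      constructor
      · rintro ⟨h1, h2⟩ n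
        exact ⟨h1, lt_of_le_of_lt h2 (by linarith [show (0:ℝ) < 1/((N + n : ℕ) + 1 : ℝ) by positivity])⟩
      · intro h1
        refine ⟨(h1 0).1, le_of_forall_pos_lt_add fun ε hε => ?_⟩
        obtain ⟨n, hn⟩ := exists_nat_one_div_lt hε
        have h2 := (h1 n).2
        have : 1/((N + n : ℕ) + 1 : ℝ) ≤ 1 / ((n:ℝ) + 1) := by
          apply one_div_le_one_div_of_le (by positivity)
          push_cast; linarith [(Nat.cast_nonneg N : (0:ℝ) ≤ N)]
        linarith
    rw [e]
    refine MeasurableSet.iInter fun n => ?_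
    have hle : t + 1/((N + n : ℕ) + 1 : ℝ) ≤ min s T := by
      have : 1/((N + n : ℕ) + 1 : ℝ) ≤ 1 / ((N:ℝ) + 1) := by
        apply one_div_le_one_div_of_le (by positivity)
        push_cast; linarith [(Nat.cast_nonneg n : (0:ℝ) ≤ n)]
      linarith
    have hpos : (0:ℝ) < 1/((N + n : ℕ) + 1 : ℝ) := by positivity
    exact fraw_mono hle _ (h _ (by linarith [ht.1]) (hle.trans (min_le_right _ _)))
  · subst htT
    rw [min_eq_right hts.le]
    exact fraw_T hT hE

lemma lt_of_plus {E : Set (Path T)} {τ : Path T → ℝ} (h0 : ∀ ω, 0 ≤ τ ω)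
    (h : ∀ t ∈ Set.Icc (0:ℝ) T, MeasurableSet[Fplus T t] (E ∩ {ω | τ ω ≤ t})) {t : ℝ}
    (ht : t ≤ T) : MeasurableSet[Fraw T t] (E ∩ {ω | τ ω < t}) := by
  have e : E ∩ {ω | τ ω < t} = ⋃ n : ℕ, (E ∩ {ω | τ ω ≤ t - 1/((n:ℝ) + 1)}) := by
    ext ω
    simp only [mem_inter_iff, mem_iUnion, mem_ofPred_eq]
    constructor
    · rintro ⟨h1, h2⟩
      obtain ⟨n, hn⟩ := exists_nat_one_div_lt (sub_pos.2 h2)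
      exact ⟨n, h1, by linarith⟩
    · rintro ⟨n, h1, h2⟩
      exact ⟨h1, by linarith [show (0:ℝ) < 1/((n:ℝ) + 1) by positivity]⟩
  rw [e]
  refine MeasurableSet.iUnion fun n => ?_
  have hpos : (0:ℝ) < 1/((n:ℝ) + 1) := by positivity
  by_cases hn : 0 ≤ t - 1/((n:ℝ) + 1)
  · have := h _ ⟨hn, by linarith⟩
    rw [Fplus, MeasurableSpace.measurableSet_iInf] at this
    have := this t
    rw [MeasurableSpace.measurableSet_iInf] at this
    have := this (by linarith)
    rwa [min_eq_left ht] at this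
  · convert MeasurableSet.empty
    ext ω
    simp only [mem_inter_iff, mem_ofPred_eq, mem_empty_iff_false, iff_false]
    rintro ⟨-, h2⟩
    linarith [h0 ω]

lemma stop_lt {τ : Path T → ℝ} (h0 : ∀ ω, 0 ≤ τ ω) (h : IsStopPlus T τ) {t : ℝ}
    (ht : t ≤ T) : MeasurableSet[Fraw T t] {ω | τ ω < t} := by
  have := lt_of_plus (E := univ) h0 (fun t ht => by rw [univ_inter]; exact h t ht) ht
  rwa [univ_inter] at this

lemma coeff_lt {τ f : Path T → ℝ} (h0 : ∀ ω, 0 ≤ τ ω) (h : IsStopPlus T τ)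
    (hf : MeasAtStopPlus T τ f) {t : ℝ} (ht : t ≤ T) :
    Measurable[Fraw T t] (fun ω => f ω * (if τ ω < t then 1 else 0)) := by
  intro B hB
  have h1 := lt_of_plus (E := f ⁻¹' B) h0 (fun t ht => hf B hB t ht) ht
  have h2 := stop_lt h0 h ht
  by_cases hB0 : (0:ℝ) ∈ B
  · convert MeasurableSet.union h1 h2.compl using 1
    ext ω
    by_cases h : τ ω < t <;> simp [h, hB0]
  · convert h1 using 1
    ext ω
    by_cases h : τ ω < t <;> simp [h, hB0]

def hitQ (B : ℝ → Set (Path T)) (ω : Path T) : ℝ :=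
  sInf ({r : ℝ | (∃ q : ℚ, (q:ℝ) = r) ∧ 0 ≤ r ∧ r ≤ T ∧ ω ∈ B r} ∪ {T})

variable (B : ℝ → Set (Path T))

include hT in
lemma hitQ_bdd (ω : Path T) :
    BddBelow ({r : ℝ | (∃ q : ℚ, (q:ℝ) = r) ∧ 0 ≤ r ∧ r ≤ T ∧ ω ∈ B r} ∪ {T}) := by
  refine ⟨0, ?_⟩
  rintro r (h | h)
  · exact h.2.1
  · rw [mem_singleton_iff.1 h]; exact hT

include hT in
lemma hitQ_nonneg (ω : Path T) : 0 ≤ hitQ B ω := by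
  apply le_csInf ⟨T, Or.inr rfl⟩
  rintro r (h | h)
  · exact h.2.1
  · rw [mem_singleton_iff.1 h]; exact hT

include hT in
lemma hitQ_le (ω : Path T) : hitQ B ω ≤ T := csInf_le (hitQ_bdd hT B ω) (Or.inr rfl)

include hT in
lemma hitQ_not_mem {ω : Path T} {q : ℚ} (h0 : 0 ≤ (q:ℝ)) (h : (q:ℝ) < hitQ B ω) : ω ∉ B q :=
  fun hm => absurd (csInf_le (hitQ_bdd hT B ω)
    (Or.inl ⟨⟨q, rfl⟩, h0, h.le.trans (hitQ_le hT B ω), hm⟩)) (not_le.2 h)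

lemma hitQ_eq_T {ω : Path T} (h : ∀ r, 0 ≤ r → r ≤ T → ω ∉ B r) : hitQ B ω = T := by
  have e : ({r : ℝ | (∃ q : ℚ, (q:ℝ) = r) ∧ 0 ≤ r ∧ r ≤ T ∧ ω ∈ B r} ∪ {T}) = {T} := by
    ext r
    simp only [mem_union, mem_ofPred_eq, mem_singleton_iff, or_iff_right_iff_imp]
    rintro ⟨-, h1, h2, h3⟩
    exact absurd h3 (h r h1 h2)
  rw [hitQ, e, csInf_singleton]

include hT in
lemma hitQ_lt (hB : ∀ r, 0 ≤ r → r ≤ T → MeasurableSet[Fraw T r] (B r)) {t : ℝ} (ht : t ≤ T) :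
    MeasurableSet[Fraw T t] {ω | hitQ B ω < t} := by
  have e : {ω | hitQ B ω < t} = ⋃ q : ℚ, {ω | 0 ≤ (q:ℝ) ∧ (q:ℝ) < t ∧ ω ∈ B q} := by
    ext ω
    simp only [mem_iUnion, mem_ofPred_eq]
    constructor
    · intro h
      obtain ⟨r, hr, hrt⟩ := exists_lt_of_csInf_lt ⟨T, Or.inr rfl⟩ h
      rcases hr with ⟨⟨q, rfl⟩, h1, h2, h3⟩ | hr
      · exact ⟨q, h1, hrt, h3⟩
      · rw [mem_singleton_iff.1 hr] at hrt; exact absurd hrt (not_lt.2 ht)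
    · rintro ⟨q, h1, h2, h3⟩
      by_contra hcon
      exact hitQ_not_mem hT B h1 (h2.trans_le (not_lt.1 hcon)) h3
  rw [e]
  refine MeasurableSet.iUnion fun q => ?_
  by_cases h1 : 0 ≤ (q:ℝ)
  · by_cases h2 : (q:ℝ) < t
    · simp only [h1, h2, true_and]
      exact fraw_mono h2.le _ (hB q h1 (h2.le.trans ht))
    · simp only [h2, false_and, and_false]
      exact @MeasurableSet.empty _ (Fraw T t)
  · simp only [h1, false_and]
    exact @MeasurableSet.empty _ (Fraw T t)

end Opt


section Prob
variable {α : Type*} {m0 : MeasurableSpace α} {μ : Measure α} [IsProbabilityMeasure μ]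

lemma int_of_bdd {f : α → ℝ} (hf : AEStronglyMeasurable f μ) {C : ℝ} (h : ∀ x, |f x| ≤ C) :
    Integrable f μ :=
  Integrable.of_bound hf C (Eventually.of_forall fun x => by rw [Real.norm_eq_abs]; exact h x)

lemma orth {m : MeasurableSpace α} (hm : m ≤ m0) {a D : α → ℝ} (hD : Integrable D μ)
    (h0 : ∀ A, MeasurableSet[m] A → ∫ x in A, D x ∂μ = 0) (ha : Measurable[m] a)
    (haD : Integrable (fun x => a x * D x) μ) : ∫ x, a x * D x ∂μ = 0 := by
  have h1 : (0 : α → ℝ) =ᵐ[μ] μ[D|m] := by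
    refine ae_eq_condExp_of_forall_setIntegral_eq hm hD ?_ ?_ ?_
    · intro s _ _; exact integrableOn_zero
    · intro s hs _; rw [h0 s hs]; simp
    · exact (@stronglyMeasurable_zero α ℝ m _ _).aestronglyMeasurable
  have h2 := condExp_mul_of_stronglyMeasurable_left (μ := μ) (m := m)
    (Measurable.stronglyMeasurable ha) haD hD
  rw [← integral_condExp hm]
  calc ∫ x, (μ[fun x => a x * D x|m]) x ∂μ = ∫ x, a x * (μ[D|m]) x ∂μ := integral_congr_ae h2
    _ = ∫ x, (0:ℝ) ∂μ := by
        refine integral_congr_ae ?_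
        filter_upwards [h1] with x hx
        rw [← hx]; simp
    _ = 0 := by simp

variable (F : ℕ → MeasurableSpace α) (hF : ∀ i, F i ≤ m0) (hmono : Monotone F)
  (D a : ℕ → α → ℝ) (CD Ca : ℝ) (hDb : ∀ i x, |D i x| ≤ CD) (hab : ∀ i x, |a i x| ≤ Ca)
  (hDm : ∀ i, Measurable[F (i+1)] (D i)) (ham : ∀ i, Measurable[F i] (a i))
  (hD0 : ∀ i A, MeasurableSet[F i] A → ∫ x in A, D i x ∂μ = 0)

include hF hDb hab hDm ham in
lemma aD_int (i : ℕ) : Integrable (fun x => a i x * D i x) μ := by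
  refine int_of_bdd (C := Ca * CD) ?_ ?_
  · exact (((ham i).mono (hF _) le_rfl).mul ((hDm i).mono (hF _) le_rfl)).aestronglyMeasurable
  · intro x
    rw [abs_mul]
    exact mul_le_mul (hab i x) (hDb i x) (abs_nonneg _) ((abs_nonneg _).trans (hab i x))

include hF hDb hab hDm ham hD0 in
lemma sum_zero (N : ℕ) : ∫ x, ∑ j ∈ Finset.range N, a j x * D j x ∂μ = 0 := by
  rw [integral_finsetSum _ fun i _ => aD_int F hF D a CD Ca hDb hab hDm ham i]
  refine Finset.sum_eq_zero fun i _ => ?_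
  exact orth (hF i) (int_of_bdd (((hDm i).mono (hF _) le_rfl)).aestronglyMeasurable (hDb i))
    (hD0 i) (ham i) (aD_int F hF D a CD Ca hDb hab hDm ham i)

include hmono hDb hab hDm ham in
lemma sum_meas_bdd (N : ℕ) : Measurable[F N] (fun x => ∑ j ∈ Finset.range N, a j x * D j x) ∧
    ∀ x, |∑ j ∈ Finset.range N, a j x * D j x| ≤ N * (Ca * CD) := by
  constructor
  · refine Finset.measurable_sum _ fun j hj => ?_
    have := Finset.mem_range.1 hj
    exact ((ham j).mono (hmono (by omega)) le_rfl).mul ((hDm j).mono (hmono (by omega)) le_rfl)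
  · intro x
    refine (Finset.abs_sum_le_sum_abs _ _).trans ?_
    refine (Finset.sum_le_card_nsmul _ _ (Ca * CD) fun j _ => ?_).trans (by simp)
    rw [abs_mul]
    exact mul_le_mul (hab j x) (hDb j x) (abs_nonneg _) ((abs_nonneg _).trans (hab j x))

include hF hmono hDb hab hDm ham hD0 in
lemma sq_sum (N : ℕ) : ∫ x, (∑ j ∈ Finset.range N, a j x * D j x)^2 ∂μ =
    ∑ j ∈ Finset.range N, ∫ x, (a j x * D j x)^2 ∂μ := by
  induction N with
  | zero => simp
  | succ N ih =>
    obtain ⟨hXm, hXb⟩ := sum_meas_bdd F hmono D a CD Ca hDb hab hDm ham N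
    set X : α → ℝ := fun x => ∑ j ∈ Finset.range N, a j x * D j x with hX
    have hXm' := hXm.mono (hF N) le_rfl
    have haM := (ham N).mono (hF _) le_rfl
    have hDM := (hDm N).mono (hF _) le_rfl
    have hDi : Integrable (D N) μ := int_of_bdd hDM.aestronglyMeasurable (hDb N)
    have haDb : ∀ x, |a N x * D N x| ≤ Ca * CD := fun x => by
      rw [abs_mul]
      exact mul_le_mul (hab N x) (hDb N x) (abs_nonneg _) ((abs_nonneg _).trans (hab N x))
    have i1 : Integrable (fun x => X x ^ 2) μ := by
      refine int_of_bdd (C := (N * (Ca*CD))^2) (hXm'.pow_const 2).aestronglyMeasurable fun x => ?_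
      rw [abs_pow]; exact pow_le_pow_left₀ (abs_nonneg _) (hXb x) 2
    have i2 : Integrable (fun x => (X x * a N x) * D N x) μ := by
      refine int_of_bdd (C := (N * (Ca*CD)) * (Ca * CD)) ((hXm'.mul haM).mul hDM).aestronglyMeasurable
        fun x => ?_
      rw [mul_assoc, abs_mul]
      exact mul_le_mul (hXb x) (haDb x) (abs_nonneg _) ((abs_nonneg _).trans (hXb x))
    have i3 : Integrable (fun x => (a N x * D N x)^2) μ := by
      refine int_of_bdd (C := (Ca*CD)^2) ((haM.mul hDM).pow_const 2).aestronglyMeasurable fun x => ?_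
      rw [abs_pow]; exact pow_le_pow_left₀ (abs_nonneg _) (haDb x) 2
    have e : ∀ x, (∑ j ∈ Finset.range (N+1), a j x * D j x)^2 =
        X x ^ 2 + 2 * ((X x * a N x) * D N x) + (a N x * D N x)^2 := fun x => by
      rw [Finset.sum_range_succ]; simp only [hX]; ring
    simp only [e]
    rw [integral_add (by exact i1.add (i2.const_mul 2)) i3, integral_add i1 (i2.const_mul 2),
      integral_const_mul, orth (a := fun x => X x * a N x) (hF N) hDi (hD0 N) (hXm.mul (ham N)) i2, ih,
      Finset.sum_range_succ]
    ring

include hF hmono hDb hab hDm ham hD0 in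
lemma sq_sum_le (N : ℕ) (B : ℝ) (hB : ∀ x, |∑ j ∈ Finset.range N, D j x| ≤ B) :
    ∫ x, (∑ j ∈ Finset.range N, a j x * D j x)^2 ∂μ ≤ Ca^2 * B^2 := by
  rw [sq_sum F hF hmono D a CD Ca hDb hab hDm ham hD0]
  have h1 := sq_sum (μ := μ) F hF hmono D (fun _ _ => 1) CD 1 hDb (by simp) hDm
    (fun i => measurable_const) hD0 N
  simp only [one_mul] at h1
  have i3 : ∀ j, Integrable (fun x => (D j x)^2) μ := fun j => by
    refine int_of_bdd (C := (CD)^2) (((hDm j).mono (hF _) le_rfl).pow_const 2).aestronglyMeasurable fun x => ?_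
    rw [abs_pow]; exact pow_le_pow_left₀ (abs_nonneg _) (hDb j x) 2
  calc ∑ j ∈ Finset.range N, ∫ x, (a j x * D j x)^2 ∂μ
      ≤ ∑ j ∈ Finset.range N, ∫ x, Ca^2 * (D j x)^2 ∂μ := by
        refine Finset.sum_le_sum fun j _ => integral_mono_of_nonneg ?_ ((i3 j).const_mul _) ?_
        · exact Eventually.of_forall fun x => sq_nonneg _
        · refine Eventually.of_forall fun x => ?_
          simp only [mul_pow]
          exact mul_le_mul_of_nonneg_right (sq_le_sq' (by linarith [neg_le_of_abs_le (hab j x)])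
            (le_of_abs_le (hab j x))) (sq_nonneg _)
    _ = Ca^2 * ∫ x, (∑ j ∈ Finset.range N, D j x)^2 ∂μ := by
        rw [h1, Finset.mul_sum]
        simp only [integral_const_mul]
    _ ≤ Ca^2 * B^2 := by
        refine mul_le_mul_of_nonneg_left ?_ (sq_nonneg _)
        calc _ ≤ ∫ x, B^2 ∂μ := by
              refine integral_mono_of_nonneg (Eventually.of_forall fun x => sq_nonneg _)
                (integrable_const _) (Eventually.of_forall fun x => ?_)
              exact sq_le_sq' (by linarith [neg_le_of_abs_le (hB x)]) (le_of_abs_le (hB x))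
          _ = B^2 := by simp

def clip (c z : ℝ) : ℝ := max (-c) (min z c)

lemma clip_abs {c : ℝ} (hc : 0 ≤ c) (z : ℝ) : |clip c z| ≤ c := by
  unfold clip; rw [abs_le]
  exact ⟨le_max_left _ _, max_le (by linarith) (min_le_right _ _)⟩

lemma clip_eq {c z : ℝ} (h : |z| ≤ c) : clip c z = z := by
  unfold clip
  rw [abs_le] at h
  rw [min_eq_left h.2, max_eq_right h.1]

lemma continuous_clip (c : ℝ) : Continuous (clip c) :=
  continuous_const.max (continuous_id.min continuous_const)

lemma clip_sub {c : ℝ} (hc : 0 < c) (z : ℝ) : |z - clip c z| ≤ z^2 / c := by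
  by_cases h : |z| ≤ c
  · rw [clip_eq h]; simp; positivity
  · rw [le_div_iff₀ hc]
    push Not at h
    rcases le_total 0 z with hz | hz
    · rw [abs_of_nonneg hz] at h
      have : clip c z = c := by unfold clip; rw [min_eq_right h.le, max_eq_right (by linarith)]
      rw [this, abs_of_nonneg (by linarith)]
      nlinarith
    · rw [abs_of_nonpos hz] at h
      have : clip c z = -c := by
        unfold clip; rw [min_eq_left (by linarith), max_eq_left (by linarith)]
      rw [this, abs_of_nonpos (by linarith)]
      nlinarith

lemma int_of_sq {Z : α → ℝ} (hZ : AEMeasurable Z μ) {C : ℝ}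
    (h : ∫⁻ x, ENNReal.ofReal (Z x ^2) ∂μ ≤ ENNReal.ofReal C) :
    Integrable Z μ ∧ Integrable (fun x => Z x ^ 2) μ := by
  have h2 : Integrable (fun x => Z x ^ 2) μ := by
    refine ⟨(hZ.pow_const 2).aestronglyMeasurable, ?_⟩
    rw [hasFiniteIntegral_iff_ofReal (Eventually.of_forall fun x => sq_nonneg _)]
    exact h.trans_lt ENNReal.ofReal_lt_top
  refine ⟨?_, h2⟩
  refine Integrable.mono' ((integrable_const (1:ℝ)).add h2) hZ.aestronglyMeasurable
    (Eventually.of_forall fun x => ?_)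
  simp only [Real.norm_eq_abs, Pi.add_apply]
  rw [← sq_abs (Z x)]
  nlinarith [sq_nonneg (|Z x| - 1), abs_nonneg (Z x)]

lemma L2_lim {Z : α → ℝ} {Zn : ℕ → α → ℝ} (hm : ∀ n, AEMeasurable (Zn n) μ) {C : ℝ} (hC : 0 ≤ C)
    (hlim : ∀ᵐ x ∂μ, Tendsto (fun n => Zn n x) atTop (𝓝 (Z x)))
    (h0 : ∀ n, ∫ x, Zn n x ∂μ = 0)
    (h2 : ∀ n, ∫⁻ x, ENNReal.ofReal (Zn n x ^ 2) ∂μ ≤ ENNReal.ofReal C) :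
    AEMeasurable Z μ ∧ ∫ x, Z x ∂μ = 0 ∧ ∫⁻ x, ENNReal.ofReal (Z x ^ 2) ∂μ ≤ ENNReal.ofReal C := by
  have hZ : AEMeasurable Z μ := aemeasurable_of_tendsto_metrizable_ae' hm hlim
  have hZ2 : ∫⁻ x, ENNReal.ofReal (Z x ^ 2) ∂μ ≤ ENNReal.ofReal C := by
    calc ∫⁻ x, ENNReal.ofReal (Z x ^ 2) ∂μ
        = ∫⁻ x, liminf (fun n => ENNReal.ofReal (Zn n x ^ 2)) atTop ∂μ := by
          refine lintegral_congr_ae ?_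
          filter_upwards [hlim] with x hx
          exact ((ENNReal.tendsto_ofReal (hx.pow 2)).liminf_eq).symm
      _ ≤ liminf (fun n => ∫⁻ x, ENNReal.ofReal (Zn n x ^ 2) ∂μ) atTop :=
          lintegral_liminf_le' fun n => ((hm n).pow_const 2).ennreal_ofReal
      _ ≤ ENNReal.ofReal C := by
          refine liminf_le_of_le (by isBoundedDefault) fun b hb => ?_
          obtain ⟨n, hn⟩ := hb.exists
          exact hn.trans (h2 n)
  refine ⟨hZ, ?_, hZ2⟩
  have hclip : ∀ (W : α → ℝ), AEMeasurable W μ →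
      (∫⁻ x, ENNReal.ofReal (W x ^ 2) ∂μ ≤ ENNReal.ofReal C) → ∀ c : ℝ, 0 < c →
      |∫ x, W x ∂μ - ∫ x, clip c (W x) ∂μ| ≤ C / c := by
    intro W hW hW2 c hc
    obtain ⟨i1, i2⟩ := int_of_sq hW hW2
    have i3 : Integrable (fun x => clip c (W x)) μ :=
      int_of_bdd ((continuous_clip c).measurable.comp_aemeasurable hW).aestronglyMeasurable
        (fun x => clip_abs hc.le _)
    rw [← integral_sub i1 i3]
    have hI : ∫ x, W x ^ 2 ∂μ ≤ C := by
      rw [integral_eq_lintegral_of_nonneg_ae (Eventually.of_forall fun x => sq_nonneg _)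
        i2.aestronglyMeasurable]
      exact ENNReal.toReal_le_of_le_ofReal hC hW2
    calc |∫ x, (W x - clip c (W x)) ∂μ| ≤ ∫ x, |W x - clip c (W x)| ∂μ := abs_integral_le_integral_abs
      _ ≤ ∫ x, W x ^ 2 / c ∂μ := integral_mono (i1.sub i3).abs (i2.div_const c)
          fun x => clip_sub hc _
      _ = (∫ x, W x ^ 2 ∂μ) / c := integral_div _ _
      _ ≤ C / c := div_le_div_of_nonneg_right hI hc.le
  have hfin : ∀ c : ℝ, 0 < c → |∫ x, Z x ∂μ| ≤ 2 * C / c := by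
    intro c hc
    have hlim2 : Tendsto (fun n => ∫ x, clip c (Zn n x) ∂μ) atTop (𝓝 (∫ x, clip c (Z x) ∂μ)) := by
      refine tendsto_integral_of_dominated_convergence (fun _ => c)
        (fun n => ((continuous_clip c).measurable.comp_aemeasurable (hm n)).aestronglyMeasurable)
        (integrable_const _) (fun n => Eventually.of_forall fun x => ?_) ?_
      · rw [Real.norm_eq_abs]; exact clip_abs hc.le _
      · filter_upwards [hlim] with x hx
        exact ((continuous_clip c).tendsto _).comp hx
    have h3 : |∫ x, clip c (Z x) ∂μ| ≤ C / c := by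
      refine le_of_tendsto hlim2.abs (Eventually.of_forall fun n => ?_)
      have := hclip (Zn n) (hm n) (h2 n) c hc
      rwa [h0 n, zero_sub, abs_neg] at this
    have h4 := hclip Z hZ hZ2 c hc
    have h5 : |∫ x, Z x ∂μ| ≤ |∫ x, Z x ∂μ - ∫ x, clip c (Z x) ∂μ| + |∫ x, clip c (Z x) ∂μ| := by
      have := abs_add_le (∫ x, Z x ∂μ - ∫ x, clip c (Z x) ∂μ) (∫ x, clip c (Z x) ∂μ)
      simpa using this
    have : 2 * C / c = C / c + C / c := by ring
    linarith
  have hle : |∫ x, Z x ∂μ| ≤ 0 := by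
    have ht : Tendsto (fun n : ℕ => 2 * C / ((n:ℝ) + 1)) atTop (𝓝 0) := by
      have := (tendsto_one_div_add_atTop_nhds_zero_nat (𝕜 := ℝ)).const_mul (2 * C)
      simpa [div_eq_mul_inv] using this
    exact ge_of_tendsto ht (Eventually.of_forall fun n => hfin _ (by positivity))
  exact abs_nonpos_iff.1 hle

end Prob


section OptStop
variable {T : ℝ} (hT : 0 ≤ T) {Q : Measure (Path T)} [IsProbabilityMeasure Q]

variable (ρ : Path T → ℝ) (s t : ℝ)

def ug (s t : ℝ) (n j : ℕ) : ℝ := s + (t - s) * (j / ((n:ℝ)+1))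

lemma ug_zero (n : ℕ) : ug s t n 0 = s := by simp [ug]
lemma ug_last (n : ℕ) : ug s t n (n+1) = t := by
  unfold ug; push_cast
  rw [div_self (by positivity)]; ring
variable {s t} in
lemma ug_mono (h : s ≤ t) (n : ℕ) {i j : ℕ} (hij : i ≤ j) : ug s t n i ≤ ug s t n j := by
  unfold ug
  have : (i:ℝ) / ((n:ℝ)+1) ≤ j / ((n:ℝ)+1) :=
    div_le_div_of_nonneg_right (by exact_mod_cast hij) (by positivity)
  have := mul_le_mul_of_nonneg_left this (sub_nonneg.2 h)
  linarith
lemma ug_succ (n j : ℕ) : ug s t n (j+1) = ug s t n j + (t-s) * (1/((n:ℝ)+1)) := by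
  unfold ug; push_cast; ring

lemma kap_ex (n : ℕ) (ω : Path T) : ∃ j, ρ ω < ug s t n j ∨ n + 1 ≤ j := ⟨n+1, Or.inr le_rfl⟩

def kap (n : ℕ) (ω : Path T) : ℕ := Nat.find (kap_ex ρ s t n ω)

lemma kap_le (n : ℕ) (ω : Path T) : kap ρ s t n ω ≤ n + 1 := Nat.find_min' _ (Or.inr le_rfl)

lemma kap_meas (hst : s ≤ t) (htT : t ≤ T) (n : ℕ)
    (hρ : ∀ u, u ≤ T → MeasurableSet[Fraw T u] {ω | ρ ω < u}) (j : ℕ) (hj : j ≤ n + 1) :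
    MeasurableSet[Fraw T (ug s t n j)] {ω | kap ρ s t n ω = j} := by
  have hle : ∀ i ≤ n+1, ug s t n i ≤ T := fun i hi =>
    ((ug_mono hst n hi).trans_eq (ug_last s t n)).trans htT
  have hone : ∀ i, i ≤ j → MeasurableSet[Fraw T (ug s t n j)] {ω | ρ ω < ug s t n i ∨ n + 1 ≤ i} := by
    intro i hi
    refine MeasurableSet.union ?_ (MeasurableSet.const _)
    exact fraw_mono (ug_mono hst n hi) _ (hρ _ (hle i (hi.trans hj)))
  have e : {ω | kap ρ s t n ω = j} = {ω | ρ ω < ug s t n j ∨ n + 1 ≤ j} ∩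
      ⋂ (i : ℕ) (_ : i < j), {ω | ρ ω < ug s t n i ∨ n + 1 ≤ i}ᶜ := by
    ext ω
    simp only [mem_ofPred_eq, kap, Nat.find_eq_iff, mem_inter_iff, mem_iInter, mem_compl_iff]
  rw [e]
  refine MeasurableSet.inter (hone j le_rfl) ?_
  refine MeasurableSet.iInter fun i => MeasurableSet.iInter fun hi => ?_
  exact (hone i hi.le).compl

lemma kap_near (hst : s ≤ t) (n : ℕ) (ω : Path T) :
    |ug s t n (kap ρ s t n ω) - min (max (ρ ω) s) t| ≤ (t-s) * (1/((n:ℝ)+1)) := by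
  have hsp : ρ ω < ug s t n (kap ρ s t n ω) ∨ n + 1 ≤ kap ρ s t n ω := Nat.find_spec (kap_ex ρ s t n ω)
  have hmin : ∀ i, i < kap ρ s t n ω → ¬ (ρ ω < ug s t n i ∨ n + 1 ≤ i) :=
    fun i hi => Nat.find_min (kap_ex ρ s t n ω) hi
  have hkl := kap_le ρ s t n ω
  have hmesh : 0 ≤ (t-s) * (1/((n:ℝ)+1)) := mul_nonneg (by linarith) (by positivity)
  generalize kap ρ s t n ω = k at *
  rcases Nat.eq_zero_or_pos k with h0 | h0
  · rw [h0, ug_zero] at hsp ⊢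
    rcases hsp with h | h
    · rw [max_eq_right h.le, min_eq_left hst]; simpa using hmesh
    · omega
  · obtain ⟨i, hi⟩ := Nat.exists_eq_succ_of_ne_zero h0.ne'
    have hn := hmin i (by omega)
    push Not at hn
    have h1 : s ≤ ug s t n i := (ug_zero s t n).symm.le.trans (ug_mono hst n (Nat.zero_le i))
    have h2 : ug s t n (i+1) ≤ t := (ug_mono hst n (by omega)).trans_eq (ug_last s t n)
    rw [hi, Nat.succ_eq_add_one] at hsp ⊢
    rw [max_eq_left (h1.trans hn.1)]
    have h3 := ug_succ s t n i
    rcases hsp with h | h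
    · rw [min_eq_left (h.le.trans h2), abs_le]; constructor <;> linarith
    · have : i = n := by omega
      subst this
      rw [ug_last] at h3 ⊢
      rcases le_total (ρ ω) t with h4 | h4
      · rw [min_eq_left h4, abs_le]; constructor <;> linarith
      · rw [min_eq_right h4]; simpa using hmesh

variable (M : ℝ → Path T → ℝ)

def Wn (n : ℕ) (ω : Path T) : ℝ := M (ug s t n (kap ρ s t n ω)) ω

variable (hM : IsMart T Q M) (had : ∀ u ∈ Set.Icc (0:ℝ) T, Measurable[Fraw T u] (M u))
  (hρ : ∀ u, u ≤ T → MeasurableSet[Fraw T u] {ω | ρ ω < u})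
  (h0s : 0 ≤ s) (hst : s ≤ t) (htT : t ≤ T)

lemma Wn_sum (n : ℕ) (B : Set (Path T)) (ω : Path T) : B.indicator (Wn ρ s t M n) ω =
    ∑ j ∈ Finset.range (n+2), (B ∩ {ω | kap ρ s t n ω = j}).indicator (M (ug s t n j)) ω := by
  rw [Finset.sum_eq_single (kap ρ s t n ω)]
  · simp only [indicator, mem_inter_iff, mem_ofPred_eq, and_true, Wn]
  · intro j _ hj
    rw [indicator_of_notMem]
    rintro ⟨-, h⟩
    exact hj h.symm
  · intro h
    exact absurd (Finset.mem_range.2 (by have := kap_le ρ s t n ω; omega)) h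

include hM hρ h0s hst htT

lemma ug_mem {n j : ℕ} (hj : j ≤ n + 1) : ug s t n j ∈ Set.Icc (0:ℝ) T :=
  ⟨h0s.trans ((ug_zero s t n).symm.le.trans (ug_mono hst n (Nat.zero_le j))),
    ((ug_mono hst n hj).trans_eq (ug_last s t n)).trans htT⟩

lemma Wn_int (n : ℕ) : Integrable (Wn ρ s t M n) Q := by
  have e : Wn ρ s t M n = fun ω => ∑ j ∈ Finset.range (n+2),
      (univ ∩ {ω | kap ρ s t n ω = j}).indicator (M (ug s t n j)) ω := by
    funext ω
    rw [← Wn_sum, indicator_univ]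
  rw [e]
  refine integrable_finsetSum _ fun j hj => ?_
  have hj' : j ≤ n + 1 := by have := Finset.mem_range.1 hj; omega
  refine (hM.1 _ (ug_mem ρ s t M hM hρ h0s hst htT hj')).indicator ?_
  rw [univ_inter]
  exact fraw_le _ _ (kap_meas ρ s t hst htT n hρ j hj')

lemma Wn_setint (n : ℕ) (B : Set (Path T)) (hBm : MeasurableSet B)
    (hB : ∀ j ≤ n+1, MeasurableSet[Fraw T (ug s t n j)] (B ∩ {ω | kap ρ s t n ω = j})) :
    ∫ ω in B, Wn ρ s t M n ω ∂Q = ∫ ω in B, M t ω ∂Q := by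
  have hmem : ∀ j ∈ Finset.range (n+2), j ≤ n + 1 := fun j hj => by
    have := Finset.mem_range.1 hj; omega
  have hm : t ∈ Set.Icc (0:ℝ) T := ⟨h0s.trans hst, htT⟩
  rw [← integral_indicator hBm, ← integral_indicator hBm]
  have e2 : ∀ ω, B.indicator (M t) ω = ∑ j ∈ Finset.range (n+2),
      (B ∩ {ω | kap ρ s t n ω = j}).indicator (M t) ω := fun ω => by
    rw [Finset.sum_eq_single (kap ρ s t n ω)]
    · simp only [indicator, mem_inter_iff, mem_ofPred_eq, and_true]
    · intro j _ hj
      rw [indicator_of_notMem]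
      rintro ⟨-, h⟩
      exact hj h.symm
    · intro h
      exact absurd (Finset.mem_range.2 (by have := kap_le ρ s t n ω; omega)) h
  simp only [Wn_sum, e2]
  rw [integral_finsetSum, integral_finsetSum]
  · refine Finset.sum_congr rfl fun j hj => ?_
    have h1 := hB j (hmem j hj)
    rw [integral_indicator (fraw_le _ _ h1), integral_indicator (fraw_le _ _ h1)]
    exact (hM.2 _ t (ug_mem ρ s t M hM hρ h0s hst htT (hmem j hj)) hm
      ((ug_mono hst n (hmem j hj)).trans_eq (ug_last s t n)) _ h1).symm
  · intro j hj
    exact (hM.1 _ hm).indicator (fraw_le _ _ (hB j (hmem j hj)))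
  · intro j hj
    exact (hM.1 _ (ug_mem ρ s t M hM hρ h0s hst htT (hmem j hj))).indicator
      (fraw_le _ _ (hB j (hmem j hj)))

include had in
lemma Wn_measurable (n : ℕ) : Measurable (Wn ρ s t M n) := by
  have e : Wn ρ s t M n = fun ω => ∑ j ∈ Finset.range (n+2),
      (univ ∩ {ω | kap ρ s t n ω = j}).indicator (M (ug s t n j)) ω := by
    funext ω
    rw [← Wn_sum, indicator_univ]
  rw [e]
  refine Finset.measurable_sum _ fun j hj => ?_
  have hj' : j ≤ n + 1 := by have := Finset.mem_range.1 hj; omega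
  refine Measurable.indicator ((had _ (ug_mem ρ s t M hM hρ h0s hst htT hj')).mono (fraw_le _) le_rfl) ?_
  rw [univ_inter]
  exact fraw_le _ _ (kap_meas ρ s t hst htT n hρ j hj')

include had in
lemma opt_stop (hMc : ∀ ω, Continuous (fun u => M u ω)) (A : Set (Path T))
    (hA : MeasurableSet[Fraw T s] A) :
    Integrable (fun ω => M (min (max (ρ ω) s) t) ω) Q ∧
    ∫ ω in A, M (min (max (ρ ω) s) t) ω ∂Q = ∫ ω in A, M s ω ∂Q := by
  have hWm := Wn_measurable ρ s t M hM had hρ h0s hst htT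
  have hWi := Wn_int ρ s t M hM hρ h0s hst htT
  have hm : t ∈ Set.Icc (0:ℝ) T := ⟨h0s.trans hst, htT⟩
  have hce : ∀ n, Wn ρ s t M n =ᵐ[Q]
      Q[M t | MeasurableSpace.comap (Wn ρ s t M n) inferInstance] := by
    intro n
    refine ae_eq_condExp_of_forall_setIntegral_eq (hWm n).comap_le (hM.1 t hm)
      (fun _ _ _ => (hWi n).integrableOn) ?_ ?_
    · rintro B ⟨B', hB', rfl⟩ -
      refine Wn_setint ρ s t M hM hρ h0s hst htT n _ (hWm n hB') fun j hj => ?_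
      have e : Wn ρ s t M n ⁻¹' B' ∩ {ω | kap ρ s t n ω = j} =
          (M (ug s t n j)) ⁻¹' B' ∩ {ω | kap ρ s t n ω = j} := by
        ext ω
        simp only [mem_inter_iff, mem_preimage, mem_ofPred_eq, Wn]
        constructor
        · rintro ⟨h1, h2⟩; rw [h2] at h1; exact ⟨h1, h2⟩
        · rintro ⟨h1, h2⟩; rw [h2]; exact ⟨h1, rfl⟩
      rw [e]
      exact MeasurableSet.inter (had _ (ug_mem ρ s t M hM hρ h0s hst htT hj) hB')
        (kap_meas ρ s t hst htT n hρ j hj)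
    · exact (Measurable.stronglyMeasurable (comap_measurable _)).aestronglyMeasurable
  have hUI := (hM.1 t hm).uniformIntegrable_condExp
    (ℱ := fun n => MeasurableSpace.comap (Wn ρ s t M n) inferInstance) (fun n => (hWm n).comap_le)
  have hUI' : UniformIntegrable (fun n => Wn ρ s t M n) 1 Q := by
    obtain ⟨h1, h2, C, h3⟩ := hUI
    refine ⟨fun n => (hWm n).aestronglyMeasurable, h2.ae_eq fun n => (hce n).symm, C, fun n => ?_⟩
    rw [eLpNorm_congr_ae (hce n)]; exact h3 n
  have hlim : ∀ ω, Tendsto (fun n => Wn ρ s t M n ω) atTop (𝓝 (M (min (max (ρ ω) s) t) ω)) := by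
    intro ω
    have h1 : Tendsto (fun n => ug s t n (kap ρ s t n ω)) atTop (𝓝 (min (max (ρ ω) s) t)) := by
      rw [tendsto_iff_dist_tendsto_zero]
      refine squeeze_zero (fun n => dist_nonneg) (fun n => kap_near ρ s t hst n ω) ?_
      have := (tendsto_one_div_add_atTop_nhds_zero_nat (𝕜 := ℝ)).const_mul (t - s)
      simpa using this
    exact ((hMc ω).tendsto _).comp h1
  have hmem : MemLp (fun ω => M (min (max (ρ ω) s) t) ω) 1 Q := by
    obtain ⟨h1, h2, C, h3⟩ := hUI'
    refine ⟨aestronglyMeasurable_of_tendsto_ae atTop h1 (Eventually.of_forall hlim), ?_⟩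
    refine lt_of_le_of_lt (Lp.eLpNorm_lim_le_liminf_eLpNorm h1 _ (Eventually.of_forall hlim)) ?_
    refine lt_of_le_of_lt ?_ (ENNReal.coe_lt_top (r := C))
    refine liminf_le_of_le (by isBoundedDefault) fun b hb => ?_
    obtain ⟨n, hn⟩ := hb.exists
    exact hn.trans (h3 n)
  have hL1 := tendsto_Lp_finite_of_tendsto_ae le_rfl ENNReal.one_ne_top
    (fun n => (hWm n).aestronglyMeasurable) hmem hUI'.2.1 (Eventually.of_forall hlim)
  have hI := tendsto_setIntegral_of_L1' _ hmem.1 (Eventually.of_forall hWi) hL1 A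
  have hcst : ∀ n, ∫ ω in A, Wn ρ s t M n ω ∂Q = ∫ ω in A, M s ω ∂Q := by
    intro n
    rw [Wn_setint ρ s t M hM hρ h0s hst htT n A (fraw_le _ _ hA) fun j hj => ?_]
    · exact hM.2 s t ⟨h0s, hst.trans htT⟩ hm hst A hA
    · exact MeasurableSet.inter (fraw_mono ((ug_zero s t n).symm.le.trans
        (ug_mono hst n (Nat.zero_le j))) _ hA) (kap_meas ρ s t hst htT n hρ j hj)
  simp only [hcst] at hI
  exact ⟨memLp_one_iff_integrable.1 hmem, tendsto_nhds_unique hI tendsto_const_nhds⟩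
end OptStop


section Weak
variable {T : ℝ} (hT : 0 ≤ T) {Q : Measure (Path T)} [IsProbabilityMeasure Q]

lemma ev_meas_clamp {f : Path T → ℝ} (hf : Measurable (fun ω => max 0 (f ω))) :
    Measurable (fun ω : Path T => ev T hT ω (f ω)) := by
  have h := (continuous_ev_joint hT).measurable.comp (measurable_id.prodMk hf)
  have e : (fun ω : Path T => ev T hT ω (f ω)) =
      ((fun p : Path T × ℝ => ev T hT p.1 p.2) ∘ fun a => (id a, max 0 (f a))) := by
    funext ω
    simp only [Function.comp, id]
    rcases le_total 0 (f ω) with h' | h'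
    · rw [max_eq_right h']
    · rw [max_eq_left h', ev_of_le hT ω h']
  rw [e]
  exact h

lemma stopped_adapted {τ : Path T → ℝ} (hτ : IsStopRaw T τ) {t : ℝ} (ht : t ∈ Set.Icc (0:ℝ) T) :
    Measurable[Fraw T t] (fun ω => ev T hT ω (min (τ ω) t)) := by
  have hm : Measurable (fun ω => max 0 (min (τ ω) t)) := by
    refine measurable_of_Iic fun c => ?_
    by_cases h0 : 0 ≤ c
    · by_cases h1 : c < t
      · have : (fun ω => max 0 (min (τ ω) t)) ⁻¹' Iic c = {ω | τ ω ≤ c} := by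
          ext ω
          simp [h0, not_le.2 h1]
        rw [this]
        exact fraw_le _ _ (hτ c ⟨h0, h1.le.trans ht.2⟩)
      · have : (fun ω => max 0 (min (τ ω) t)) ⁻¹' Iic c = univ := by
          ext ω
          simp [h0, not_lt.1 h1]
        rw [this]; exact MeasurableSet.univ
    · have : (fun ω => max 0 (min (τ ω) t)) ⁻¹' Iic c = ∅ := by
        ext ω
        simp [h0]
      rw [this]; exact MeasurableSet.empty
  refine fraw_of_stp hT ht.1 (ev_meas_clamp hT hm) fun ω => ?_
  have key : ∀ c ∈ Set.Icc 0 t, (τ (stp hT t ω) ≤ c ↔ τ ω ≤ c) := fun c hc =>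
    stp_mem_iff hT (fraw_mono hc.2 _ (hτ c ⟨hc.1, hc.2.trans ht.2⟩)) ω
  have e : max 0 (min (τ (stp hT t ω)) t) = max 0 (min (τ ω) t) := by
    apply le_antisymm
    · refine max_le (le_max_left _ _) ?_
      rcases le_total (max 0 (min (τ ω) t)) t with h | h
      · by_cases h2 : τ ω ≤ t
        · exact (min_le_left _ _).trans ((key _ ⟨le_max_left _ _, h⟩).2
            (by rw [min_eq_left h2]; exact le_max_right _ _))
        · rw [min_eq_right (not_le.1 h2).le]; exact (min_le_right _ _).trans (le_max_right _ _)
      · exact (min_le_right _ _).trans h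
    · refine max_le (le_max_left _ _) ?_
      rcases le_total (max 0 (min (τ (stp hT t ω)) t)) t with h | h
      · by_cases h2 : τ (stp hT t ω) ≤ t
        · exact (min_le_left _ _).trans ((key _ ⟨le_max_left _ _, h⟩).1
            (by rw [min_eq_left h2]; exact le_max_right _ _))
        · rw [min_eq_right (not_le.1 h2).le]; exact (min_le_right _ _).trans (le_max_right _ _)
      · exact (min_le_right _ _).trans h
  have hmax : ∀ (w : Path T) (x : ℝ), ev T hT w (max 0 x) = ev T hT w x := fun w x => by
    rcases le_total 0 x with h' | h'
    · rw [max_eq_right h']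
    · rw [max_eq_left h', ev_of_le hT w h']
  rw [← hmax, e, hmax, ev_stp]
  congr 1
  exact min_eq_right (min_le_right _ _)

variable (k : ℕ)

def rho (k : ℕ) (ω : Path T) : ℝ := hitQ (fun r => {ω | (k:ℝ) < |ev T hT ω r|}) ω

lemma rho_nonneg (ω : Path T) : 0 ≤ rho hT k ω := hitQ_nonneg hT _ ω
lemma rho_le (ω : Path T) : rho hT k ω ≤ T := hitQ_le hT _ ω

lemma rho_lt {u : ℝ} (hu : u ≤ T) : MeasurableSet[Fraw T u] {ω | rho hT k ω < u} := by
  refine hitQ_lt hT _ (fun r h0 hr => ?_) hu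
  have : Measurable[Fraw T r] (fun ω => ev T hT ω r) := by
    have := fraw_eval (t := r) (⟨r, h0, hr⟩ : Set.Icc (0:ℝ) T) le_rfl
    simpa only [ev, clamp_of_mem hT ⟨h0, hr⟩] using this
  exact measurableSet_lt measurable_const (continuous_abs.measurable.comp this)

lemma rho_measurable : Measurable (rho hT k : Path T → ℝ) := by
  refine measurable_of_Iio fun c => ?_
  by_cases h : c ≤ T
  · exact fraw_le _ _ (rho_lt hT k h)
  · have : (rho hT k) ⁻¹' Iio c = univ := by
      ext ω
      simp only [mem_preimage, mem_Iio, mem_univ, iff_true]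
      exact (rho_le hT k ω).trans_lt (not_le.1 h)
    rw [this]; exact MeasurableSet.univ

lemma rho_bound {ω : Path T} (h0 : |ev T hT ω 0| ≤ k) {u : ℝ} (hu : u ≤ rho hT k ω) :
    |ev T hT ω u| ≤ k := by
  rcases le_or_gt u 0 with h | h
  · rw [ev_of_le hT ω h]; exact h0
  have hcl : u ∈ closure (Set.Ioo 0 (rho hT k ω) ∩ Set.range ((↑) : ℚ → ℝ)) := by
    have hd := Rat.denseRange_cast (𝕜 := ℝ)
    have := hd.open_subset_closure_inter (isOpen_Ioo (a := (0:ℝ)) (b := rho hT k ω))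
    have h2 := closure_mono this
    rw [closure_closure, closure_Ioo (h.trans_le hu).ne] at h2
    exact h2 ⟨h.le, hu⟩
  refine closure_minimal (t := {u | |ev T hT ω u| ≤ k}) ?_ ?_ hcl
  · rintro _ ⟨h1, q, rfl⟩
    have hn := hitQ_not_mem hT _ h1.1.le h1.2
    by_contra hc
    exact hn (by simpa using hc)
  · exact isClosed_le (continuous_ev hT ω).abs continuous_const

lemma ev_le_norm (ω : Path T) (u : ℝ) : |ev T hT ω u| ≤ ‖ω‖ := ω.norm_coe_le_norm _

lemma rho_eq_T {ω : Path T} (h : ‖ω‖ ≤ k) : rho hT k ω = T :=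
  hitQ_eq_T _ fun r _ _ hr => absurd ((ev_le_norm hT ω r).trans h) (not_le.2 hr)

def Yk (t : ℝ) (ω : Path T) : ℝ :=
  if |ev T hT ω 0| ≤ k then ev T hT ω (min t (rho hT k ω)) else 0

lemma Yk_bdd (t : ℝ) (ω : Path T) : |Yk hT k t ω| ≤ k := by
  unfold Yk
  split_ifs with h
  · exact rho_bound hT k h (min_le_right _ _)
  · simp

lemma S0_meas : MeasurableSet[Fraw T 0] {ω : Path T | |ev T hT ω 0| ≤ k} := by
  have : Measurable[Fraw T 0] (fun ω : Path T => ev T hT ω 0) := by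
    have := fraw_eval (t := 0) (⟨0, le_rfl, hT⟩ : Set.Icc (0:ℝ) T) le_rfl
    simpa only [ev, clamp_of_mem hT ⟨le_rfl, hT⟩] using this
  exact measurableSet_le (continuous_abs.measurable.comp this) measurable_const

lemma Yk_measurable (t : ℝ) : Measurable (Yk hT k t : Path T → ℝ) := by
  refine Measurable.ite (fraw_le _ _ (S0_meas hT k)) ?_ measurable_const
  exact ev_meas_clamp hT (measurable_const.max (measurable_const.min (rho_measurable hT k)))

lemma Yk_adapted {t : ℝ} (ht : 0 ≤ t) : Measurable[Fraw T t] (Yk hT k t : Path T → ℝ) := by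
  refine fraw_of_stp hT ht (Yk_measurable hT k t) fun ω => ?_
  have e : min t (rho hT k (stp hT t ω)) = min t (rho hT k ω) := by
    rcases le_or_gt T t with h | h
    · rw [stp_of_ge hT h]
    have key : ∀ u ≤ t, (rho hT k (stp hT t ω) < u ↔ rho hT k ω < u) := fun u hu =>
      stp_mem_iff hT (fraw_mono hu _ (rho_lt hT k (hu.trans h.le))) ω
    refine le_antisymm ?_ ?_
    · refine le_min (min_le_left _ _) ?_
      by_contra hcon
      push Not at hcon
      have := (key _ (min_le_left _ _)).2 hcon
      exact absurd this (not_lt.2 (min_le_right _ _))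
    · refine le_min (min_le_left _ _) ?_
      by_contra hcon
      push Not at hcon
      have := (key _ (min_le_left _ _)).1 hcon
      exact absurd this (not_lt.2 (min_le_right _ _))
  unfold Yk
  rw [e, ev_stp, ev_stp, min_eq_right ht, min_eq_right (min_le_left _ _)]

lemma Yk_mart0 (hL : IsLocalMart T Q (Sproc T hT)) {s t : ℝ} (h0 : 0 ≤ s) (hst : s ≤ t) (htT : t ≤ T)
    (A : Set (Path T)) (hA : MeasurableSet[Fraw T s] A) :
    ∫ ω in A, (Yk hT k t ω - Yk hT k s ω) ∂Q = 0 := by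
  obtain ⟨τ, hτ, hτl, hτm⟩ := hL
  set A' := A ∩ {ω : Path T | |ev T hT ω 0| ≤ k}
  have hA' : MeasurableSet[Fraw T s] A' := MeasurableSet.inter hA (fraw_mono h0 _ (S0_meas hT k))
  set d : ℕ → Path T → ℝ := fun m ω => ev T hT ω (min (τ m ω) (min (max (rho hT k ω) s) t)) -
    ev T hT ω (min (τ m ω) s) with hd
  have hsT : s ∈ Set.Icc (0:ℝ) T := ⟨h0, hst.trans htT⟩
  have hos := fun m => opt_stop (Q := Q) (rho hT k) s t
      (fun t ω => Sproc T hT (min (τ m ω) t) ω) (hτm m)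
      (fun u hu => stopped_adapted hT (hτ m) hu) (fun u hu => rho_lt hT k hu) h0 hst htT
      (fun ω => (continuous_ev hT ω).comp (continuous_const.min continuous_id)) A' hA'
  have hd0 : ∀ m, ∫ ω in A', d m ω ∂Q = 0 := by
    intro m
    obtain ⟨hi, he⟩ := hos m
    have hi2 := (hτm m).1 s hsT
    exact (integral_sub hi.integrableOn hi2.integrableOn).trans (sub_eq_zero.2 he)
  have hlim : Tendsto (fun m => ∫ ω in A', d m ω ∂Q) atTop
      (𝓝 (∫ ω in A', (Yk hT k t ω - Yk hT k s ω) ∂Q)) := by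
    refine tendsto_integral_of_dominated_convergence (fun _ => (2 * k : ℝ)) (fun m => ?_)
      (integrable_const _) (fun m => ?_) ?_
    · exact ((hos m).1.aestronglyMeasurable.sub
        ((hτm m).1 s hsT).aestronglyMeasurable).restrict
    · refine (ae_restrict_iff' (fraw_le _ _ hA')).2 (Eventually.of_forall fun ω hω => ?_)
      have hω0 : |ev T hT ω 0| ≤ k := hω.2
      rw [Real.norm_eq_abs]
      simp only [hd]
      rcases le_total (rho hT k ω) s with h | h
      · rw [max_eq_right h, min_eq_left hst, sub_self, abs_zero]; positivity
      · rw [max_eq_left h]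
        have b1 := rho_bound hT k hω0 (u := min (τ m ω) (min (rho hT k ω) t))
          ((min_le_right _ _).trans (min_le_left _ _))
        have b2 := rho_bound hT k hω0 (u := min (τ m ω) s) ((min_le_right _ _).trans h)
        refine (abs_sub _ _).trans ?_
        linarith
    · have hl2 := ae_restrict_of_ae (s := A') hτl
      have hl3 := (ae_restrict_iff' (μ := Q) (p := fun ω => ω ∈ A') (fraw_le _ _ hA')).2
        (Eventually.of_forall fun ω hω => hω)
      filter_upwards [hl2, hl3] with ω hω hωA
      have hω0 : |ev T hT ω 0| ≤ k := hωA.2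
      refine tendsto_const_nhds.congr' ?_
      filter_upwards [hω.2.eventually_ge_atTop T] with m hm
      simp only [hd, Yk, if_pos hω0]
      have hx : min (max (rho hT k ω) s) t ≤ τ m ω := (min_le_right _ _).trans (htT.trans hm)
      rw [min_eq_right hx, min_eq_right ((hst.trans htT).trans hm)]
      rcases le_total (rho hT k ω) s with h | h
      · rw [max_eq_right h, min_eq_left hst, min_eq_right h, min_eq_right (h.trans hst)]; ring
      · rw [max_eq_left h, min_eq_left h, min_comm]
  simp only [hd0] at hlim
  have hz := tendsto_nhds_unique tendsto_const_nhds hlim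
  have hsplit : ∫ ω in A, (Yk hT k t ω - Yk hT k s ω) ∂Q =
      ∫ ω in A', (Yk hT k t ω - Yk hT k s ω) ∂Q := by
    rw [← integral_indicator (fraw_le _ _ hA), ← integral_indicator (fraw_le _ _ hA')]
    congr 1
    funext ω
    by_cases h1 : ω ∈ A
    · by_cases h2 : |ev T hT ω 0| ≤ k
      · have hm : ω ∈ A' := ⟨h1, h2⟩
        rw [indicator_of_mem h1, indicator_of_mem hm]
      · rw [indicator_of_mem h1, indicator_of_notMem (fun h => h2 h.2)]
        simp [Yk, h2]
    · rw [indicator_of_notMem h1, indicator_of_notMem (fun h => h1 h.1)]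
  rw [hsplit, ← hz]

lemma Yk_T {t : ℝ} (h : T ≤ t) (ω : Path T) : Yk hT k t ω = Yk hT k T ω := by
  unfold Yk
  rw [min_eq_right (rho_le hT k ω), min_eq_right ((rho_le hT k ω).trans h)]

lemma Yk_mart (hL : IsLocalMart T Q (Sproc T hT)) {s t : ℝ} (h0 : 0 ≤ s) (hst : s ≤ t)
    (A : Set (Path T)) (hA : MeasurableSet[Fraw T s] A) :
    ∫ ω in A, (Yk hT k t ω - Yk hT k s ω) ∂Q = 0 := by
  rcases le_total T s with h | h
  · simp [Yk_T hT k h, Yk_T hT k (h.trans hst)]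
  · rcases le_total T t with h' | h'
    · simp only [Yk_T hT k h']
      exact Yk_mart0 hT k hL h0 h le_rfl A hA
    · exact Yk_mart0 hT k hL h0 hst h' A hA

end Weak


section Weak2
variable {T : ℝ} (hT : 0 ≤ T)

def posn (H : SimpleStrategy T) (t : ℝ) (ω : Path T) : ℝ :=
  ∑ l : Fin H.L, H.coeff l ω *
    ((if H.τ l.castSucc ω < t then 1 else 0) - (if H.τ l.succ ω < t then 1 else 0))

lemma tau_nonneg (H : SimpleStrategy T) (l : Fin (H.L+1)) (ω : Path T) : 0 ≤ H.τ l ω := by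
  induction l using Fin.induction with
  | zero => exact H.τ_nonneg ω
  | succ i ih => exact ih.trans (H.τ_mono i ω)

lemma tau_le (H : SimpleStrategy T) (l : Fin (H.L+1)) (ω : Path T) : H.τ l ω ≤ T := by
  induction l using Fin.reverseInduction with
  | last => exact H.τ_le ω
  | cast i ih => exact (H.τ_mono i ω).trans ih

lemma tau_isStop (H : SimpleStrategy T) (l : Fin (H.L + 1)) : IsStopPlus T (H.τ l) := by
  obtain ⟨_, _, _, _, _, _, h, _, _⟩ := H
  exact h l

lemma posn_meas (H : SimpleStrategy T) {t : ℝ} (ht : t ≤ T) : Measurable[Fraw T t] (posn H t) := by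
  unfold posn
  refine Finset.measurable_sum _ fun l _ => ?_
  have h1 := coeff_lt (fun ω => tau_nonneg H l.castSucc ω) (tau_isStop H l.castSucc) (H.coeff_meas l) ht
  have h2 := stop_lt (fun ω => tau_nonneg H l.succ ω) (tau_isStop H l.succ) ht
  have h3 : Measurable[Fraw T t] (fun ω => if H.τ l.succ ω < t then (1:ℝ) else 0) :=
    Measurable.ite h2 measurable_const measurable_const
  have e : (fun ω => H.coeff l ω *
    ((if H.τ l.castSucc ω < t then (1:ℝ) else 0) - (if H.τ l.succ ω < t then 1 else 0))) =
    fun ω => (H.coeff l ω * (if H.τ l.castSucc ω < t then (1:ℝ) else 0)) -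
      (H.coeff l ω * (if H.τ l.castSucc ω < t then (1:ℝ) else 0)) *
        (if H.τ l.succ ω < t then (1:ℝ) else 0) := by
    funext ω
    by_cases hh : H.τ l.succ ω < t
    · have := (H.τ_mono l ω).trans_lt hh
      simp [hh, this]
    · simp [hh]
  rw [e]
  exact h1.sub (h1.mul h3)

lemma posn_bdd (H : SimpleStrategy T) : ∃ C : ℝ, 0 ≤ C ∧ ∀ t ω, |posn H t ω| ≤ C := by
  choose C hC using H.coeff_bdd
  refine ⟨∑ l, |C l| * 2, Finset.sum_nonneg fun l _ => by positivity, fun t ω => ?_⟩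
  refine (Finset.abs_sum_le_sum_abs _ _).trans (Finset.sum_le_sum fun l _ => ?_)
  rw [abs_mul]
  refine mul_le_mul ((hC l ω).trans (le_abs_self _)) ?_ (abs_nonneg _) (abs_nonneg _)
  split_ifs <;> norm_num

lemma grid_posn_S (H : SimpleStrategy T) (ω : Path T) {ρ : ℝ} (hρ0 : 0 ≤ ρ) (hρ : ρ ≤ T) :
    Tendsto (fun n => ∑ j ∈ Finset.range (2^n), posn H (tg T n j) ω *
      (ev T hT ω (min (tg T n (j+1)) ρ) - ev T hT ω (min (tg T n j) ρ))) atTop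
      (𝓝 (integ T H (Sproc T hT) ρ ω)) := by
  have : ∀ l : Fin H.L, Tendsto (fun n => H.coeff l ω * ((∑ j ∈ Finset.range (2^n),
      (if H.τ l.castSucc ω < tg T n j then (1:ℝ) else 0) *
      (ev T hT ω (min (tg T n (j+1)) ρ) - ev T hT ω (min (tg T n j) ρ))) -
      ∑ j ∈ Finset.range (2^n), (if H.τ l.succ ω < tg T n j then (1:ℝ) else 0) *
      (ev T hT ω (min (tg T n (j+1)) ρ) - ev T hT ω (min (tg T n j) ρ)))) atTop
      (𝓝 (H.coeff l ω * (Sproc T hT (min (H.τ l.succ ω) ρ) ω -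
        Sproc T hT (min (H.τ l.castSucc ω) ρ) ω))) := fun l => by
    have h := ((grid_S hT ω ρ (H.τ l.castSucc ω) hρ0 hρ).sub
      (grid_S hT ω ρ (H.τ l.succ ω) hρ0 hρ)).const_mul (H.coeff l ω)
    convert h using 2
    simp only [Sproc]; ring
  refine (tendsto_finsetSum Finset.univ fun l _ => this l).congr fun n => ?_
  simp only [posn, Finset.sum_mul]
  rw [Finset.sum_comm]
  refine Finset.sum_congr rfl fun l _ => ?_
  rw [← Finset.sum_sub_distrib, Finset.mul_sum]
  exact Finset.sum_congr rfl fun j _ => by ring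

lemma grid_posn_R (H : SimpleStrategy T) (m : ℕ) (ω : Path T) {ρ : ℝ} (hρ0 : 0 ≤ ρ) (hρ : ρ ≤ T) :
    Tendsto (fun n => ∑ j ∈ Finset.range (2^n), Rm hT m (tg T n j) ω * posn H (tg T n j) ω *
      (ev T hT ω (min (tg T n (j+1)) ρ) - ev T hT ω (min (tg T n j) ρ))) atTop
      (𝓝 (integ T H (Sm T hT m) ρ ω)) := by
  have : ∀ l : Fin H.L, Tendsto (fun n => H.coeff l ω * ((∑ j ∈ Finset.range (2^n),
      ((if H.τ l.castSucc ω < tg T n j then (1:ℝ) else 0) * Rm hT m (tg T n j) ω) *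
      (ev T hT ω (min (tg T n (j+1)) ρ) - ev T hT ω (min (tg T n j) ρ))) -
      ∑ j ∈ Finset.range (2^n),
      ((if H.τ l.succ ω < tg T n j then (1:ℝ) else 0) * Rm hT m (tg T n j) ω) *
      (ev T hT ω (min (tg T n (j+1)) ρ) - ev T hT ω (min (tg T n j) ρ)))) atTop
      (𝓝 (H.coeff l ω * (Sm T hT m (min (H.τ l.succ ω) ρ) ω -
        Sm T hT m (min (H.τ l.castSucc ω) ρ) ω))) := fun l => by
    have h := ((grid_R hT m ω ρ (H.τ l.castSucc ω) hρ0 hρ).sub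
      (grid_R hT m ω ρ (H.τ l.succ ω) hρ0 hρ)).const_mul (H.coeff l ω)
    convert h using 2
    ring
  refine (tendsto_finsetSum Finset.univ fun l _ => this l).congr fun n => ?_
  simp only [posn, Finset.sum_mul, Finset.mul_sum]
  rw [Finset.sum_comm]
  refine Finset.sum_congr rfl fun l _ => ?_
  rw [← Finset.sum_sub_distrib, Finset.mul_sum]
  exact Finset.sum_congr rfl fun j _ => by ring

variable {Q : Measure (Path T)} [IsProbabilityMeasure Q] (k : ℕ)

lemma Z1 (hL : IsLocalMart T Q (Sproc T hT)) (H G : SimpleStrategy T) :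
    ∃ C : ℝ, 0 ≤ C ∧ ∀ m, 
    AEMeasurable (fun ω => if |ev T hT ω 0| ≤ k then integ T H (Sproc T hT) (rho hT k ω) ω +
      integ T G (Sm T hT m) (rho hT k ω) ω else 0) Q ∧
    ∫ ω, (if |ev T hT ω 0| ≤ k then integ T H (Sproc T hT) (rho hT k ω) ω +
      integ T G (Sm T hT m) (rho hT k ω) ω else 0) ∂Q = 0 ∧
    ∫⁻ ω, ENNReal.ofReal ((if |ev T hT ω 0| ≤ k then integ T H (Sproc T hT) (rho hT k ω) ω +
      integ T G (Sm T hT m) (rho hT k ω) ω else 0)^2) ∂Q ≤ ENNReal.ofReal C := by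
  obtain ⟨CH, hCH0, hCH⟩ := posn_bdd H
  obtain ⟨CG, hCG0, hCG⟩ := posn_bdd G
  have hk : (0:ℝ) ≤ k := Nat.cast_nonneg k
  refine ⟨(CH + k * CG)^2 * (2*k)^2, by positivity, fun m => ?_⟩
  let a : ℕ → ℕ → Path T → ℝ := fun n j ω => if j < 2^n then
    posn H (tg T n j) ω + clip k (Rm hT m (tg T n j) ω) * posn G (tg T n j) ω else 0
  let D : ℕ → ℕ → Path T → ℝ := fun n j ω => Yk hT k (tg T n (j+1)) ω - Yk hT k (tg T n j) ω
  have hF : ∀ n i, Fraw T (tg T n i) ≤ (inferInstance : MeasurableSpace (Path T)) :=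
    fun n i => fraw_le _
  have hmono : ∀ n, Monotone (fun i => Fraw T (tg T n i)) := fun n i j h => fraw_mono (tg_mono hT n h)
  have hDb : ∀ n i ω, |D n i ω| ≤ 2 * k := fun n i ω => by
    refine (abs_sub _ _).trans ?_
    linarith [Yk_bdd hT k (tg T n (i+1)) ω, Yk_bdd hT k (tg T n i) ω]
  have hab : ∀ n i ω, |a n i ω| ≤ CH + k * CG := fun n i ω => by
    simp only [a]
    split_ifs
    · refine (abs_add_le _ _).trans (add_le_add (hCH _ _) ?_)
      rw [abs_mul]
      exact mul_le_mul (clip_abs hk _) (hCG _ _) (abs_nonneg _) hk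
    · rw [abs_zero]; positivity
  have hDm : ∀ n i, Measurable[Fraw T (tg T n (i+1))] (D n i) := fun n i =>
    (Yk_adapted hT k (tg_nonneg hT n _)).sub
      ((Yk_adapted hT k (tg_nonneg hT n _)).mono (fraw_mono (tg_mono hT n (Nat.le_succ i))) le_rfl)
  have ham : ∀ n i, Measurable[Fraw T (tg T n i)] (a n i) := fun n i => by
    by_cases h : i < 2^n
    · have : a n i = fun ω => posn H (tg T n i) ω + clip k (Rm hT m (tg T n i) ω) * posn G (tg T n i) ω := by
        funext ω; simp only [a, if_pos h]
      rw [this]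
      exact (posn_meas H (tg_le hT h.le)).add (((continuous_clip _).measurable.comp
        (Rm_fraw hT m (tg_nonneg hT n i) (tg_le hT h.le))).mul (posn_meas G (tg_le hT h.le)))
    · have : a n i = fun ω => 0 := by
        funext ω; simp only [a, if_neg h]
      rw [this]; exact measurable_const
  have hD0 : ∀ n i A, MeasurableSet[Fraw T (tg T n i)] A → ∫ x in A, D n i x ∂Q = 0 :=
    fun n i A hA => Yk_mart hT k hL (tg_nonneg hT n i) (tg_mono hT n (Nat.le_succ i)) A hA
  have hsm : ∀ n, Measurable (fun x => ∑ j ∈ Finset.range (2^n), a n j x * D n j x) := fun n =>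
    (sum_meas_bdd (fun i => Fraw T (tg T n i)) (hmono n) (D n) (a n) _ _ (hDb n) (hab n) (hDm n)
      (ham n) (2^n)).1.mono (hF n _) le_rfl
  have hsb := fun n => (sum_meas_bdd (fun i => Fraw T (tg T n i)) (hmono n) (D n) (a n) _ _ (hDb n) (hab n) (hDm n)
      (ham n) (2^n)).2
  refine L2_lim (Zn := fun n x => ∑ j ∈ Finset.range (2^n), a n j x * D n j x)
    (fun n => (hsm n).aemeasurable) (by positivity) (Eventually.of_forall fun ω => ?_)
    (fun n => sum_zero (fun i => Fraw T (tg T n i)) (hF n) (D n) (a n) _ _ (hDb n) (hab n) (hDm n)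
      (ham n) (hD0 n) (2^n)) (fun n => ?_)
  · by_cases h0 : |ev T hT ω 0| ≤ k
    · simp only [if_pos h0]
      refine ((grid_posn_S hT H ω (rho_nonneg hT k ω) (rho_le hT k ω)).add
        (grid_posn_R hT G m ω (rho_nonneg hT k ω) (rho_le hT k ω))).congr fun n => ?_
      rw [← Finset.sum_add_distrib]
      refine Finset.sum_congr rfl fun j hj => ?_
      have hj := Finset.mem_range.1 hj
      simp only [a, D, Yk, if_pos h0, if_pos hj]
      rcases le_or_gt (rho hT k ω) (tg T n j) with h | h
      · rw [min_eq_right h, min_eq_right (h.trans (tg_mono hT n (Nat.le_succ j)))]; ring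
      · rw [clip_eq (Rm_bound hT m ω (tg_nonneg hT n j) (tg_le hT hj.le)
          (fun s _ hs => rho_bound hT k h0 (hs.trans h.le)))]
        ring
    · simp only [if_neg h0, D, Yk]
      simp
  · rw [← ofReal_integral_eq_lintegral_ofReal]
    · refine ENNReal.ofReal_le_ofReal (sq_sum_le (fun i => Fraw T (tg T n i)) (hF n) (hmono n)
        (D n) (a n) _ _ (hDb n) (hab n) (hDm n) (ham n) (hD0 n) (2^n) _ fun x => ?_)
      simp only [D]
      rw [Finset.sum_range_sub (fun j => Yk hT k (tg T n j) x)]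
      refine (abs_sub _ _).trans ?_
      linarith [Yk_bdd hT k (tg T n (2^n)) x, Yk_bdd hT k (tg T n 0) x]
    · refine int_of_bdd ((hsm n).pow_const 2).aestronglyMeasurable
        (C := (((2^n:ℕ):ℝ) * ((CH + k * CG) * (2*k)))^2) fun x => ?_
      rw [abs_pow]
      exact pow_le_pow_left₀ (abs_nonneg _) (hsb n x) 2
    · exact Eventually.of_forall fun x => sq_nonneg _

lemma integ_Sm_tendsto (G : SimpleStrategy T) {ω : Path T} (h : ω ∈ Cv hT) {t : ℝ} (h0 : 0 ≤ t)
    : Tendsto (fun m => integ T G (Sm T hT m) t ω) atTop (𝓝 (integ T G (SS T hT) t ω)) := by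
  refine tendsto_finsetSum _ fun l _ => Tendsto.const_mul _ (Tendsto.sub ?_ ?_)
  · have hm : min (G.τ l.succ ω) t ∈ Set.Icc (0:ℝ) T :=
      ⟨le_min (tau_nonneg _ _ _) h0, (min_le_left _ _).trans (tau_le _ _ _)⟩
    rw [SS_eq hT h hm]
    exact Sm_tendsto_SSP hT h hm
  · have hm : min (G.τ l.castSucc ω) t ∈ Set.Icc (0:ℝ) T :=
      ⟨le_min (tau_nonneg _ _ _) h0, (min_le_left _ _).trans (tau_le _ _ _)⟩
    rw [SS_eq hT h hm]
    exact Sm_tendsto_SSP hT h hm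

lemma Z2 (hL : IsLocalMart T Q (Sproc T hT)) (hC : ∀ᵐ ω ∂Q, ω ∈ Cv hT) (H G : SimpleStrategy T) :
    ∃ C : ℝ, 
    AEMeasurable (fun ω => if |ev T hT ω 0| ≤ k then integ T H (Sproc T hT) (rho hT k ω) ω +
      integ T G (SS T hT) (rho hT k ω) ω else 0) Q ∧
    ∫ ω, (if |ev T hT ω 0| ≤ k then integ T H (Sproc T hT) (rho hT k ω) ω +
      integ T G (SS T hT) (rho hT k ω) ω else 0) ∂Q = 0 ∧
    ∫⁻ ω, ENNReal.ofReal ((if |ev T hT ω 0| ≤ k then integ T H (Sproc T hT) (rho hT k ω) ω +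
      integ T G (SS T hT) (rho hT k ω) ω else 0)^2) ∂Q ≤ ENNReal.ofReal C := by
  obtain ⟨C, hC0, h⟩ := Z1 hT k hL H G
  refine ⟨C, L2_lim (fun m => (h m).1) hC0 ?_ (fun m => (h m).2.1) (fun m => (h m).2.2)⟩
  filter_upwards [hC] with ω hω
  by_cases h0 : |ev T hT ω 0| ≤ k
  · simp only [if_pos h0]
    exact tendsto_const_nhds.add (integ_Sm_tendsto hT G hω (rho_nonneg hT k ω))
  · simp only [if_neg h0]; exact tendsto_const_nhds

/-- supermartingale property of admissible strategies -/
lemma admissible_le {Ξ : Set (Path T)} (hL : IsLocalMart T Q (Sproc T hT))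
    (hC : ∀ᵐ ω ∂Q, ω ∈ Cv hT) (hΞ : ∀ᵐ ω ∂Q, ω ∈ Ξ) (H G : SimpleStrategy T) {lam : ℝ}
    (hl : 0 ≤ lam)
    (hadm : ∀ t ∈ Set.Icc (0:ℝ) T, ∀ ω ∈ Ξ,
      0 ≤ lam + integ T H (Sproc T hT) t ω + integ T G (SS T hT) t ω) :
    AEMeasurable (fun ω => ENNReal.ofReal (lam + integ T H (Sproc T hT) T ω + integ T G (SS T hT) T ω)) Q ∧
    ∫⁻ ω, ENNReal.ofReal (lam + integ T H (Sproc T hT) T ω + integ T G (SS T hT) T ω) ∂Q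
      ≤ ENNReal.ofReal lam := by
  set W : ℕ → Path T → ℝ := fun k ω => if |ev T hT ω 0| ≤ k then
      integ T H (Sproc T hT) (rho hT k ω) ω + integ T G (SS T hT) (rho hT k ω) ω else 0 with hW
  have hWm : ∀ k, AEMeasurable (W k) Q := fun k => (Z2 hT k hL hC H G).choose_spec.1
  have hWi : ∀ k, Integrable (W k) Q := fun k =>
    (int_of_sq (hWm k) (Z2 hT k hL hC H G).choose_spec.2.2).1
  have hW0 : ∀ k, ∫ ω, W k ω ∂Q = 0 := fun k => (Z2 hT k hL hC H G).choose_spec.2.1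
  have hlimW : ∀ ω, ∀ᶠ k : ℕ in atTop, lam + integ T H (Sproc T hT) T ω + integ T G (SS T hT) T ω =
      lam + W k ω := fun ω => by
    obtain ⟨N, hN⟩ := exists_nat_ge ‖ω‖
    filter_upwards [eventually_ge_atTop N] with k hk
    have hk' : ‖ω‖ ≤ k := hN.trans (Nat.cast_le.2 hk)
    have := rho_eq_T hT k hk'
    simp only [hW, if_pos ((ev_le_norm hT ω 0).trans hk'), this]
    ring
  have hlim : ∀ ω, Tendsto (fun k => ENNReal.ofReal (lam + W k ω)) atTop
      (𝓝 (ENNReal.ofReal (lam + integ T H (Sproc T hT) T ω + integ T G (SS T hT) T ω))) := fun ω => by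
    refine tendsto_const_nhds.congr' ?_
    filter_upwards [hlimW ω] with k hk
    rw [hk]
  have hm : ∀ k, AEMeasurable (fun ω => ENNReal.ofReal (lam + W k ω)) Q := fun k =>
    ((hWm k).const_add lam).ennreal_ofReal
  refine ⟨aemeasurable_of_tendsto_metrizable_ae' hm (Eventually.of_forall hlim), ?_⟩
  have hval : ∀ k, ∫⁻ ω, ENNReal.ofReal (lam + W k ω) ∂Q = ENNReal.ofReal lam := fun k => by
    rw [← ofReal_integral_eq_lintegral_ofReal]
    · rw [integral_add (integrable_const _) (hWi k), hW0 k]; simp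
    · exact (integrable_const _).add (hWi k)
    · filter_upwards [hΞ] with ω hω
      simp only [hW, Pi.zero_apply]
      split_ifs
      · rw [← add_assoc]
        exact hadm _ ⟨rho_nonneg hT k ω, rho_le hT k ω⟩ ω hω
      · simpa using hl
  calc _ = ∫⁻ ω, liminf (fun k => ENNReal.ofReal (lam + W k ω)) atTop ∂Q := by
        congr 1; funext ω; exact (hlim ω).liminf_eq.symm
    _ ≤ liminf (fun k => ∫⁻ ω, ENNReal.ofReal (lam + W k ω) ∂Q) atTop := lintegral_liminf_le' hm
    _ = ENNReal.ofReal lam := by simp only [hval]; simp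

end Weak2


section WeakMain
variable {T : ℝ} (hT : 0 ≤ T)

lemma toENNReal_liminf_le {x : ℝ≥0∞} {lam : ℝ} {X : ℕ → ℝ}
    (h : (x : EReal) ≤ (lam : EReal) + liminf (fun n => ((X n : ℝ) : EReal)) atTop) :
    x ≤ liminf (fun n => ENNReal.ofReal (lam + X n)) atTop := by
  refine le_of_forall_lt fun c hc => ?_
  have hc' : (c : EReal) < (lam : EReal) + liminf (fun n => ((X n : ℝ) : EReal)) atTop :=
    (EReal.coe_ennreal_lt_coe_ennreal_iff.2 hc).trans_le h
  obtain ⟨d, hd1, hd2⟩ := EReal.lt_iff_exists_real_btwn.1 hc'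
  have hd3 : ((d - lam : ℝ) : EReal) < liminf (fun n => ((X n : ℝ) : EReal)) atTop := by
    rw [EReal.coe_sub]
    exact EReal.sub_lt_of_lt_add' hd2
  have hev := eventually_lt_of_lt_liminf hd3
  have hc0 : c < ENNReal.ofReal d := by
    have hd0 : 0 ≤ d := by
      have := (EReal.coe_ennreal_nonneg c).trans hd1.le
      exact_mod_cast this
    rw [← EReal.coe_ennreal_lt_coe_ennreal_iff, EReal.coe_ennreal_ofReal, max_eq_left hd0]
    exact hd1
  refine hc0.trans_le (le_liminf_of_le (by isBoundedDefault) ?_)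
  filter_upwards [hev] with n hn
  have := EReal.coe_lt_coe_iff.1 hn
  exact ENNReal.ofReal_le_ofReal (by linarith)

lemma weak_duality {Ξ : Set (Path T)} {Xibar : Set (PathPair T)} (hA : AssumptionA T hT Ξ Xibar)
    (ξ : Path T → ℝ≥0∞) : (supMart T hT Ξ ξ : EReal) ≤ Phi T hT Ξ (fun ω => (ξ ω : EReal)) := by
  refine le_sInf ?_
  rintro _ ⟨lam, ⟨H, G, hadm, hsup⟩, rfl⟩
  have hl : 0 ≤ lam := by
    obtain ⟨ω, hω⟩ := hA.xi_nonempty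
    have := hadm 0 0 ⟨le_rfl, hT⟩ ω hω
    have e : ∀ (H : SimpleStrategy T) (X : ℝ → Path T → ℝ), integ T H X 0 ω = 0 := fun H X => by
      refine Finset.sum_eq_zero fun l _ => ?_
      rw [min_eq_right (tau_nonneg _ _ _), min_eq_right (tau_nonneg _ _ _), sub_self, mul_zero]
    rw [e, e] at this
    linarith
  have key : supMart T hT Ξ ξ ≤ ENNReal.ofReal lam := by
    refine iSup₂_le fun Q hQ => ?_
    obtain ⟨hQp, hL, hQ1⟩ := hQ
    have hΞ : ∀ᵐ ω ∂Q, ω ∈ Ξ := (mem_ae_iff_prob_eq_one (Xi_measurable hT hA)).2 hQ1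
    have hC : ∀ᵐ ω ∂Q, ω ∈ Cv hT := by
      filter_upwards [hΞ] with ω hω
      rw [hA.xi_eq] at hω
      exact ((mem_Omega_iff hT ω).1 hω.1).1
    have hs := fun n => admissible_le hT hL hC hΞ (H n) (G n) hl (hadm n)
    calc ∫⁻ ω, ξ ω ∂Q ≤ ∫⁻ ω, liminf (fun n => ENNReal.ofReal (lam +
          integ T (H n) (Sproc T hT) T ω + integ T (G n) (SS T hT) T ω)) atTop ∂Q := by
          refine lintegral_mono_ae ?_
          filter_upwards [hΞ] with ω hω
          have := toENNReal_liminf_le (hsup ω hω)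
          simpa only [add_assoc] using this
      _ ≤ liminf (fun n => ∫⁻ ω, ENNReal.ofReal (lam +
          integ T (H n) (Sproc T hT) T ω + integ T (G n) (SS T hT) T ω) ∂Q) atTop :=
          lintegral_liminf_le' fun n => (hs n).1
      _ ≤ liminf (fun _ : ℕ => ENNReal.ofReal lam) atTop :=
          liminf_le_liminf (Eventually.of_forall fun n => (hs n).2)
      _ = ENNReal.ofReal lam := by simp
  have := EReal.coe_ennreal_le_coe_ennreal_iff.2 key
  rwa [EReal.coe_ennreal_ofReal, max_eq_left hl] at this

end WeakMain


section Hedge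
variable {T : ℝ} (hT : 0 ≤ T)

def sp (s : ℝ) (p : PathPair T) : PathPair T := (stp hT s p.1, stp hT s p.2)

lemma sp_sp (s t : ℝ) (p : PathPair T) : sp hT s (sp hT t p) = sp hT (min s t) p := by
  simp only [sp, stp_stp]

lemma sp_of_ge {s : ℝ} (h : T ≤ s) (p : PathPair T) : sp hT s p = p := by
  simp only [sp, stp_of_ge hT h]

lemma continuous_sp (s : ℝ) : Continuous (sp hT s : PathPair T → PathPair T) :=
  ((continuous_stp hT s).comp continuous_fst).prodMk ((continuous_stp hT s).comp continuous_snd)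

lemma SSbar_sp {s : ℝ} (hs : 0 ≤ s) (t : ℝ) (p : PathPair T) :
    SSbarProc T hT t (sp hT s p) = SSbarProc T hT (min s t) p := by
  simp only [SSbarProc, sp, ev_stp, min_eq_right hs]

lemma Sbar_sp (s : ℝ) (t : ℝ) (p : PathPair T) :
    SbarProc T hT t (sp hT s p) = SbarProc T hT (min s t) p := by
  simp only [SbarProc, sp, ev_stp]

lemma continuous_Sbar (t : ℝ) : Continuous (SbarProc T hT t) :=
  (continuous_ev_left hT t).comp continuous_fst

lemma continuous_SSbar (t : ℝ) : Continuous (SSbarProc T hT t) :=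
  (((((continuous_ev_left hT t).comp continuous_fst).pow 2).sub
    (((continuous_ev_left hT 0).comp continuous_fst).pow 2)).sub
    ((continuous_ev_left hT t).comp continuous_snd)).div_const 2

lemma continuous_Sbar_t (p : PathPair T) : Continuous (fun t => SbarProc T hT t p) :=
  continuous_ev hT p.1

lemma continuous_SSbar_t (p : PathPair T) : Continuous (fun t => SSbarProc T hT t p) :=
  ((((continuous_ev hT p.1).pow 2).sub continuous_const).sub (continuous_ev hT p.2)).div_const 2

structure IsHedge (n : ℕ) (α β : ℕ → PathPair T → ℝ) : Prop where
  ca : ∀ j, Continuous (α j)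
  cb : ∀ j, Continuous (β j)
  ba : ∀ j, ∃ C, ∀ p, |α j p| ≤ C
  bb : ∀ j, ∃ C, ∀ p, |β j p| ≤ C
  aa : ∀ j p, α j (sp hT (tg T n j) p) = α j p
  ab : ∀ j p, β j (sp hT (tg T n j) p) = β j p

def hv (n : ℕ) (α β : ℕ → PathPair T → ℝ) (t : ℝ) (p : PathPair T) : ℝ :=
  ∑ j ∈ Finset.range (2^n),
    (α j p * (SbarProc T hT (min (tg T n (j+1)) t) p - SbarProc T hT (min (tg T n j) t) p) +
     β j p * (SSbarProc T hT (min (tg T n (j+1)) t) p - SSbarProc T hT (min (tg T n j) t) p))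

variable {n : ℕ} {α β : ℕ → PathPair T → ℝ}

lemma hv_sp (h : IsHedge hT n α β) {t : ℝ} (ht : 0 ≤ t) (p : PathPair T) :
    hv hT n α β T (sp hT t p) = hv hT n α β t p := by
  refine Finset.sum_congr rfl fun j hj => ?_
  have hj := Finset.mem_range.1 hj
  rw [min_eq_left (tg_le hT hj), min_eq_left (tg_le hT hj.le)]
  simp only [SSbar_sp hT ht, Sbar_sp hT, min_comm t]
  rcases le_total t (tg T n j) with h1 | h1
  · rw [min_eq_right h1, min_eq_right (h1.trans (tg_mono hT n (Nat.le_succ j)))]; ring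
  · have e1 : α j (sp hT t p) = α j p := by
      rw [← h.aa j (sp hT t p), sp_sp, min_eq_left h1, h.aa]
    have e2 : β j (sp hT t p) = β j p := by
      rw [← h.ab j (sp hT t p), sp_sp, min_eq_left h1, h.ab]
    rw [e1, e2]

lemma hv_cont_t (p : PathPair T) : Continuous (fun t => hv hT n α β t p) := by
  refine continuous_finsetSum _ fun j _ => ?_
  have h1 := fun c : ℝ => (continuous_Sbar_t hT p).comp ((continuous_const (y := c)).min continuous_id)
  have h2 := fun c : ℝ => (continuous_SSbar_t hT p).comp ((continuous_const (y := c)).min continuous_id)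
  exact (continuous_const.mul ((h1 _).sub (h1 _))).add (continuous_const.mul ((h2 _).sub (h2 _)))

lemma hv_cont (h : IsHedge hT n α β) (t : ℝ) : Continuous (hv hT n α β t) := by
  refine continuous_finsetSum _ fun j _ => ?_
  exact ((h.ca j).mul ((continuous_Sbar hT _).sub (continuous_Sbar hT _))).add
    ((h.cb j).mul ((continuous_SSbar hT _).sub (continuous_SSbar hT _)))

lemma hv_zero (p : PathPair T) : hv hT n α β 0 p = 0 := by
  refine Finset.sum_eq_zero fun j _ => ?_
  rw [min_eq_right (tg_nonneg hT _ _), min_eq_right (tg_nonneg hT _ _)]; ring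

def theta (n : ℕ) (α β : ℕ → PathPair T → ℝ) (lam : ℝ) (ω : Path T) : ℝ :=
  hitQ (fun r => {ω | lam + hv hT n α β T (stp hT r ω, GP hT (stp hT r ω)) < 0}) ω

lemma pre_meas {f : PathPair T → ℝ} (hf : Continuous f) {r : ℝ} (hr : 0 ≤ r) :
    Measurable[Fraw T r] (fun ω => f (stp hT r ω, GP hT (stp hT r ω))) :=
  (hf.measurable.comp (pairGP_measurable hT)).comp (fraw_stp hT hr)

lemma theta_lt (h : IsHedge hT n α β) (lam : ℝ) {t : ℝ} (ht : t ≤ T) :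
    MeasurableSet[Fraw T t] {ω | theta hT n α β lam ω < t} := by
  refine hitQ_lt hT _ (fun r h0 _ => ?_) ht
  exact measurableSet_lt (measurable_const.add (pre_meas hT (hv_cont hT h T) h0)) measurable_const

/-- strategy built from integrands -/
def strat (h : IsHedge hT n α β) (lam : ℝ) (γ : ℕ → PathPair T → ℝ) (cg : ∀ j, Continuous (γ j))
    (bg : ∀ j, ∃ C, ∀ p, |γ j p| ≤ C) : SimpleStrategy T where
  L := 2^n
  τ l ω := min (tg T n l) (theta hT n α β lam ω)
  coeff l ω := γ l (stp hT (tg T n l) ω, GP hT (stp hT (tg T n l) ω)) *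
    (if theta hT n α β lam ω < tg T n l then 0 else 1)
  τ_nonneg ω := le_min (tg_nonneg hT _ _) (hitQ_nonneg hT _ _)
  τ_mono l ω := min_le_min (tg_mono hT n (by simp)) le_rfl
  τ_le ω := (min_le_right _ _).trans (hitQ_le hT _ _)
  τ_stop l := by
    intro t ht
    have := plus_of_lt hT (E := univ)
      (τ := fun ω => min (tg T n l) (theta hT n α β lam ω)) ?_ ?_ t ht
    · simpa using this
    · have : (univ ∩ {ω | min (tg T n l) (theta hT n α β lam ω) ≤ T} : Set (Path T)) = univ := by
        ext ω
        simp only [univ_inter, mem_univ, iff_true]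
        exact (min_le_right _ _).trans (hitQ_le hT _ _)
      rw [this]; exact MeasurableSet.univ
    · intro t h0 ht
      rw [univ_inter]
      by_cases hl : tg T n l < t
      · have : {ω : Path T | min (tg T n l) (theta hT n α β lam ω) < t} = univ := by
          ext ω; simp [hl]
        rw [this]; exact MeasurableSet.univ
      · have : {ω : Path T | min (tg T n l) (theta hT n α β lam ω) < t} =
            {ω | theta hT n α β lam ω < t} := by
          ext ω; simp [hl]
        rw [this]; exact theta_lt hT h lam ht
  coeff_bdd l := by
    obtain ⟨C, hC⟩ := bg l
    refine ⟨|C|, fun ω => ?_⟩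
    have := (hC (stp hT (tg T n l) ω, GP hT (stp hT (tg T n l) ω))).trans (le_abs_self C)
    split_ifs
    · simp
    · simpa using this
  coeff_meas l := by
    have hlT : tg T n l ≤ T := tg_le hT l.2.le
    have hcm : Measurable[Fraw T (tg T n l)] (fun ω =>
        γ l (stp hT (tg T n l) ω, GP hT (stp hT (tg T n l) ω)) *
        (if theta hT n α β lam ω < tg T n l then (0:ℝ) else 1)) :=
      (pre_meas hT (cg l) (tg_nonneg hT _ _)).mul
        (Measurable.ite (theta_lt hT h lam hlT) measurable_const measurable_const)
    intro B hB
    refine plus_of_lt hT ?_ ?_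
    · have : {ω | (fun ω => min (tg T n (l.castSucc : Fin (2^n+1))) (theta hT n α β lam ω)) ω ≤ T} =
          (univ : Set (Path T)) := by
        ext ω
        simp only [mem_univ, iff_true]
        exact (min_le_right _ _).trans (hitQ_le hT _ _)
      rw [this, inter_univ]
      exact fraw_le _ _ (hcm hB)
    · intro t h0 ht
      by_cases hl : tg T n l < t
      · have : {ω : Path T | min (tg T n (l.castSucc : Fin (2^n+1))) (theta hT n α β lam ω) < t} = univ := by
          ext ω; simp [hl]
        rw [this, inter_univ]
        exact fraw_mono hl.le _ (hcm hB)
      · have : {ω : Path T | min (tg T n (l.castSucc : Fin (2^n+1))) (theta hT n α β lam ω) < t} =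
            {ω | theta hT n α β lam ω < t} := by
          ext ω; simp [hl]
        rw [this]
        have hth := theta_lt hT h lam ht
        by_cases hB0 : (0:ℝ) ∈ B
        · convert hth using 1
          ext ω
          refine ⟨fun h => h.2, fun hh => ⟨?_, hh⟩⟩
          have hh' : theta hT n α β lam ω < tg T n l := lt_of_lt_of_le hh (not_lt.1 hl)
          show _ ∈ B
          simp only [if_pos hh', mul_zero]; exact hB0
        · convert MeasurableSet.empty using 1
          ext ω
          simp only [mem_empty_iff_false, iff_false]
          rintro ⟨hh1, hh⟩
          have hh' : theta hT n α β lam ω < tg T n l := lt_of_lt_of_le hh (not_lt.1 hl)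
          apply hB0
          have hh1 : _ ∈ B := hh1
          simpa only [if_pos hh', mul_zero] using hh1

lemma strat_val (h : IsHedge hT n α β) (lam : ℝ) (γ : ℕ → PathPair T → ℝ) (cg : ∀ j, Continuous (γ j))
    (bg : ∀ j, ∃ C, ∀ p, |γ j p| ≤ C) (ag : ∀ j p, γ j (sp hT (tg T n j) p) = γ j p)
    (X : ℝ → Path T → ℝ) {ω : Path T} (hω : ω ∈ Cv hT) (t : ℝ) :
    integ T (strat hT h lam γ cg bg) X t ω = ∑ j ∈ Finset.range (2^n), γ j (ω, GP hT ω) *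
      (X (min (tg T n (j+1)) (min t (theta hT n α β lam ω))) ω -
       X (min (tg T n j) (min t (theta hT n α β lam ω))) ω) := by
  rw [← Fin.sum_univ_eq_sum_range (fun j => γ j (ω, GP hT ω) *
      (X (min (tg T n (j+1)) (min t (theta hT n α β lam ω))) ω -
       X (min (tg T n j) (min t (theta hT n α β lam ω))) ω)) (2^n)]
  refine Finset.sum_congr rfl fun (l : Fin (2^n)) _ => ?_
  have hlT : tg T n l ≤ T := tg_le hT l.2.le
  show γ l (stp hT (tg T n l) ω, GP hT (stp hT (tg T n l) ω)) *
    (if theta hT n α β lam ω < tg T n l then 0 else 1) *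
    (X (min (min (tg T n (l.succ : Fin (2^n+1))) (theta hT n α β lam ω)) t) ω -
     X (min (min (tg T n (l.castSucc : Fin (2^n+1))) (theta hT n α β lam ω)) t) ω) = _
  rw [GP_stp hT hω (tg_nonneg hT _ _) hlT]
  have := ag l (ω, GP hT ω)
  simp only [sp] at this
  rw [this]
  simp only [min_assoc, min_comm _ t, Fin.val_succ, Fin.val_castSucc]
  split_ifs with hl
  · have h1 : min t (theta hT n α β lam ω) ≤ tg T n l := (min_le_right _ _).trans hl.le
    have h2 : min t (theta hT n α β lam ω) ≤ tg T n (l+1) := h1.trans (tg_mono hT n (Nat.le_succ _))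
    rw [min_eq_right h1, min_eq_right h2]
    ring
  · simp [min_left_comm]

lemma hedge_strategy (h : IsHedge hT n α β) {lam : ℝ} (hl : 0 ≤ lam) :
    ∃ H G : SimpleStrategy T, (∀ t ∈ Set.Icc (0:ℝ) T, ∀ ω ∈ BigOmega T hT,
      0 ≤ lam + integ T H (Sproc T hT) t ω + integ T G (SS T hT) t ω) ∧
    ∀ ω ∈ BigOmega T hT, (∀ r ∈ Set.Icc (0:ℝ) T, 0 ≤ lam + hv hT n α β T (sp hT r (ω, qv T hT ω))) →
      integ T H (Sproc T hT) T ω + integ T G (SS T hT) T ω = hv hT n α β T (ω, qv T hT ω) := by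
  have key : ∀ ω ∈ BigOmega T hT, ∀ t ∈ Set.Icc (0:ℝ) T,
      integ T (strat hT h lam α h.ca h.ba) (Sproc T hT) t ω +
      integ T (strat hT h lam β h.cb h.bb) (SS T hT) t ω =
      hv hT n α β (min t (theta hT n α β lam ω)) (ω, GP hT ω) := by
    intro ω hω t ht
    have hc := ((mem_Omega_iff hT ω).1 hω).1
    rw [strat_val hT h lam α h.ca h.ba h.aa _ hc, strat_val hT h lam β h.cb h.bb h.ab _ hc,
      ← Finset.sum_add_distrib]
    refine Finset.sum_congr rfl fun j hj => ?_
    have hm : ∀ i, min (tg T n i) (min t (theta hT n α β lam ω)) ∈ Set.Icc (0:ℝ) T := fun i =>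
      ⟨le_min (tg_nonneg hT _ _) (le_min ht.1 (hitQ_nonneg hT _ _)),
        (min_le_right _ _).trans ((min_le_left _ _).trans ht.2)⟩
    rw [SS_eq hT hc (hm _), SS_eq hT hc (hm _), SSP_SSbar, SSP_SSbar]
    rfl
  refine ⟨strat hT h lam α h.ca h.ba, strat hT h lam β h.cb h.bb, fun t ht ω hω => ?_,
    fun ω hω hpos => ?_⟩
  · rw [add_assoc, key ω hω t ht]
    have hc := ((mem_Omega_iff hT ω).1 hω).1
    have hu : min t (theta hT n α β lam ω) ≤ theta hT n α β lam ω := min_le_right _ _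
    have hu0 : 0 ≤ min t (theta hT n α β lam ω) := le_min ht.1 (hitQ_nonneg hT _ _)
    have hthT : theta hT n α β lam ω ≤ T := hitQ_le hT _ _
    generalize min t (theta hT n α β lam ω) = u at *
    rcases hu0.eq_or_lt with h0 | h0
    · rw [← h0, hv_zero]; linarith
    have hcl : u ∈ closure (Set.Ioo 0 (theta hT n α β lam ω) ∩ Set.range ((↑) : ℚ → ℝ)) := by
      have hd := Rat.denseRange_cast (𝕜 := ℝ)
      have := hd.open_subset_closure_inter (isOpen_Ioo (a := (0:ℝ)) (b := theta hT n α β lam ω))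
      have h2 := closure_mono this
      rw [closure_closure, closure_Ioo (h0.trans_le hu).ne] at h2
      exact h2 ⟨h0.le, hu⟩
    refine closure_minimal (t := {u | 0 ≤ lam + hv hT n α β u (ω, GP hT ω)}) ?_ ?_ hcl
    · rintro _ ⟨h1, q, rfl⟩
      have hn := hitQ_not_mem hT _ h1.1.le h1.2
      have hn : ¬ (lam + hv hT n α β T (stp hT q ω, GP hT (stp hT q ω)) < 0) := fun hh => hn hh
      rw [GP_stp hT hc h1.1.le (h1.2.le.trans hthT)] at hn
      have e := hv_sp hT h h1.1.le (ω, GP hT ω)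
      simp only [sp] at e
      rw [e] at hn
      exact not_lt.1 hn
    · exact isClosed_le continuous_const (continuous_const.add (hv_cont_t hT _))
  · rw [key ω hω T ⟨hT, le_rfl⟩]
    have hc := ((mem_Omega_iff hT ω).1 hω).1
    rw [qv_eq hT hω] at hpos ⊢
    have : theta hT n α β lam ω = T := by
      refine hitQ_eq_T _ fun r h0 hr hm => ?_
      have hm : lam + hv hT n α β T (stp hT r ω, GP hT (stp hT r ω)) < 0 := hm
      rw [GP_stp hT hc h0 hr] at hm
      have := hpos r ⟨h0, hr⟩
      simp only [sp] at this
      linarith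
    rw [this, min_self]

end Hedge


section Lsub
variable {T : ℝ} (hT : 0 ≤ T)

lemma tg_double (n i : ℕ) : tg T (n+1) (2*i) = tg T n i := by
  unfold tg
  push_cast
  rw [pow_succ]
  field_simp

lemma sum_double (f y : ℕ → ℝ) (N : ℕ) :
    ∑ j ∈ Finset.range (2*N), f (j/2) * (y (j+1) - y j) =
    ∑ i ∈ Finset.range N, f i * (y (2*(i+1)) - y (2*i)) := by
  induction N with
  | zero => simp
  | succ N ih =>
    rw [show 2*(N+1) = 2*N+1+1 by ring, Finset.sum_range_succ, Finset.sum_range_succ, ih,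
      Finset.sum_range_succ]
    have h1 : (2*N+1)/2 = N := by omega
    have h2 : 2*N/2 = N := by omega
    rw [h1, h2, show 2*(N+1) = 2*N+1+1 by ring]
    ring

lemma hedge_refine {n : ℕ} {α β : ℕ → PathPair T → ℝ} (h : IsHedge hT n α β) :
    ∃ α' β', IsHedge hT (n+1) α' β' ∧ ∀ t, hv hT (n+1) α' β' t = hv hT n α β t := by
  have hle : ∀ j, tg T n (j/2) ≤ tg T (n+1) j := fun j => by
    rw [← tg_double]; exact tg_mono hT _ (Nat.mul_div_le j 2)
  refine ⟨fun j => α (j/2), fun j => β (j/2), ⟨fun j => h.ca _, fun j => h.cb _, fun j => h.ba _,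
    fun j => h.bb _, fun j p => ?_, fun j p => ?_⟩, fun t => ?_⟩
  · show α (j/2) _ = α (j/2) p
    rw [← h.aa (j/2), sp_sp, min_eq_left (hle j), h.aa]
  · show β (j/2) _ = β (j/2) p
    rw [← h.ab (j/2), sp_sp, min_eq_left (hle j), h.ab]
  · funext p
    simp only [hv, Finset.sum_add_distrib]
    rw [pow_succ, mul_comm (2^n) 2,
      sum_double (fun j => α j p) (fun j => SbarProc T hT (min (tg T (n+1) j) t) p),
      sum_double (fun j => β j p) (fun j => SSbarProc T hT (min (tg T (n+1) j) t) p)]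
    simp only [tg_double]

lemma hedge_refine_le {n N : ℕ} (hN : n ≤ N) {α β : ℕ → PathPair T → ℝ} (h : IsHedge hT n α β) :
    ∃ α' β', IsHedge hT N α' β' ∧ ∀ t, hv hT N α' β' t = hv hT n α β t := by
  induction N, hN using Nat.le_induction with
  | base => exact ⟨α, β, h, fun _ => rfl⟩
  | succ N _ ih =>
    obtain ⟨α', β', h', e⟩ := ih
    obtain ⟨α'', β'', h'', e'⟩ := hedge_refine hT h'
    exact ⟨α'', β'', h'', fun t => (e' t).trans (e t)⟩

lemma bdd_add {f g : PathPair T → ℝ} (hf : ∃ C, ∀ p, |f p| ≤ C) (hg : ∃ C, ∀ p, |g p| ≤ C) :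
    ∃ C, ∀ p, |f p + g p| ≤ C := by
  obtain ⟨C, hC⟩ := hf
  obtain ⟨D, hD⟩ := hg
  exact ⟨C + D, fun p => (abs_add_le _ _).trans (add_le_add (hC p) (hD p))⟩

lemma bdd_smul {f : PathPair T → ℝ} (c : ℝ) (hf : ∃ C, ∀ p, |f p| ≤ C) :
    ∃ C, ∀ p, |c * f p| ≤ C := by
  obtain ⟨C, hC⟩ := hf
  exact ⟨|c| * C, fun p => by rw [abs_mul]; exact mul_le_mul_of_nonneg_left (hC p) (abs_nonneg _)⟩

def Lsub : Submodule ℝ (PathPair T → ℝ) where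
  carrier := {g | ∃ n α β, IsHedge hT n α β ∧ g = hv hT n α β T}
  zero_mem' := by
    refine ⟨0, fun _ _ => 0, fun _ _ => 0, ⟨fun _ => continuous_const, fun _ => continuous_const,
      fun _ => ⟨0, by simp⟩, fun _ => ⟨0, by simp⟩, by simp, by simp⟩, ?_⟩
    funext p
    simp [hv]
  add_mem' := by
    rintro _ _ ⟨n, α, β, h, rfl⟩ ⟨n', α', β', h', rfl⟩
    obtain ⟨a, b, k, e⟩ := hedge_refine_le hT (le_max_left n n') h
    obtain ⟨a', b', k', e'⟩ := hedge_refine_le hT (le_max_right n n') h'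
    refine ⟨max n n', fun j p => a j p + a' j p, fun j p => b j p + b' j p,
      ⟨fun j => (k.ca j).add (k'.ca j), fun j => (k.cb j).add (k'.cb j),
       fun j => bdd_add (k.ba j) (k'.ba j), fun j => bdd_add (k.bb j) (k'.bb j),
       fun j p => by rw [k.aa, k'.aa], fun j p => by rw [k.ab, k'.ab]⟩, ?_⟩
    rw [← e, ← e']
    funext p
    simp only [hv, Pi.add_apply, ← Finset.sum_add_distrib]
    exact Finset.sum_congr rfl fun j _ => by ring
  smul_mem' := by
    rintro c _ ⟨n, α, β, h, rfl⟩
    refine ⟨n, fun j p => c * α j p, fun j p => c * β j p,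
      ⟨fun j => continuous_const.mul (h.ca j), fun j => continuous_const.mul (h.cb j),
       fun j => bdd_smul c (h.ba j), fun j => bdd_smul c (h.bb j),
       fun j p => by rw [h.aa], fun j p => by rw [h.ab]⟩, ?_⟩
    funext p
    simp only [hv, Pi.smul_apply, smul_eq_mul, Finset.mul_sum]
    exact Finset.sum_congr rfl fun j _ => by ring

lemma Lsub_cont {g : PathPair T → ℝ} (hg : g ∈ Lsub hT) : Continuous g := by
  obtain ⟨n, α, β, h, rfl⟩ := hg
  exact hv_cont hT h T

/-- elementary gains -/
lemma Lsub_elem (n i k : ℕ) (hik : i ≤ k) (hk : k ≤ 2^n) {a b : PathPair T → ℝ} (ha : Continuous a)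
    (hb : Continuous b)
    (ba : ∃ C, ∀ p, |a p| ≤ C) (bb : ∃ C, ∀ p, |b p| ≤ C) :
    (fun p => a (sp hT (tg T n i) p) * (SbarProc T hT (tg T n k) p - SbarProc T hT (tg T n i) p) +
      b (sp hT (tg T n i) p) * (SSbarProc T hT (tg T n k) p - SSbarProc T hT (tg T n i) p))
      ∈ Lsub hT := by
  have c : ∀ (a : PathPair T → ℝ) (ha : Continuous a) j,
      Continuous (fun p => if i ≤ j ∧ j < k then a (sp hT (tg T n i) p) else 0) :=
    fun a ha j => by
      split_ifs
      · exact ha.comp (continuous_sp hT _)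
      · exact continuous_const
  have b' : ∀ (a : PathPair T → ℝ) (_ : ∃ C, ∀ p, |a p| ≤ C) j,
      ∃ C, ∀ p, |if i ≤ j ∧ j < k then a (sp hT (tg T n i) p) else 0| ≤ C :=
    fun a ⟨C, hC⟩ j => by
      split_ifs
      · exact ⟨C, fun p => hC _⟩
      · exact ⟨0, by simp⟩
  have ad : ∀ (a : PathPair T → ℝ) (j : ℕ) p,
      (if i ≤ j ∧ j < k then a (sp hT (tg T n i) (sp hT (tg T n j) p)) else 0) =
      if i ≤ j ∧ j < k then a (sp hT (tg T n i) p) else 0 := fun a j p => by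
    split_ifs with h
    · rw [sp_sp, min_eq_left (tg_mono hT n h.1)]
    · rfl
  refine ⟨n, fun j p => if i ≤ j ∧ j < k then a (sp hT (tg T n i) p) else 0,
    fun j p => if i ≤ j ∧ j < k then b (sp hT (tg T n i) p) else 0,
    ⟨c a ha, c b hb, b' a ba, b' b bb, ad a, ad b⟩, ?_⟩
  have tele : ∀ (x : ℝ) (y : ℕ → ℝ), ∑ j ∈ Finset.range (2^n),
      (if i ≤ j ∧ j < k then x else 0) * (y (j+1) - y j) = x * (y k - y i) := fun x y => by
    rw [← Finset.sum_range_add_sum_Ico _ hk]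
    rw [Finset.sum_eq_zero (s := Finset.Ico k (2^n)) (fun j hj => by
      rw [if_neg (fun h => absurd h.2 (not_lt.2 (Finset.mem_Ico.1 hj).1)), zero_mul]), add_zero,
      ← sum_tail y i k hik, Finset.mul_sum]
    refine Finset.sum_congr rfl fun j hj => ?_
    have := Finset.mem_range.1 hj
    by_cases h : i ≤ j <;> simp [h, this]
  funext p
  simp only [hv, Finset.sum_add_distrib]
  rw [tele _ (fun j => SbarProc T hT (min (tg T n j) T) p),
    tele _ (fun j => SSbarProc T hT (min (tg T n j) T) p)]
  rw [min_eq_left (tg_le hT hk), min_eq_left (tg_le hT (hik.trans hk))]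

end Lsub


section HB
variable {K : Type*} [MetricSpace K] [CompactSpace K] [MeasurableSpace K] [BorelSpace K]

lemma riesz_prob [Nonempty K] (Λ : C(K,ℝ) →ₗ[ℝ] ℝ) (hpos : ∀ f : C(K,ℝ), (∀ x, 0 ≤ f x) → 0 ≤ Λ f)
    (h1 : Λ 1 = 1) : ∃ μ : Measure K, IsProbabilityMeasure μ ∧ ∀ f : C(K,ℝ), ∫ x, f x ∂μ = Λ f := by
  let Λ' : CompactlySupportedContinuousMap K ℝ →ₚ[ℝ] ℝ := PositiveLinearMap.mk₀
    { toFun := fun f => Λ f.toContinuousMap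
      map_add' := fun f g => by rw [← map_add]; rfl
      map_smul' := fun c f => by rw [RingHom.id_apply, ← map_smul]; rfl } 
    (fun f hf => hpos _ (fun x => hf x))
  have hint : ∀ f : C(K,ℝ), ∫ x, f x ∂(RealRMK.rieszMeasure Λ') = Λ f := fun f => by
    have := RealRMK.integral_rieszMeasure Λ'
      (CompactlySupportedContinuousMap.continuousMapEquiv f)
    exact this
  refine ⟨RealRMK.rieszMeasure Λ', ?_, hint⟩
  have h := hint 1
  rw [h1] at h
  simp only [ContinuousMap.one_apply, integral_const, smul_eq_mul, mul_one] at h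
  constructor
  rw [Measure.real, ENNReal.toReal_eq_one_iff] at h
  exact h

lemma usc_approx [Nonempty K] (X : K → ℝ) (hX : UpperSemicontinuous X) {C : ℝ} (hC : ∀ x, |X x| ≤ C) :
    ∃ f : ℕ → C(K,ℝ), (∀ n x, X x < f n x) ∧ (∀ n x, |f n x| ≤ C + 1) ∧
      ∀ x, Tendsto (fun n => f n x) atTop (𝓝 (X x)) := by
  have hb : ∀ (n : ℕ) x, BddAbove (Set.range fun q => X q - n * dist x q) := fun n x =>
    ⟨C, by rintro _ ⟨q, rfl⟩
           have := (le_abs_self _).trans (hC q)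
           have : (0:ℝ) ≤ n * dist x q := by positivity
           simp only; linarith⟩
  let F : ℕ → K → ℝ := fun n x => ⨆ q, X q - n * dist x q
  have hlow : ∀ n x, X x ≤ F n x := fun n x => by
    have := le_ciSup (hb n x) x
    simpa using this
  have hup : ∀ n x, F n x ≤ C := fun n x => ciSup_le fun q => by
    have := (le_abs_self _).trans (hC q)
    have : (0:ℝ) ≤ n * dist x q := by positivity
    linarith
  have hlip : ∀ n : ℕ, LipschitzWith (n : NNReal) (F n) := fun n => LipschitzWith.of_le_add_mul _ fun x y => by
    refine ciSup_le fun q => ?_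
    have := le_ciSup (hb n y) q
    have tri : dist y q ≤ dist x y + dist x q := by
      rw [dist_comm x y]; exact dist_triangle _ _ _
    have : (n:ℝ) * dist y q ≤ n * (dist x y + dist x q) := by gcongr
    simp only [NNReal.coe_natCast]
    simp only [F] at *
    linarith
  have hpos : ∀ n : ℕ, (0:ℝ) < 1/((n:ℝ)+1) := fun n => by positivity
  refine ⟨fun n => ⟨fun x => F n x + 1/((n:ℝ)+1), (hlip n).continuous.add continuous_const⟩,
    fun n x => ?_, fun n x => ?_, fun x => ?_⟩
  · show X x < F n x + _
    linarith [hlow n x, hpos n]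
  · show |F n x + 1/((n:ℝ)+1)| ≤ _
    have h1 : 1/((n:ℝ)+1) ≤ 1 := by
      rw [div_le_one (by positivity)]; linarith [(Nat.cast_nonneg n : (0:ℝ) ≤ n)]
    have := hlow n x
    have := hup n x
    have := abs_le.1 (hC x)
    have := hpos n
    rw [abs_le]; constructor <;> linarith
  · show Tendsto (fun n : ℕ => F n x + 1/((n:ℝ)+1)) atTop _
    rw [← add_zero (X x)]
    refine Tendsto.add ?_ tendsto_one_div_add_atTop_nhds_zero_nat
    rw [Metric.tendsto_atTop]
    intro ε hε
    obtain ⟨δ, hδ, hδ'⟩ := Metric.eventually_nhds_iff.1 (hX x (X x + ε/2) (by linarith))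
    obtain ⟨N, hN⟩ := exists_nat_ge (2*C/δ)
    refine ⟨N, fun n hn => ?_⟩
    have hle : F n x ≤ X x + ε/2 := ciSup_le fun q => by
      by_cases hq : dist q x < δ
      · have := hδ' hq
        have : (0:ℝ) ≤ n * dist x q := by positivity
        linarith
      · have h1 : 2*C ≤ N * δ := (div_le_iff₀ hδ).1 hN
        have h2 : (N:ℝ) * δ ≤ n * dist x q := by
          rw [dist_comm x q]
          have : (N:ℝ) ≤ n := Nat.cast_le.2 hn
          have := not_lt.1 hq
          gcongr
        have := abs_le.1 (hC q)
        have := abs_le.1 (hC x)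
        linarith
    rw [Real.dist_eq, abs_lt]
    have := hlow n x
    constructor <;> linarith

lemma hb_measure [Nonempty K] (L : Submodule ℝ C(K,ℝ)) (X : K → ℝ) (hX : UpperSemicontinuous X) {C : ℝ}
    (hC : ∀ x, |X x| ≤ C) (lam : ℝ) (hno : ∀ g ∈ L, ∃ x, lam + g x ≤ X x) :
    ∃ μ : Measure K, IsProbabilityMeasure μ ∧ (∀ g ∈ L, ∫ x, g x ∂μ = 0) ∧ lam ≤ ∫ x, X x ∂μ := by
  let U : Set C(K,ℝ) := {f | ∀ x, X x < f x}
  let A : Set C(K,ℝ) := {f | f - ContinuousMap.const K lam ∈ L}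
  have hUc : Convex ℝ U := by
    intro f hf g hg a b ha hb hab x
    have h1 := hf x
    have h2 := hg x
    show X x < a * f x + b * g x
    have e : X x = a * X x + b * X x := by rw [← add_mul, hab, one_mul]
    rw [e]
    rcases ha.eq_or_lt with h | h
    · have : b = 1 := by linarith
      subst this; rw [← h]; linarith
    · have := mul_lt_mul_of_pos_left h1 h
      have := mul_le_mul_of_nonneg_left h2.le hb
      linarith
  have hUo : IsOpen U := by
    rw [Metric.isOpen_iff]
    intro f hf
    have hl : UpperSemicontinuous (fun x => X x + (- f x)) := hX.add (f.continuous.neg.upperSemicontinuous)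
    obtain ⟨x0, -, hx0⟩ := (hl.upperSemicontinuousOn univ).exists_isMaxOn univ_nonempty isCompact_univ
    refine ⟨f x0 - X x0, by linarith [hf x0], fun g hg x => ?_⟩
    have h1 := hx0 (mem_univ x)
    have h2 : dist (g x) (f x) < f x0 - X x0 := (ContinuousMap.dist_apply_le_dist x).trans_lt hg
    rw [Real.dist_eq, abs_lt] at h2
    have h1 : X x + -f x ≤ X x0 + - f x0 := h1
    linarith [h2.1]
  have hAc : Convex ℝ A := by
    intro f hf g hg a b ha hb hab
    show a • f + b • g - ContinuousMap.const K lam ∈ L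
    have : a • f + b • g - ContinuousMap.const K lam =
        a • (f - ContinuousMap.const K lam) + b • (g - ContinuousMap.const K lam) := by
      ext x
      simp only [ContinuousMap.sub_apply, ContinuousMap.add_apply, ContinuousMap.smul_apply,
        ContinuousMap.const_apply, smul_eq_mul]
      linear_combination (lam) * hab
    rw [this]
    exact L.add_mem (L.smul_mem a hf) (L.smul_mem b hg)
  have hdisj : Disjoint U A := by
    rw [Set.disjoint_left]
    intro f hf hfA
    obtain ⟨x, hx⟩ := hno _ hfA
    have := hf x
    simp only [ContinuousMap.sub_apply, ContinuousMap.const_apply] at hx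
    linarith
  obtain ⟨φ, u, h1, h2⟩ := geometric_hahn_banach_open hUc hUo hAc hdisj
  have hφL : ∀ g ∈ L, φ g = 0 := by
    intro g hg
    have key : ∀ c : ℝ, u ≤ φ (ContinuousMap.const K lam) + c * φ g := fun c => by
      have := h2 (ContinuousMap.const K lam + c • g) (by
        show _ + _ - _ ∈ L
        rw [add_sub_cancel_left]; exact L.smul_mem c hg)
      simpa using this
    by_contra hne
    have := key ((u - 1 - φ (ContinuousMap.const K lam)) / φ g)
    rw [div_mul_cancel₀ _ hne] at this
    linarith
  have hC1U : ∀ f : C(K,ℝ), (∀ x, 0 ≤ f x) → (ContinuousMap.const K (C+1) + f) ∈ U := fun f hf x => by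
    show X x < (C+1) + f x
    linarith [hf x, (abs_le.1 (hC x)).2]
  have hneg : ∀ f : C(K,ℝ), (∀ x, 0 ≤ f x) → φ f ≤ 0 := by
    intro f hf
    by_contra hne
    push Not at hne
    have hc : 0 ≤ max 0 ((u - φ (ContinuousMap.const K (C+1))) / φ f) := le_max_left _ _
    have := h1 _ (hC1U ((max 0 ((u - φ (ContinuousMap.const K (C+1))) / φ f)) • f)
      (fun x => mul_nonneg hc (hf x)))
    simp only [map_add, map_smul, smul_eq_mul] at this
    have h3 : (u - φ (ContinuousMap.const K (C+1))) / φ f * φ f ≤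
      max 0 ((u - φ (ContinuousMap.const K (C+1))) / φ f) * φ f :=
      mul_le_mul_of_nonneg_right (le_max_right _ _) hne.le
    rw [div_mul_cancel₀ _ hne.ne'] at h3
    linarith
  have hconst : ∀ c : ℝ, φ (ContinuousMap.const K c) = c * φ 1 := fun c => by
    have : ContinuousMap.const K c = c • (1 : C(K,ℝ)) := by ext x; simp
    rw [this, map_smul, smul_eq_mul]
  have hlamA : u ≤ lam * φ 1 := by
    rw [← hconst]
    exact h2 _ (by show _ - _ ∈ L; rw [sub_self]; exact L.zero_mem)
  have h1neg : φ 1 < 0 := by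
    refine lt_of_le_of_ne (hneg 1 fun x => zero_le_one) fun h0 => ?_
    have := h1 _ (hC1U 0 fun x => le_rfl)
    rw [add_zero, hconst, h0] at this
    rw [h0] at hlamA
    linarith
  obtain ⟨μ, hμ, hμi⟩ := riesz_prob ((φ 1)⁻¹ • φ.toLinearMap) (fun f hf => by
      show 0 ≤ (φ 1)⁻¹ * φ f
      exact mul_nonneg_of_nonpos_of_nonpos (inv_nonpos.2 h1neg.le) (hneg f hf))
    (by show (φ 1)⁻¹ * φ 1 = 1; exact inv_mul_cancel₀ h1neg.ne)
  have hμi : ∀ f : C(K,ℝ), ∫ x, f x ∂μ = (φ 1)⁻¹ * φ f := hμi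
  refine ⟨μ, hμ, fun g hg => by rw [hμi, hφL g hg, mul_zero], ?_⟩
  have hUint : ∀ f ∈ U, lam ≤ ∫ x, f x ∂μ := fun f hf => by
    rw [hμi]
    have h3 := (h1 f hf).le.trans hlamA
    have := mul_le_mul_of_nonpos_left h3 (inv_nonpos.2 h1neg.le)
    rw [mul_comm lam, ← mul_assoc, inv_mul_cancel₀ h1neg.ne, one_mul] at this
    exact this
  obtain ⟨f, hf1, hf2, hf3⟩ := usc_approx X hX hC
  have hlim : Tendsto (fun n => ∫ x, f n x ∂μ) atTop (𝓝 (∫ x, X x ∂μ)) :=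
    tendsto_integral_of_dominated_convergence (fun _ => C + 1)
      (fun n => (f n).continuous.aestronglyMeasurable) (integrable_const _)
      (fun n => Eventually.of_forall fun x => hf2 n x) (Eventually.of_forall hf3)
  exact ge_of_tendsto' hlim fun n => hUint _ (hf1 n)

end HB


section Pathwise
variable {T : ℝ} (hT : 0 ≤ T)

def Am (m : ℕ) (t : ℝ) (ω : Path T) : ℝ :=
  ev T hT ω t ^ 2 - ev T hT ω 0 ^ 2 - 2 * Sm T hT m t ω

lemma Am_almost_mono (m : ℕ) (ω : Path T) {s t : ℝ} (h0 : 0 ≤ s) (hst : s ≤ t) (htT : t ≤ T) :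
    Am hT m s ω ≤ Am hT m t ω + eps m ^ 2 := by
  obtain ⟨K1, hK1⟩ := Sm_eq hT m ω
  obtain ⟨K2, hK2⟩ := sig_eventually hT m ω
  generalize hKd : max K1 K2 = K
  have hSm := hK1 K (by rw [← hKd]; exact le_max_left _ _)
  have hsig := hK2 K (by rw [← hKd]; exact le_max_right _ _)
  have hA : ∀ u, 0 ≤ u → u ≤ T → Am hT m u ω = ∑ k ∈ Finset.range K,
      (ev T hT ω (min (sig T hT m (k + 1) ω) u) - ev T hT ω (min (sig T hT m k ω) u))^2 := by
    intro u hu0 hu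
    have htel : ∑ k ∈ Finset.range K, (ev T hT ω (min (sig T hT m (k + 1) ω) u) ^ 2 -
        ev T hT ω (min (sig T hT m k ω) u) ^ 2) = ev T hT ω u ^ 2 - ev T hT ω 0 ^ 2 := by
      rw [Finset.sum_range_sub (fun k => ev T hT ω (min (sig T hT m k ω) u) ^ 2), hsig,
        min_eq_right (by linarith), sig_zero, min_eq_left hu0]
    rw [Am, ← htel, hSm u, Finset.mul_sum, ← Finset.sum_sub_distrib]
    refine Finset.sum_congr rfl fun k _ => ?_
    rcases le_total (sig T hT m k ω) u with h | h
    · rw [min_eq_left h]; ring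
    · rw [min_eq_right h, min_eq_right (h.trans (sig_le_succ hT m k ω))]; ring
  rw [hA s h0 (hst.trans htT), hA t (h0.trans hst) htT]
  obtain ⟨κ, hκ1, hκ2⟩ := sig_index hT m ω h0 (hst.trans htT)
  have hsum : ∑ k ∈ Finset.range K, (if k = κ then eps m ^ 2 else 0) ≤ eps m ^ 2 := by
    rw [Finset.sum_ite_eq']
    split_ifs
    · exact le_rfl
    · positivity
  refine le_trans ?_ (add_le_add_right hsum _)
  rw [← Finset.sum_add_distrib]
  refine Finset.sum_le_sum fun k _ => ?_
  rcases lt_trichotomy k κ with h | h | h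
  · rw [if_neg h.ne, add_zero]
    have h1 : sig T hT m (k+1) ω ≤ s := (sig_mono hT m ω (show k+1 ≤ κ from h)).trans hκ1
    have h2 : sig T hT m k ω ≤ s := (sig_le_succ hT m k ω).trans h1
    rw [min_eq_left h1, min_eq_left h2, min_eq_left (h1.trans hst), min_eq_left (h2.trans hst)]
  · subst h
    rw [if_pos rfl, min_eq_left hκ1, min_eq_right hκ2.le]
    have h1 := sig_between hT m k ω hκ1 hκ2.le
    have h2 := sq_le_sq' (abs_le.1 h1).1 (abs_le.1 h1).2
    nlinarith [sq_nonneg (ev T hT ω (min (sig T hT m (k + 1) ω) t) - ev T hT ω (min (sig T hT m k ω) t))]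
  · rw [if_neg h.ne', add_zero]
    have h2 : s ≤ sig T hT m k ω := hκ2.le.trans (sig_mono hT m ω (show κ+1 ≤ k from h))
    rw [min_eq_right h2, min_eq_right (h2.trans (sig_le_succ hT m k ω)), sub_self, zero_pow two_ne_zero]
    exact sq_nonneg _

lemma eps_tendsto : Tendsto (fun m => eps m ^ 2) atTop (𝓝 0) := by
  have := (tendsto_pow_atTop_nhds_zero_of_lt_one (r := (1/2:ℝ)) (by norm_num) (by norm_num)).pow 2
  simpa only [eps_eq, ne_eq, OfNat.ofNat_ne_zero, not_false_eq_true, zero_pow] using this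

include hT in
lemma tg_index (n : ℕ) {t : ℝ} (h0 : 0 ≤ t) (ht : t ≤ T) :
    tg T n ⌊t * 2^n / T⌋₊ ≤ t ∧ t ≤ tg T n ⌊t * 2^n / T⌋₊ + T/2^n ∧ ⌊t * 2^n / T⌋₊ ≤ 2^n := by
  rcases hT.eq_or_lt with h | h
  · have : t = 0 := by linarith
    subst this
    simp [tg, ← h]
  · have h1 := Nat.floor_le (show 0 ≤ t * 2^n / T by positivity)
    have h2 := Nat.lt_floor_add_one (t * 2^n / T)
    rw [le_div_iff₀ h] at h1
    rw [div_lt_iff₀ h] at h2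
    have hp : (0:ℝ) < 2^n := by positivity
    refine ⟨?_, ?_, ?_⟩
    · unfold tg; rw [div_le_iff₀ hp]; exact h1
    · unfold tg; rw [← add_div, le_div_iff₀ hp]; linarith
    · have : ((⌊t * 2^n / T⌋₊ : ℕ) : ℝ) ≤ ((2^n : ℕ):ℝ) := by
        push_cast
        have : (⌊t * 2^n / T⌋₊ : ℝ) * T ≤ 2^n * T := h1.trans (by rw [mul_comm]; gcongr)
        exact le_of_mul_le_mul_right this h
      exact_mod_cast this

include hT in
lemma tg_cell (n : ℕ) {t : ℝ} (h0 : 0 ≤ t) (ht : t ≤ T) :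
    ∃ i j, i ≤ 2^n ∧ j ≤ 2^n ∧ tg T n i ≤ t ∧ t ≤ tg T n j ∧ tg T n j ≤ tg T n i + T/2^n := by
  obtain ⟨h1, h2, h3⟩ := tg_index hT n h0 ht
  generalize ⌊t * 2^n / T⌋₊ = k at *
  have hp : 0 ≤ T/2^n := by positivity
  rcases h3.eq_or_lt with h | h
  · refine ⟨k, k, h3, h3, h1, ?_, by linarith⟩
    rw [h, tg_last]; exact ht
  · exact ⟨k, k+1, h3, h, h1, by rw [tg_succ]; exact h2, by rw [tg_succ]⟩

lemma pathwise_conv (ω ν : Path T) (hmono : Monotone ν)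
    (hlim : ∀ n j : ℕ, j ≤ 2^n → Tendsto (fun m => Sm T hT m (tg T n j) ω) atTop
      (𝓝 (SSbarProc T hT (tg T n j) (ω, ν)))) :
    ω ∈ BigOmega T hT ∧ qv T hT ω = ν := by
  have hAlim : ∀ n j : ℕ, j ≤ 2^n → Tendsto (fun m => Am hT m (tg T n j) ω) atTop
      (𝓝 (ev T hT ν (tg T n j))) := fun n j hj => by
    have := ((hlim n j hj).const_mul 2).const_sub (ev T hT ω (tg T n j) ^ 2 - ev T hT ω 0 ^ 2)
    have e : ev T hT ω (tg T n j) ^ 2 - ev T hT ω 0 ^ 2 - 2 * SSbarProc T hT (tg T n j) (ω, ν) =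
        ev T hT ν (tg T n j) := by simp only [SSbarProc]; ring
    rw [e] at this
    exact this
  have hνm : ∀ {s t : ℝ}, s ≤ t → ev T hT ν s ≤ ev T hT ν t := fun h =>
    hmono (Set.monotone_projIcc hT h)
  let L : Path T := ⟨fun t => SSbarProc T hT t (ω, ν),
    (continuous_SSbar_t hT (ω, ν)).comp continuous_subtype_val⟩
  have hL : Tendsto (fun m => SmP hT m ω) atTop (𝓝 L) := by
    rw [Metric.tendsto_atTop]
    intro ε hε
    obtain ⟨δ, hδ, hδ'⟩ := Metric.uniformContinuous_iff.1
      (CompactSpace.uniformContinuous_of_continuous ν.continuous) (ε/4) (by linarith)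
    obtain ⟨n, hn⟩ := ((mesh_tendsto T).eventually (gt_mem_nhds hδ)).exists
    have hev : ∀ᶠ m in atTop, (∀ j ∈ Finset.range (2^n+1),
        |Am hT m (tg T n j) ω - ev T hT ν (tg T n j)| < ε/4) ∧ eps m ^ 2 < ε/4 := by
      refine Eventually.and ?_ (eps_tendsto.eventually (gt_mem_nhds (by linarith)))
      rw [Filter.eventually_all_finset]
      intro j hj
      have := Metric.tendsto_nhds.1 (hAlim n j (Nat.lt_succ_iff.1 (Finset.mem_range.1 hj))) (ε/4) (by linarith)
      simpa only [Real.dist_eq] using this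
    obtain ⟨M, hM⟩ := eventually_atTop.1 hev
    refine ⟨M, fun m hm => ?_⟩
    obtain ⟨hm1, hm2⟩ := hM m hm
    rw [ContinuousMap.dist_lt_iff hε]
    rintro ⟨t, ht0, htT⟩
    obtain ⟨i, j, hi, hj, h1, h2, h3⟩ := tg_cell hT n ht0 htT
    have hij : |ev T hT ν (tg T n j) - ev T hT ν (tg T n i)| < ε/4 := by
      have := hδ' (a := clamp T hT (tg T n j)) (b := clamp T hT (tg T n i)) (by
        rw [Subtype.dist_eq, clamp_of_mem hT ⟨tg_nonneg hT _ _, tg_le hT hj⟩,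
          clamp_of_mem hT ⟨tg_nonneg hT _ _, tg_le hT hi⟩, Real.dist_eq, abs_lt]
        simp only
        constructor <;> linarith)
      rwa [Real.dist_eq] at this
    have e1 := abs_lt.1 (hm1 i (Finset.mem_range.2 (by omega)))
    have e2 := abs_lt.1 (hm1 j (Finset.mem_range.2 (by omega)))
    have e3 := Am_almost_mono hT m ω (tg_nonneg hT n i) h1 htT
    have e4 := Am_almost_mono hT m ω ht0 h2 (tg_le hT hj)
    have e5 := hνm h1
    have e6 := hνm h2
    have e7 := abs_lt.1 hij
    have goal1 : |Am hT m t ω - ev T hT ν t| < ε := by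
      rw [abs_lt]; constructor <;> linarith
    have e8 : Sm T hT m t ω - SSbarProc T hT t (ω, ν) = - (Am hT m t ω - ev T hT ν t) / 2 := by
      simp only [SSbarProc, Am]; ring
    show dist (Sm T hT m t ω) (SSbarProc T hT t (ω, ν)) < ε
    rw [Real.dist_eq, e8, abs_div, abs_neg, abs_two]
    linarith [abs_nonneg (Am hT m t ω - ev T hT ν t)]
  have hGP : GP hT ω = ν := by
    refine path_ext' hT fun t ht => ?_
    have : ev T hT L t = SSbarProc T hT t (ω, ν) := by
      show SSbarProc T hT (clamp T hT t : ℝ) (ω, ν) = _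
      rw [clamp_of_mem hT ht]
    rw [ev_GP, SSP_eq hT hL, this]
    simp only [SSbarProc]; ring
  have hΩ : ω ∈ BigOmega T hT := (mem_Omega_iff hT ω).2 ⟨⟨L, hL⟩, by rw [hGP]; exact hmono⟩
  exact ⟨hΩ, by rw [qv_eq hT hΩ, hGP]⟩
end Pathwise


section TestExt
lemma test_ext {α E : Type*} [MeasurableSpace α] (μ : Measure α) [IsProbabilityMeasure μ]
    [TopologicalSpace E] [MeasurableSpace E] [BorelSpace E] [HasOuterApproxClosed E]
    {π : α → E} (hπ : Measurable π) {D : α → ℝ} (hD : Measurable D) {C : ℝ} (hC : ∀ x, |D x| ≤ C)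
    (h : ∀ f : BoundedContinuousFunction E ℝ, ∫ x, f (π x) * D x ∂μ = 0) {B : Set E}
    (hB : MeasurableSet B) : ∫ x in π ⁻¹' B, D x ∂μ = 0 := by
  have hC0 : ∀ x, 0 ≤ D x + C := fun x => by linarith [(abs_le.1 (hC x)).1]
  have hDm : Measurable (fun x => D x + C) := hD.add_const C
  have hDi : Integrable D μ := int_of_bdd hD.aestronglyMeasurable hC
  have hDi' : Integrable (fun x => D x + C) μ := hDi.add (integrable_const C)
  by_cases hne : Nonempty α
  swap
  · rw [not_nonempty_iff] at hne
    simp [Subsingleton.elim μ 0]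
  have hCn : 0 ≤ C := (abs_nonneg _).trans (hC hne.some)
  let κ := μ.withDensity (fun x => ((D x + C).toNNReal : ℝ≥0∞))
  haveI : IsFiniteMeasure κ := isFiniteMeasure_withDensity_ofReal hDi'.2
  let κ2 : Measure α := C.toNNReal • μ
  haveI : IsFiniteMeasure κ2 := inferInstance
  have heq : κ.map π = κ2.map π := by
    refine ext_of_forall_integral_eq_of_IsFiniteMeasure fun f => ?_
    have hfm : Measurable (fun x => f (π x)) := f.continuous.measurable.comp hπ
    have hfi : Integrable (fun x => f (π x)) μ := int_of_bdd (C := ‖f‖) hfm.aestronglyMeasurable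
      (fun x => f.norm_coe_le_norm _)
    have hfD : Integrable (fun x => f (π x) * D x) μ := hDi.bdd_mul hfm.aestronglyMeasurable
      (c := ‖f‖) (Eventually.of_forall fun x => f.norm_coe_le_norm _)
    rw [integral_map hπ.aemeasurable f.continuous.aestronglyMeasurable,
      integral_map hπ.aemeasurable f.continuous.aestronglyMeasurable]
    rw [integral_withDensity_eq_integral_smul hDm.real_toNNReal, integral_smul_nnreal_measure]
    have : ∀ x, (D x + C).toNNReal • f (π x) = f (π x) * D x + C * f (π x) := fun x => by
      rw [NNReal.smul_def, Real.coe_toNNReal _ (hC0 x), smul_eq_mul]; ring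
    simp only [this]
    rw [integral_add hfD (hfi.const_mul C), h f, zero_add, integral_const_mul, NNReal.smul_def,
      Real.coe_toNNReal _ hCn, smul_eq_mul]
  have h1 : κ (π ⁻¹' B) = κ2 (π ⁻¹' B) := by
    rw [← Measure.map_apply hπ hB, heq, Measure.map_apply hπ hB]
  have hBm := hπ hB
  have h2 : ∫ x in π ⁻¹' B, (D x + C) ∂μ = C * μ.real (π ⁻¹' B) := by
    rw [integral_eq_lintegral_of_nonneg_ae (Eventually.of_forall hC0) hDm.aestronglyMeasurable]
    have : ∫⁻ x in π ⁻¹' B, ENNReal.ofReal (D x + C) ∂μ = κ (π ⁻¹' B) :=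
      (withDensity_apply _ hBm).symm
    rw [this, h1]
    show (((C.toNNReal • μ) (π ⁻¹' B))).toReal = _
    rw [Measure.smul_apply, ENNReal.smul_def, smul_eq_mul, ENNReal.toReal_mul, ENNReal.coe_toReal,
      Real.coe_toNNReal _ hCn]
    rfl
  rw [integral_add hDi.integrableOn (integrable_const C)] at h2
  simp only [integral_const, measureReal_restrict_apply_univ, smul_eq_mul] at h2
  linarith
end TestExt


section MartK
variable {T : ℝ} (hT : 0 ≤ T)

lemma K_bound {K : Set (PathPair T)} (hK : IsCompact K) : ∃ C, 0 ≤ C ∧ ∀ x : K, ∀ t,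
    |SbarProc T hT t x| ≤ C ∧ |VbarProc T hT t x| ≤ C ∧ |SSbarProc T hT t x| ≤ C := by
  obtain ⟨C, hC0, hC⟩ := hK.isBounded.exists_pos_norm_le
  refine ⟨C^2 + C, by positivity, fun x t => ?_⟩
  have h := hC x x.2
  have h1 : ∀ t, |ev T hT x.1.1 t| ≤ C := fun t =>
    ((x.1.1.norm_coe_le_norm _).trans (norm_fst_le x.1)).trans h
  have h2 : ∀ t, |ev T hT x.1.2 t| ≤ C := fun t =>
    ((x.1.2.norm_coe_le_norm _).trans (norm_snd_le x.1)).trans h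
  refine ⟨(h1 t).trans (by nlinarith), (h2 t).trans (by nlinarith), ?_⟩
  have e1 := sq_le_sq' (abs_le.1 (h1 t)).1 (abs_le.1 (h1 t)).2
  have e2 := sq_le_sq' (abs_le.1 (h1 0)).1 (abs_le.1 (h1 0)).2
  have e3 := abs_le.1 (h2 t)
  have e4 := sq_nonneg (ev T hT x.1.1 t)
  have e5 := sq_nonneg (ev T hT x.1.1 0)
  unfold SSbarProc
  rw [abs_le]
  constructor <;> linarith

lemma continuous_sp_t (p : PathPair T) : Continuous (fun s => sp hT s p) :=
  ((continuous_stp_joint hT).comp (continuous_const.prodMk continuous_id)).prodMk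
    ((continuous_stp_joint hT).comp (continuous_const.prodMk continuous_id))

variable {K : Set (PathPair T)} (hK : IsCompact K) (μ : Measure K) [IsProbabilityMeasure μ]
  (hμ : ∀ g ∈ Lsub hT, ∫ x : K, g x ∂μ = 0)

def gt (T t : ℝ) (n : ℕ) : ℝ := tg T n ⌊t * 2^n / T⌋₊

include hT in
lemma gt_tendsto {t : ℝ} (h0 : 0 ≤ t) (ht : t ≤ T) : Tendsto (gt T t) atTop (𝓝 t) := by
  have h := (mesh_tendsto T).const_sub t
  rw [sub_zero] at h
  refine tendsto_of_tendsto_of_tendsto_of_le_of_le h tendsto_const_nhds (fun n => ?_) (fun n => ?_)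
  · have := (tg_index hT n h0 ht).2.1
    simp only [gt]; linarith
  · exact (tg_index hT n h0 ht).1

include hK hμ in
lemma mart_cont {s t : ℝ} (h0 : 0 ≤ s) (hst : s ≤ t) (htT : t ≤ T) {a b : PathPair T → ℝ}
    (ha : Continuous a) (hb : Continuous b) (ba : ∃ C, ∀ p, |a p| ≤ C) (bb : ∃ C, ∀ p, |b p| ≤ C) :
    ∫ x : K, (a (sp hT s x) * (SbarProc T hT t x - SbarProc T hT s x) +
      b (sp hT s x) * (SSbarProc T hT t x - SSbarProc T hT s x)) ∂μ = 0 := by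
  obtain ⟨C, hC0, hC⟩ := K_bound hT hK
  obtain ⟨A, hA⟩ := ba
  obtain ⟨B, hB⟩ := bb
  have hF0 : ∀ n, ∫ x : K, (a (sp hT (gt T s n) x) * (SbarProc T hT (gt T t n) x - SbarProc T hT (gt T s n) x) +
      b (sp hT (gt T s n) x) * (SSbarProc T hT (gt T t n) x - SSbarProc T hT (gt T s n) x)) ∂μ = 0 := by
    intro n
    refine hμ _ (Lsub_elem hT n _ _ ?_ (tg_index hT n (h0.trans hst) htT).2.2 ha hb ⟨A, hA⟩ ⟨B, hB⟩)
    exact Nat.floor_mono (by gcongr)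
  have hs := gt_tendsto hT h0 (hst.trans htT)
  have ht := gt_tendsto hT (h0.trans hst) htT
  have key := tendsto_integral_of_dominated_convergence (μ := μ) (F := fun n (x : K) =>
      (a (sp hT (gt T s n) x) * (SbarProc T hT (gt T t n) x - SbarProc T hT (gt T s n) x) +
      b (sp hT (gt T s n) x) * (SSbarProc T hT (gt T t n) x - SSbarProc T hT (gt T s n) x)))
      (f := fun x : K => (a (sp hT s x) * (SbarProc T hT t x - SbarProc T hT s x) +
      b (sp hT s x) * (SSbarProc T hT t x - SSbarProc T hT s x)))
      (fun _ => A * (C + C) + B * (C + C)) (fun n => ?_) (integrable_const _) (fun n => ?_) ?_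
  · simp only [hF0] at key
    exact (tendsto_nhds_unique key tendsto_const_nhds)
  · refine Continuous.aestronglyMeasurable ?_
    have := (((ha.comp (continuous_sp hT (gt T s n))).mul ((continuous_Sbar hT (gt T t n)).sub
      (continuous_Sbar hT (gt T s n)))).add ((hb.comp (continuous_sp hT (gt T s n))).mul
      ((continuous_SSbar hT (gt T t n)).sub (continuous_SSbar hT (gt T s n)))))
    exact this.comp continuous_subtype_val
  · refine Eventually.of_forall fun x => ?_
    rw [Real.norm_eq_abs]
    refine (abs_add_le _ _).trans (add_le_add ?_ ?_)
    · rw [abs_mul]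
      exact mul_le_mul (hA _) ((abs_sub _ _).trans (add_le_add (hC x _).1 (hC x _).1)) (abs_nonneg _)
        ((abs_nonneg _).trans (hA x))
    · rw [abs_mul]
      exact mul_le_mul (hB _) ((abs_sub _ _).trans (add_le_add (hC x _).2.2 (hC x _).2.2)) (abs_nonneg _)
        ((abs_nonneg _).trans (hB x))
  · refine Eventually.of_forall fun x => ?_
    have c1 := (((ha.comp (continuous_sp_t hT x.1)).tendsto s).comp hs)
    have c2 := (((hb.comp (continuous_sp_t hT x.1)).tendsto s).comp hs)
    have c3 := (((continuous_Sbar_t hT x.1).tendsto s).comp hs)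
    have c4 := (((continuous_Sbar_t hT x.1).tendsto t).comp ht)
    have c5 := (((continuous_SSbar_t hT x.1).tendsto s).comp hs)
    have c6 := (((continuous_SSbar_t hT x.1).tendsto t).comp ht)
    exact (c1.mul (c4.sub c3)).add (c2.mul (c6.sub c5))

include hK hμ in
lemma mart_set {s t : ℝ} (h0 : 0 ≤ s) (hst : s ≤ t) (htT : t ≤ T) {B : Set (PathPair T)}
    (hB : MeasurableSet B) :
    ∫ x in (fun x : K => sp hT s x) ⁻¹' B, (SbarProc T hT t x - SbarProc T hT s x) ∂μ = 0 ∧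
    ∫ x in (fun x : K => sp hT s x) ⁻¹' B, (SSbarProc T hT t x - SSbarProc T hT s x) ∂μ = 0 := by
  obtain ⟨C, hC0, hC⟩ := K_bound hT hK
  have hπ : Measurable (fun x : K => sp hT s x) :=
    ((continuous_sp hT s).comp continuous_subtype_val).measurable
  constructor
  · refine test_ext μ hπ (D := fun x : K => SbarProc T hT t x - SbarProc T hT s x) ?_ (C := C + C) ?_ ?_ hB
    · exact (((continuous_Sbar hT t).sub (continuous_Sbar hT s)).comp continuous_subtype_val).measurable
    · exact fun x => (abs_sub _ _).trans (add_le_add (hC x _).1 (hC x _).1)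
    · intro f
      have := mart_cont hT hK μ hμ h0 hst htT f.continuous (b := fun _ => 0) continuous_const
        ⟨‖f‖, fun p => f.norm_coe_le_norm p⟩ ⟨0, fun p => by simp⟩
      simpa using this
  · refine test_ext μ hπ (D := fun x : K => SSbarProc T hT t x - SSbarProc T hT s x) ?_ (C := C + C) ?_ ?_ hB
    · exact (((continuous_SSbar hT t).sub (continuous_SSbar hT s)).comp continuous_subtype_val).measurable
    · exact fun x => (abs_sub _ _).trans (add_le_add (hC x _).2.2 (hC x _).2.2)
    · intro f
      have := mart_cont hT hK μ hμ h0 hst htT (a := fun _ => 0) (b := f) continuous_const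
        f.continuous ⟨0, fun p => by simp⟩ ⟨‖f‖, fun p => f.norm_coe_le_norm p⟩
      simpa using this
end MartK


section Energy
variable {T : ℝ} (hT : 0 ≤ T)

lemma K_modulus {K : Set (PathPair T)} (hK : IsCompact K) {w : ℝ} (hw : 0 < w) : ∃ δ > 0,
    ∀ x : K, ∀ s t, |s - t| < δ → |SbarProc T hT s x - SbarProc T hT t x| ≤ w ∧
      |VbarProc T hT s x - VbarProc T hT t x| ≤ w := by
  haveI : CompactSpace K := isCompact_iff_compactSpace.1 hK
  have hc : Continuous (fun q : K × Set.Icc (0:ℝ) T => ((q.1.1.1 q.2, q.1.1.2 q.2) : ℝ × ℝ)) := by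
    fun_prop
  obtain ⟨δ, hδ, h⟩ := Metric.uniformContinuous_iff.1
    (CompactSpace.uniformContinuous_of_continuous hc) w hw
  refine ⟨δ, hδ, fun x s t hst => ?_⟩
  have := (h (a := (x, clamp T hT s)) (b := (x, clamp T hT t)) (by
    rw [Prod.dist_eq, dist_self, max_eq_right dist_nonneg, Subtype.dist_eq, clamp_val, clamp_val, Real.dist_eq]
    refine lt_of_le_of_lt ?_ hst
    refine (abs_max_sub_max_le_max _ _ _ _).trans ?_
    rw [sub_self, abs_zero, max_eq_right (abs_nonneg _)]
    refine (abs_min_sub_min_le_max _ _ _ _).trans ?_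
    rw [sub_self, abs_zero, max_eq_right (abs_nonneg _)])).le
  rw [Prod.dist_eq, max_le_iff, Real.dist_eq, Real.dist_eq] at this
  exact this

variable {K : Set (PathPair T)}

def FK (n : ℕ) (j : ℕ) : MeasurableSpace K :=
  MeasurableSpace.comap (fun x : K => sp hT (tg T n j) x) inferInstance

lemma FK_le (n j : ℕ) : FK hT n j ≤ (inferInstance : MeasurableSpace K) :=
  Measurable.comap_le ((continuous_sp hT _).comp continuous_subtype_val).measurable

lemma FK_of {β : Type*} [MeasurableSpace β] (n j : ℕ) {f : PathPair T → β} (hf : Measurable f)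
    (h : ∀ p, f (sp hT (tg T n j) p) = f p) : Measurable[FK hT n j] (fun x : K => f x) := by
  have : (fun x : K => f x) = f ∘ (fun x : K => sp hT (tg T n j) x) := by
    funext x; exact (h x).symm
  rw [this]
  exact hf.comp (comap_measurable _)

lemma FK_mono (n : ℕ) : Monotone (FK hT n : ℕ → MeasurableSpace K) := by
  intro i j hij
  refine Measurable.comap_le (m₁ := FK hT n j) ?_
  refine FK_of hT n j (f := sp hT (tg T n i)) (continuous_sp hT _).measurable fun p => ?_
  rw [sp_sp, min_eq_left (tg_mono hT n hij)]

def dS (ρ : ℝ) (n j : ℕ) (x : K) : ℝ :=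
  SbarProc T hT (min (tg T n (j+1)) ρ) x - SbarProc T hT (min (tg T n j) ρ) x
def dV (ρ : ℝ) (n j : ℕ) (x : K) : ℝ :=
  VbarProc T hT (min (tg T n (j+1)) ρ) x - VbarProc T hT (min (tg T n j) ρ) x
def dM (ρ : ℝ) (n j : ℕ) (x : K) : ℝ :=
  SSbarProc T hT (min (tg T n (j+1)) ρ) x - SSbarProc T hT (min (tg T n j) ρ) x
def rj (m : ℕ) (ρ : ℝ) (n j : ℕ) (x : K) : ℝ := Rm hT m (min (tg T n j) ρ) x.1.1

lemma dS_meas (ρ : ℝ) (n j : ℕ) : Measurable[FK hT n (j+1)] (dS hT ρ n j : K → ℝ) := by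
  refine FK_of hT n (j+1) (f := fun p => SbarProc T hT (min (tg T n (j+1)) ρ) p -
    SbarProc T hT (min (tg T n j) ρ) p) ((continuous_Sbar hT _).sub (continuous_Sbar hT _)).measurable
    fun p => ?_
  have := tg_mono hT n (Nat.le_succ j)
  simp only [Sbar_sp]
  rw [min_eq_right (min_le_left _ _), min_eq_right ((min_le_left _ _).trans this)]

lemma dM_meas {ρ : ℝ} (n j : ℕ) : Measurable[FK hT n (j+1)] (dM hT ρ n j : K → ℝ) := by
  refine FK_of hT n (j+1) (f := fun p => SSbarProc T hT (min (tg T n (j+1)) ρ) p -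
    SSbarProc T hT (min (tg T n j) ρ) p) ((continuous_SSbar hT _).sub (continuous_SSbar hT _)).measurable
    fun p => ?_
  have := tg_mono hT n (Nat.le_succ j)
  simp only [SSbar_sp hT (tg_nonneg hT _ _)]
  rw [min_eq_right (min_le_left _ _), min_eq_right ((min_le_left _ _).trans this)]

lemma rj_meas (m : ℕ) {ρ : ℝ} (hρ : ρ ≤ T) (n j : ℕ) :
    Measurable[FK hT n j] (rj hT m ρ n j : K → ℝ) := by
  refine FK_of hT n j (f := fun p => Rm hT m (min (tg T n j) ρ) p.1)
    ((Rm_measurable hT m _).comp measurable_fst) fun p => ?_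
  have h : min (tg T n j) ρ ≤ T := (min_le_right _ _).trans hρ
  show Rm hT m (min (tg T n j) ρ) (stp hT (tg T n j) p.1) = _
  rw [← Rm_stp hT m _ h, stp_stp, min_eq_left (min_le_left _ _), Rm_stp hT m _ h]

variable (hK : IsCompact K) (μ : Measure K) [IsProbabilityMeasure μ]
  (hμ : ∀ g ∈ Lsub hT, ∫ x : K, g x ∂μ = 0)

include hK hμ in
lemma inc_zero {ρ : ℝ} (hρ : ρ ≤ T) (n j : ℕ) {A : Set K} (hA : MeasurableSet[FK hT n j] A) :
    ∫ x in A, dS hT ρ n j x ∂μ = 0 ∧ ∫ x in A, dM hT ρ n j x ∂μ = 0 := by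
  obtain ⟨B, hB, rfl⟩ := hA
  have hm := tg_mono hT n (Nat.le_succ j)
  rcases le_total (tg T n j) ρ with h | h
  · have := mart_set hT hK μ hμ (tg_nonneg hT n j) (le_min hm h) ((min_le_right _ _).trans hρ) hB
    unfold dS dM
    rw [min_eq_left h]
    exact this
  · unfold dS dM
    rw [min_eq_right h, min_eq_right (h.trans hm)]
    simp

def dd (m : ℕ) (ρ : ℝ) (n j : ℕ) (x : K) : ℝ := rj hT m ρ n j x * dS hT ρ n j x - dM hT ρ n j x

include hK hμ in
lemma energy {C : ℝ} (hC0 : 0 ≤ C) (hC : ∀ x : K, ∀ t,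
    |SbarProc T hT t x| ≤ C ∧ |VbarProc T hT t x| ≤ C ∧ |SSbarProc T hT t x| ≤ C)
    (hV : ∀ x : K, Monotone x.1.2) (m : ℕ) {ρ : ℝ} (hρ0 : 0 ≤ ρ) (hρ : ρ ≤ T) (n : ℕ) {w : ℝ} (hw0 : 0 ≤ w)
    (hw : ∀ (x : K) j, |dS hT ρ n j x| ≤ w ∧ |dV hT ρ n j x| ≤ w) :
    ∫ x, (∑ j ∈ Finset.range (2^n), dd hT m ρ n j x)^2 ∂μ ≤
      (2 * eps m ^ 2 + w^2) * (2*C)^2 + w * (2*C) := by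
  have hSb : ∀ j (x : K), |dS hT ρ n j x| ≤ 2*C := fun j x => by
    have := (abs_sub (SbarProc T hT (min (tg T n (j+1)) ρ) x) (SbarProc T hT (min (tg T n j) ρ) x)).trans
      (add_le_add (hC x _).1 (hC x _).1)
    rw [two_mul]; exact this
  have hMb : ∀ j (x : K), |dM hT ρ n j x| ≤ 2*C := fun j x => by
    have := (abs_sub (SSbarProc T hT (min (tg T n (j+1)) ρ) x) (SSbarProc T hT (min (tg T n j) ρ) x)).trans
      (add_le_add (hC x _).2.2 (hC x _).2.2)
    rw [two_mul]; exact this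
  have hu0 : ∀ j, 0 ≤ min (tg T n j) ρ := fun j => le_min (tg_nonneg hT _ _) hρ0
  have huT : ∀ j, min (tg T n j) ρ ≤ T := fun j => (min_le_right _ _).trans hρ
  have hRb : ∀ j (x : K), |rj hT m ρ n j x| ≤ C := fun j x =>
    Rm_bound hT m x.1.1 (hu0 j) (huT j) (fun s _ _ => (hC x s).1)
  have hdb : ∀ j (x : K), |dd hT m ρ n j x| ≤ C * (2*C) + 2*C := fun j x => by
    refine (abs_sub _ _).trans (add_le_add ?_ (hMb j x))
    rw [abs_mul]
    exact mul_le_mul (hRb j x) (hSb j x) (abs_nonneg _) hC0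
  have hdm : ∀ j, Measurable[FK hT n (j+1)] (dd hT m ρ n j : K → ℝ) := fun j =>
    (((rj_meas hT m hρ n j).mono (FK_mono hT n (Nat.le_succ j)) le_rfl).mul (dS_meas hT ρ n j)).sub
      (dM_meas hT n j)
  have hSm : ∀ j, Measurable (dS hT ρ n j : K → ℝ) := fun j => (dS_meas hT ρ n j).mono (FK_le hT _ _) le_rfl
  have hMm : ∀ j, Measurable (dM hT ρ n j : K → ℝ) := fun j => (dM_meas hT n j).mono (FK_le hT _ _) le_rfl
  have hRm : ∀ j, Measurable (rj hT m ρ n j : K → ℝ) := fun j => (rj_meas hT m hρ n j).mono (FK_le hT _ _) le_rfl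
  have hRSi : ∀ j, Integrable (fun x : K => rj hT m ρ n j x * dS hT ρ n j x) μ := fun j =>
    int_of_bdd (C := C * (2*C)) ((hRm j).mul (hSm j)).aestronglyMeasurable fun x => by
      rw [abs_mul]
      exact mul_le_mul (hRb j x) (hSb j x) (abs_nonneg _) hC0
  have hd0 : ∀ j, ∀ A : Set K, MeasurableSet[FK hT n j] A → ∫ x in A, dd hT m ρ n j x ∂μ = 0 := by
    intro j A hA
    have hA' : MeasurableSet A := FK_le hT n j _ hA
    have e1 : ∫ x in A, rj hT m ρ n j x * dS hT ρ n j x ∂μ = 0 := by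
      rw [← integral_indicator hA']
      have e2 : (A.indicator fun x => rj hT m ρ n j x * dS hT ρ n j x) =
          fun x => A.indicator (rj hT m ρ n j) x * dS hT ρ n j x := by
        funext x
        by_cases hx : x ∈ A
        · simp [hx]
        · simp [hx]
      rw [e2]
      refine orth (FK_le hT n j) (int_of_bdd (hSm j).aestronglyMeasurable (hSb j))
        (fun B hB => (inc_zero hT hK μ hμ hρ n j hB).1) ((rj_meas hT m hρ n j).indicator hA) ?_
      rw [← e2]
      exact (hRSi j).indicator hA'
    have e3 := (inc_zero hT hK μ hμ hρ n j hA).2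
    refine (integral_sub (hRSi j).integrableOn
      (int_of_bdd (hMm j).aestronglyMeasurable (hMb j)).integrableOn).trans ?_
    rw [e1, e3, sub_zero]
  have hsq := sq_sum (μ := μ) (FK hT n) (FK_le hT n) (FK_mono hT n) (dd hT m ρ n) (fun _ _ => 1)
    (C * (2*C) + 2*C) 1 hdb (by simp) hdm (fun i => measurable_const) hd0 (2^n)
  have hsqS := sq_sum (μ := μ) (FK hT n) (FK_le hT n) (FK_mono hT n) (dS hT ρ n) (fun _ _ => 1)
    (2*C) 1 hSb (by simp) (dS_meas hT ρ n) (fun i => measurable_const)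
    (fun j A hA => (inc_zero hT hK μ hμ hρ n j hA).1) (2^n)
  simp only [one_mul] at hsq hsqS
  have hVm : ∀ j, Measurable (dV hT ρ n j : K → ℝ) := fun j => by
    have : Continuous (fun p : PathPair T => VbarProc T hT (min (tg T n (j+1)) ρ) p - VbarProc T hT (min (tg T n j) ρ) p) :=
      ((continuous_ev_left hT _).comp continuous_snd).sub ((continuous_ev_left hT _).comp continuous_snd)
    exact (this.comp continuous_subtype_val).measurable
  have hVi : ∀ j, Integrable (dV hT ρ n j : K → ℝ) μ := fun j =>
    int_of_bdd (hVm j).aestronglyMeasurable (fun x => (hw x j).2)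
  have hS2 : ∀ j, Integrable (fun x : K => dS hT ρ n j x ^ 2) μ := fun j =>
    int_of_bdd (C := w^2) ((hSm j).pow_const 2).aestronglyMeasurable (fun x => by
      rw [abs_pow]; exact pow_le_pow_left₀ (abs_nonneg _) (hw x j).1 2)
  have hpt : ∀ j (x : K), dd hT m ρ n j x ^ 2 ≤ (2 * eps m ^ 2 + w^2) * dS hT ρ n j x ^ 2 + w * dV hT ρ n j x := by
    intro j x
    have hV0 : 0 ≤ dV hT ρ n j x := by
      have := (hV x) (Set.monotone_projIcc hT (min_le_min_right ρ (tg_mono hT n (Nat.le_succ j))))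
      exact sub_nonneg.2 this
    have hVw := (abs_le.1 (hw x j).2).2
    have hS2w : dS hT ρ n j x ^ 2 ≤ w^2 := sq_le_sq' (abs_le.1 (hw x j).1).1 (abs_le.1 (hw x j).1).2
    have hn := Rm_near hT m x.1.1 (hu0 j) (huT j)
    have hn2 := sq_le_sq' (abs_le.1 hn).1 (abs_le.1 hn).2
    have hid : dd hT m ρ n j x = (Rm hT m (min (tg T n j) ρ) x.1.1 - ev T hT x.1.1 (min (tg T n j) ρ)) *
        dS hT ρ n j x - (dS hT ρ n j x ^2 - dV hT ρ n j x)/2 := by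
      simp only [dd, rj, dS, dV, dM, SbarProc, VbarProc, SSbarProc]; ring
    rw [hid]
    generalize Rm hT m (min (tg T n j) ρ) x.1.1 - ev T hT x.1.1 (min (tg T n j) ρ) = r at *
    generalize dS hT ρ n j x = s at *
    generalize dV hT ρ n j x = v at *
    have i1 : r^2 * s^2 ≤ eps m ^ 2 * s^2 := mul_le_mul_of_nonneg_right hn2 (sq_nonneg s)
    have i2 : s^2 * s^2 ≤ w^2 * s^2 := mul_le_mul_of_nonneg_right hS2w (sq_nonneg s)
    have i3 : v * v ≤ w * v := mul_le_mul_of_nonneg_right hVw hV0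
    have i4 : (r*s - (s^2-v)/2)^2 ≤ 2*(r*s)^2 + (s^2-v)^2/2 := by nlinarith [sq_nonneg (r*s + (s^2-v)/2)]
    have i5 : (s^2-v)^2 ≤ 2*(s^2*s^2) + 2*(v*v) := by nlinarith [sq_nonneg (s^2+v)]
    nlinarith
  have hd2 : ∀ j, ∫ x, dd hT m ρ n j x ^ 2 ∂μ ≤
      (2 * eps m ^ 2 + w^2) * ∫ x, dS hT ρ n j x ^ 2 ∂μ + w * ∫ x, dV hT ρ n j x ∂μ := fun j => by
    rw [← integral_const_mul, ← integral_const_mul,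
      ← integral_add ((hS2 j).const_mul _) ((hVi j).const_mul _)]
    refine integral_mono ?_ (((hS2 j).const_mul _).add ((hVi j).const_mul _)) (hpt j)
    exact int_of_bdd (C := (C * (2*C) + 2*C)^2)
      ((((hdm j).mono (FK_le hT _ _) le_rfl).pow_const 2).aestronglyMeasurable) (fun x => by
        rw [abs_pow]; exact pow_le_pow_left₀ (abs_nonneg _) (hdb j x) 2)
  rw [hsq]
  refine (Finset.sum_le_sum fun j _ => hd2 j).trans ?_
  rw [Finset.sum_add_distrib, ← Finset.mul_sum, ← Finset.mul_sum, ← hsqS,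
    ← integral_finsetSum _ (fun j _ => hVi j)]
  have hsumS : ∀ x : K, (∑ j ∈ Finset.range (2^n), dS hT ρ n j x)^2 ≤ (2*C)^2 := fun x => by
    have : ∑ j ∈ Finset.range (2^n), dS hT ρ n j x = SbarProc T hT (min (tg T n (2^n)) ρ) x -
      SbarProc T hT (min (tg T n 0) ρ) x :=
      Finset.sum_range_sub (fun j => SbarProc T hT (min (tg T n j) ρ) x) (2^n)
    have h2 := (abs_sub (SbarProc T hT (min (tg T n (2^n)) ρ) x) (SbarProc T hT (min (tg T n 0) ρ) x)).trans
      (add_le_add (hC x _).1 (hC x _).1)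
    rw [this, ← sq_abs]
    exact pow_le_pow_left₀ (abs_nonneg _) (by linarith) 2
  have hsumV : ∀ x : K, ∑ j ∈ Finset.range (2^n), dV hT ρ n j x ≤ 2*C := fun x => by
    have : ∑ j ∈ Finset.range (2^n), dV hT ρ n j x = VbarProc T hT (min (tg T n (2^n)) ρ) x -
      VbarProc T hT (min (tg T n 0) ρ) x :=
      Finset.sum_range_sub (fun j => VbarProc T hT (min (tg T n j) ρ) x) (2^n)
    have h2 := (abs_le.1 (hC x (min (tg T n (2^n)) ρ)).2.1).2
    have h3 := (abs_le.1 (hC x (min (tg T n 0) ρ)).2.1).1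
    rw [this]; linarith
  have g1 : ∫ x, (∑ j ∈ Finset.range (2^n), dS hT ρ n j x)^2 ∂μ ≤ (2*C)^2 := by
    refine (integral_mono (int_of_bdd (C := (2*C)^2) ?_ ?_) (integrable_const ((2*C)^2)) hsumS).trans ?_
    · exact ((Finset.measurable_sum _ fun j _ => hSm j).pow_const 2).aestronglyMeasurable
    · intro x; rw [abs_of_nonneg (sq_nonneg _)]; exact hsumS x
    · simp
  have g2 : ∫ x, ∑ j ∈ Finset.range (2^n), dV hT ρ n j x ∂μ ≤ 2*C := by
    refine (integral_mono (integrable_finsetSum _ fun j _ => hVi j) (integrable_const (2*C)) hsumV).trans ?_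
    simp
  exact add_le_add (mul_le_mul_of_nonneg_left g1 (by positivity)) (mul_le_mul_of_nonneg_left g2 hw0)
end Energy


section AsLim
variable {T : ℝ} (hT : 0 ≤ T) {K : Set (PathPair T)} (hK : IsCompact K) (μ : Measure K)
  [IsProbabilityMeasure μ] (hμ : ∀ g ∈ Lsub hT, ∫ x : K, g x ∂μ = 0)

lemma dd_sum (m : ℕ) {ρ : ℝ} (hρ0 : 0 ≤ ρ) (hρ : ρ ≤ T) (x : K)
    (hx0 : ev T hT x.1.2 0 = 0) :
    Tendsto (fun n => ∑ j ∈ Finset.range (2^n), dd hT m ρ n j x) atTop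
      (𝓝 (Sm T hT m ρ x.1.1 - SSbarProc T hT ρ x)) := by
  have h := grid_R hT m x.1.1 ρ (-1) hρ0 hρ
  have hm : min (-1) ρ ≤ 0 := (min_le_left _ _).trans (by norm_num)
  rw [Sm_of_nonpos hT m _ hm, sub_zero] at h
  refine (h.sub_const (SSbarProc T hT ρ x)).congr fun n => ?_
  have hM : ∑ j ∈ Finset.range (2^n), dM hT ρ n j x = SSbarProc T hT ρ x := by
    have : ∑ j ∈ Finset.range (2^n), dM hT ρ n j x = SSbarProc T hT (min (tg T n (2^n)) ρ) x -
      SSbarProc T hT (min (tg T n 0) ρ) x :=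
      Finset.sum_range_sub (fun j => SSbarProc T hT (min (tg T n j) ρ) x) (2^n)
    rw [this, tg_last, min_eq_right hρ, tg_zero, min_eq_left hρ0]
    have h0 : SSbarProc T hT 0 x = 0 := by simp only [SSbarProc, hx0]; ring
    rw [h0, sub_zero]
  simp only [dd]
  rw [Finset.sum_sub_distrib, hM]
  congr 1
  refine Finset.sum_congr rfl fun j _ => ?_
  rw [if_pos (by linarith [tg_nonneg hT n j]), one_mul]
  rcases le_total (tg T n j) ρ with h | h
  · simp only [rj, dS, SbarProc, min_eq_left h]
  · have := h.trans (tg_mono hT n (Nat.le_succ j))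
    simp only [dS, SbarProc, min_eq_right h, min_eq_right this]; simp

include hK hμ in
lemma as_conv (hV : ∀ x : K, Monotone x.1.2 ∧ ev T hT x.1.2 0 = 0) {ρ : ℝ} (hρ0 : 0 ≤ ρ) (hρ : ρ ≤ T) :
    ∀ᵐ x : K ∂μ, Tendsto (fun m => Sm T hT m ρ x.1.1) atTop (𝓝 (SSbarProc T hT ρ x)) := by
  obtain ⟨C, hC0, hC⟩ := K_bound hT hK
  have hmeas : ∀ m n, Measurable (fun x : K => ∑ j ∈ Finset.range (2^n), dd hT m ρ n j x) := fun m n =>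
    Finset.measurable_sum _ fun j _ => 
      (((rj_meas hT m hρ n j).mono (FK_le hT _ _) le_rfl).mul
        ((dS_meas hT ρ n j).mono (FK_le hT _ _) le_rfl)).sub ((dM_meas hT n j).mono (FK_le hT _ _) le_rfl)
  have hbdd : ∀ m n, ∃ B, ∀ x : K, |∑ j ∈ Finset.range (2^n), dd hT m ρ n j x| ≤ B := by
    intro m n
    refine ⟨∑ j ∈ Finset.range (2^n), (C * (C+C) + (C+C)), fun x => ?_⟩
    refine (Finset.abs_sum_le_sum_abs _ _).trans (Finset.sum_le_sum fun j _ => ?_)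
    refine (abs_sub _ _).trans (add_le_add ?_ ((abs_sub _ _).trans (add_le_add (hC x _).2.2 (hC x _).2.2)))
    rw [abs_mul]
    exact mul_le_mul (Rm_bound hT m x.1.1 (le_min (tg_nonneg hT _ _) hρ0) ((min_le_right _ _).trans hρ)
      (fun s _ _ => (hC x s).1)) ((abs_sub _ _).trans (add_le_add (hC x _).1 (hC x _).1)) (abs_nonneg _) hC0
  have hE : ∀ m, ∫⁻ x, ENNReal.ofReal ((Sm T hT m ρ x.1.1 - SSbarProc T hT ρ x)^2) ∂μ ≤
      ENNReal.ofReal ((8*C^2+1) * eps m ^ 2) := by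
    intro m
    have he := eps_pos m
    have hP : 0 < 4*C^2+2*C+1 := by positivity
    obtain ⟨w, hw0, hw1, hw2⟩ : ∃ w : ℝ, 0 < w ∧ w ≤ 1 ∧ w * (4*C^2+2*C+1) ≤ eps m ^ 2 := by
      refine ⟨min 1 (eps m ^ 2 / (4*C^2+2*C+1)), lt_min one_pos (by positivity), min_le_left _ _, ?_⟩
      rw [← le_div_iff₀ hP]; exact min_le_right _ _
    obtain ⟨δ, hδ, hmod⟩ := K_modulus hT hK hw0
    have hev : ∀ᶠ n in atTop, ∫⁻ x, ENNReal.ofReal ((∑ j ∈ Finset.range (2^n), dd hT m ρ n j x)^2) ∂μ ≤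
        ENNReal.ofReal ((8*C^2+1) * eps m ^ 2) := by
      filter_upwards [(mesh_tendsto T).eventually (gt_mem_nhds hδ)] with n hn
      have hd : ∀ j, |min (tg T n (j+1)) ρ - min (tg T n j) ρ| < δ := fun j => by
        refine lt_of_le_of_lt ((abs_min_sub_min_le_max _ _ _ _)) ?_
        rw [sub_self, abs_zero, max_eq_left (abs_nonneg _), tg_succ, add_sub_cancel_left,
          abs_of_nonneg (by positivity)]
        exact hn
      have hen := energy hT hK μ hμ hC0 hC (fun x => (hV x).1) m hρ0 hρ n hw0.le
        (fun x j => hmod x _ _ (hd j))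
      rw [← ofReal_integral_eq_lintegral_ofReal _ (Eventually.of_forall fun x => sq_nonneg _)]
      · refine ENNReal.ofReal_le_ofReal (hen.trans ?_)
        have : w^2 ≤ w := by nlinarith
        nlinarith [sq_nonneg C]
      · obtain ⟨B, hB⟩ := hbdd m n
        exact int_of_bdd (C := B^2) ((hmeas m n).pow_const 2).aestronglyMeasurable (fun x => by
          rw [abs_pow]; exact pow_le_pow_left₀ (abs_nonneg _) (hB x) 2)
    have hlim : ∀ x : K, ENNReal.ofReal ((Sm T hT m ρ x.1.1 - SSbarProc T hT ρ x)^2) =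
        liminf (fun n => ENNReal.ofReal ((∑ j ∈ Finset.range (2^n), dd hT m ρ n j x)^2)) atTop := fun x =>
      ((ENNReal.continuous_ofReal.tendsto _).comp ((dd_sum hT m hρ0 hρ x (hV x).2).pow 2)).liminf_eq.symm
    simp only [hlim]
    refine (lintegral_liminf_le fun n => ((hmeas m n).pow_const 2).ennreal_ofReal).trans ?_
    refine (liminf_le_liminf hev).trans ?_
    rw [liminf_const]
  have hms : ∀ m, Measurable (fun x : K => ENNReal.ofReal ((Sm T hT m ρ x.1.1 - SSbarProc T hT ρ x)^2)) := by
    intro m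
    refine Measurable.ennreal_ofReal (Measurable.pow_const (Measurable.sub ?_ ?_) 2)
    · exact (Sm_measurable hT m hρ0 hρ).comp (measurable_fst.comp measurable_subtype_coe)
    · exact ((continuous_SSbar hT ρ).comp continuous_subtype_val).measurable
  have hfin : ∫⁻ x, ∑' m, ENNReal.ofReal ((Sm T hT m ρ x.1.1 - SSbarProc T hT ρ x)^2) ∂μ ≠ ⊤ := by
    rw [lintegral_tsum fun m => (hms m).aemeasurable]
    refine ne_top_of_le_ne_top ?_ (ENNReal.tsum_le_tsum hE)
    have hsum : Summable (fun m => (8*C^2+1) * eps m ^ 2) := by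
      refine Summable.mul_left _ ?_
      simp only [eps_eq, ← pow_mul, mul_comm _ 2]
      simp only [pow_mul]
      exact summable_geometric_of_lt_one (by norm_num) (by norm_num)
    rw [← ENNReal.ofReal_tsum_of_nonneg (fun m => by positivity) hsum]
    exact ENNReal.ofReal_ne_top
  filter_upwards [ae_lt_top (Measurable.tsum fun m => hms m) hfin] with x hx
  have h0 := ENNReal.tendsto_atTop_zero_of_tsum_ne_top hx.ne
  have h1 := (ENNReal.tendsto_toReal ENNReal.zero_ne_top).comp h0
  have h2 : Tendsto (fun m => (Sm T hT m ρ x.1.1 - SSbarProc T hT ρ x)^2) atTop (𝓝 0) := by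
    refine h1.congr fun m => ?_
    exact ENNReal.toReal_ofReal (sq_nonneg _)
  have h3 := (Real.continuous_sqrt.tendsto 0).comp h2
  rw [Real.sqrt_zero] at h3
  have h4 : Tendsto (fun m => Sm T hT m ρ x.1.1 - SSbarProc T hT ρ x) atTop (𝓝 0) := by
    rw [tendsto_zero_iff_abs_tendsto_zero]
    refine h3.congr fun m => ?_
    exact Real.sqrt_sq_eq_abs _
  have := h4.add_const (SSbarProc T hT ρ x)
  simpa using this

include hK hμ in
lemma as_Omega (hV : ∀ x : K, Monotone x.1.2 ∧ ev T hT x.1.2 0 = 0) :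
    ∀ᵐ x : K ∂μ, x.1.1 ∈ BigOmega T hT ∧ qv T hT x.1.1 = x.1.2 := by
  have : ∀ᵐ x : K ∂μ, ∀ n : ℕ, ∀ j : ℕ, j ≤ 2^n → Tendsto (fun m => Sm T hT m (tg T n j) x.1.1) atTop
      (𝓝 (SSbarProc T hT (tg T n j) x)) := by
    rw [ae_all_iff]; intro n
    rw [ae_all_iff]; intro j
    by_cases hj : j ≤ 2^n
    · filter_upwards [as_conv hT hK μ hμ hV (tg_nonneg hT n j) (tg_le hT hj)] with x hx _
      exact hx
    · exact Eventually.of_forall fun x h => absurd h hj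
  filter_upwards [this] with x hx
  exact pathwise_conv hT x.1.1 x.1.2 (hV x).1 hx
end AsLim


section Final
variable {T : ℝ} (hT : 0 ≤ T) {Ξ : Set (Path T)} {Xibar : Set (PathPair T)}

lemma hV_of_A (hA : AssumptionA T hT Ξ Xibar) {K : Set (PathPair T)} (hKX : K ⊆ Xibar) (x : K) :
    Monotone x.1.2 ∧ ev T hT x.1.2 0 = 0 := by
  have h := hA.A2 x.1 (hKX x.2)
  refine ⟨h.2, ?_⟩
  have e : clamp T hT 0 = t0 T hT := by
    apply Subtype.ext
    simp [clamp, t0]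
  unfold ev
  rw [e]; exact h.1

lemma meas_MSet (hA : AssumptionA T hT Ξ Xibar) {K : Set (PathPair T)} (hK : IsCompact K)
    (hKX : K ⊆ Xibar) (μ : Measure K) [IsProbabilityMeasure μ]
    (hμ : ∀ g ∈ Lsub hT, ∫ x : K, g x ∂μ = 0) :
    μ.map (fun x : K => x.1.1) ∈ MSet T hT Ξ := by
  have hm : Measurable (fun x : K => x.1.1) := measurable_fst.comp measurable_subtype_coe
  have hcS : ∀ t, Measurable (Sproc T hT t) := fun t => (continuous_ev_left hT t).measurable
  obtain ⟨C, hC0, hC⟩ := K_bound hT hK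
  have hint : ∀ t, Integrable (fun x : K => SbarProc T hT t x) μ := fun t =>
    int_of_bdd (C := C) (((continuous_Sbar hT t).comp continuous_subtype_val).measurable.aestronglyMeasurable)
      (fun x => (hC x t).1)
  refine ⟨Measure.isProbabilityMeasure_map hm.aemeasurable, ?_, ?_⟩
  · refine ⟨fun m _ => m + T, fun m t ht => MeasurableSet.const _, Eventually.of_forall fun ω => ⟨?_, ?_⟩, fun m => ⟨?_, ?_⟩⟩
    · intro a b hab
      have : (a:ℝ) ≤ b := by exact_mod_cast hab
      simpa using this
    · exact tendsto_atTop_add_const_right _ _ tendsto_natCast_atTop_atTop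
    · intro t ht
      have e : min ((m:ℝ) + T) t = t := min_eq_right (by have := ht.2; have := m.cast_nonneg (α := ℝ); linarith)
      simp only [e]
      exact (integrable_map_measure (hcS t).aestronglyMeasurable hm.aemeasurable).2 (hint t)
    · intro s t hs ht hst A hAm
      have e : ∀ t ∈ Icc (0:ℝ) T, min ((m:ℝ) + T) t = t := fun t ht =>
        min_eq_right (by have := ht.2; have := m.cast_nonneg (α := ℝ); linarith)
      simp only [e t ht, e s hs]
      have hAm' : MeasurableSet A := fraw_le s A hAm
      rw [setIntegral_map hAm' (hcS t).aestronglyMeasurable hm.aemeasurable,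
        setIntegral_map hAm' (hcS s).aestronglyMeasurable hm.aemeasurable]
      have h := (mart_set hT hK μ hμ hs.1 hst ht.2 (B := A ×ˢ univ) (hAm'.prod MeasurableSet.univ)).1
      have e2 : (fun x : K => sp hT s x)⁻¹' (A ×ˢ univ) = (fun x : K => x.1.1) ⁻¹' A := by
        ext x
        simpa [sp] using stp_mem_iff hT hAm x.1.1
      rw [e2, integral_sub (hint t).integrableOn (hint s).integrableOn, sub_eq_zero] at h
      exact h
  · rw [Measure.map_apply hm (Xi_measurable hT hA)]
    rw [prob_compl_eq_zero_iff (hm (Xi_measurable hT hA)) |>.symm]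
    have := as_Omega hT hK μ hμ (hV_of_A hT hA hKX)
    refine measure_mono_null ?_ this
    intro x hx hx'
    apply hx
    show x.1.1 ∈ Ξ
    rw [hA.xi_eq]
    refine ⟨hx'.1, ?_⟩
    rw [hx'.2]
    exact hKX x.2

lemma int_le (hA : AssumptionA T hT Ξ Xibar) {K : Set (PathPair T)} (hK : IsCompact K)
    (hKX : K ⊆ Xibar) (μ : Measure K) [IsProbabilityMeasure μ]
    (hμ : ∀ g ∈ Lsub hT, ∫ x : K, g x ∂μ = 0) {X : PathPair T → ℝ} (hX : UpperSemicontinuous X)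
    (hX0 : ∀ p, 0 ≤ X p) {C : ℝ} (hXC : ∀ p, X p ≤ C) {ξ : Path T → ℝ≥0∞}
    (hle : ∀ ω, ENNReal.ofReal (X (ω, qv T hT ω)) ≤ ξ ω) :
    ENNReal.ofReal (∫ x : K, X x ∂μ) ≤ supMart T hT Ξ ξ := by
  have hm : Measurable (fun x : K => x.1.1) := measurable_fst.comp measurable_subtype_coe
  have hXm : Measurable X := hX.measurable
  have hQ := meas_MSet hT hA hK hKX μ hμ
  refine le_trans ?_ (le_iSup₂_of_le _ hQ le_rfl)
  rw [ofReal_integral_eq_lintegral_ofReal (f := fun x : K => X x)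
    (int_of_bdd (C := C) (hXm.comp measurable_subtype_coe).aestronglyMeasurable
      (fun x => by rw [abs_of_nonneg (hX0 _)]; exact hXC _)) (Eventually.of_forall fun x => hX0 _)]
  let Y : Path T → ℝ≥0∞ := (BigOmega T hT).indicator (fun ω => ENNReal.ofReal (X (ω, GP hT ω)))
  have hY : Measurable Y :=
    ((hXm.comp (pairGP_measurable hT)).ennreal_ofReal).indicator (Omega_measurable hT)
  have hYξ : ∀ ω, Y ω ≤ ξ ω := by
    intro ω
    by_cases h : ω ∈ BigOmega T hT
    · have := hle ω
      rw [qv_eq hT h] at this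
      simpa [Y, h] using this
    · simp [Y, h]
  refine le_trans ?_ (lintegral_mono hYξ)
  rw [lintegral_map hY hm]
  refine (lintegral_congr_ae ?_).le
  filter_upwards [as_Omega hT hK μ hμ (hV_of_A hT hA hKX)] with x hx
  have h2 := hx.2
  rw [qv_eq hT hx.1] at h2
  simp [Y, hx.1, h2]

/-- one-step hedge on a compact stopping-closed set -/
lemma hedge_exists (hA : AssumptionA T hT Ξ Xibar) {K : Set (PathPair T)} (hK : IsCompact K)
    (hKX : K ⊆ Xibar) {X : PathPair T → ℝ} (hX : UpperSemicontinuous X)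
    (hX0 : ∀ p, 0 ≤ X p) {C : ℝ} (hXC : ∀ p, X p ≤ C) {ξ : Path T → ℝ≥0∞}
    (hle : ∀ ω, ENNReal.ofReal (X (ω, qv T hT ω)) ≤ ξ ω) {lam : ℝ}
    (hlam : supMart T hT Ξ ξ < ENNReal.ofReal lam) :
    ∃ g ∈ Lsub hT, ∀ p ∈ K, X p < lam + g p := by
  by_cases hne : K.Nonempty
  swap
  · exact ⟨0, (Lsub hT).zero_mem, fun p hp => absurd ⟨p, hp⟩ hne⟩
  by_contra hcon
  push Not at hcon
  have : CompactSpace K := isCompact_iff_compactSpace.1 hK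
  have : Nonempty K := hne.to_subtype
  let L : Submodule ℝ C(K,ℝ) :=
    { carrier := {f | ∃ g ∈ Lsub hT, ∀ x : K, f x = g x}
      add_mem' := by
        rintro a b ⟨g, hg, h⟩ ⟨g', hg', h'⟩
        exact ⟨g + g', (Lsub hT).add_mem hg hg', fun x => by simp [h, h']⟩
      zero_mem' := ⟨0, (Lsub hT).zero_mem, fun x => rfl⟩
      smul_mem' := by
        rintro c a ⟨g, hg, h⟩
        exact ⟨c • g, (Lsub hT).smul_mem c hg, fun x => by simp [h]⟩ }
  obtain ⟨μ, hp, h1, h2⟩ := hb_measure L (fun x : K => X x) (hX.comp continuous_subtype_val)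
    (C := C) (fun x => by rw [abs_of_nonneg (hX0 _)]; exact hXC _) lam (by
      rintro f ⟨g, hg, h⟩
      obtain ⟨p, hp, hp'⟩ := hcon g hg
      exact ⟨⟨p, hp⟩, by rw [h]; exact hp'⟩)
  have hμ : ∀ g ∈ Lsub hT, ∫ x : K, g x ∂μ = 0 := fun g hg =>
    h1 ⟨fun x => g x, (Lsub_cont hT hg).comp continuous_subtype_val⟩ ⟨g, hg, fun x => rfl⟩
  have h3 := int_le hT hA hK hKX μ hμ hX hX0 hXC hle
  exact absurd hlam (not_lt.2 ((ENNReal.ofReal_le_ofReal h2).trans h3))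

lemma compacts (hA : AssumptionA T hT Ξ Xibar) : ∃ K : ℕ → Set (PathPair T),
    (∀ n, IsCompact (K n)) ∧ (∀ n, K n ⊆ Xibar) ∧ (∀ p ∈ Xibar, ∀ᶠ n in atTop, p ∈ K n) ∧
    ∀ n, ∀ p ∈ K n, ∀ r ∈ Icc (0:ℝ) T, sp hT r p ∈ K n := by
  obtain ⟨K, hK, hKX⟩ := hA.A1
  have hj : Continuous (fun q : PathPair T × ℝ => sp hT q.2 q.1) :=
    ((continuous_stp_joint hT).comp ((continuous_fst.comp continuous_fst).prodMk continuous_snd)).prodMk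
    ((continuous_stp_joint hT).comp ((continuous_snd.comp continuous_fst).prodMk continuous_snd))
  let K' : ℕ → Set (PathPair T) := fun i => (fun q : PathPair T × ℝ => sp hT q.2 q.1) '' (K i ×ˢ Icc (0:ℝ) T)
  refine ⟨fun n => ⋃ i ∈ Finset.range (n+1), K' i, fun n => ?_, fun n => ?_, ?_, ?_⟩
  · exact (Finset.range (n+1)).isCompact_biUnion fun i _ => ((hK i).prod isCompact_Icc).image hj
  · refine iUnion₂_subset fun i _ => ?_
    rintro _ ⟨⟨p, r⟩, ⟨hp, hr⟩, rfl⟩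
    have hp' : p ∈ Xibar := by rw [hKX]; exact mem_iUnion.2 ⟨i, hp⟩
    exact hA.A3 p hp' (clamp T hT r)
  · intro p hp
    rw [hKX] at hp
    obtain ⟨i, hi⟩ := mem_iUnion.1 hp
    filter_upwards [eventually_ge_atTop i] with n hn
    refine mem_iUnion₂.2 ⟨i, Finset.mem_range.2 (by omega), ⟨(p, T), ⟨hi, hT, le_rfl⟩, ?_⟩⟩
    exact sp_of_ge hT le_rfl p
  · intro n p hp r hr
    obtain ⟨i, hi, ⟨⟨q, t⟩, ⟨hq, ht⟩, rfl⟩⟩ := mem_iUnion₂.1 hp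
    refine mem_iUnion₂.2 ⟨i, hi, ⟨(q, min r t), ⟨hq, le_min hr.1 ht.1, (min_le_left _ _).trans hr.2⟩, ?_⟩⟩
    exact (sp_sp hT r t q).symm

lemma strong_real (hA : AssumptionA T hT Ξ Xibar) (ξ : Path T → ℝ≥0∞) (ξbar : ℕ → PathPair T → ℝ)
    (hbdd : ∀ n, ∃ C, ∀ p, |ξbar n p| ≤ C) (husc : ∀ n, UpperSemicontinuous (ξbar n))
    (hnonneg : ∀ n p, 0 ≤ ξbar n p)
    (hrep : ∀ ω, ξ ω = liminf (fun n => ENNReal.ofReal (ξbar n (ω, qv T hT ω))) atTop)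
    {lam : ℝ} (hlam : supMart T hT Ξ ξ < ENNReal.ofReal lam) :
    lam ∈ PhiSet T hT Ξ (fun ω => (ξ ω : EReal)) := by
  have hl0 : 0 ≤ lam := by
    by_contra h
    rw [ENNReal.ofReal_of_nonpos (by linarith)] at hlam
    exact absurd hlam (by simp)
  let X : ℕ → PathPair T → ℝ := fun n p => ⨅ i, ξbar (n+i) p
  have hbb : ∀ n p, BddBelow (range fun i => ξbar (n+i) p) := fun n p =>
    ⟨0, by rintro _ ⟨i, rfl⟩; exact hnonneg _ _⟩
  have hX0 : ∀ n p, 0 ≤ X n p := fun n p => Real.iInf_nonneg fun i => hnonneg _ _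
  have hXle : ∀ n i p, X n p ≤ ξbar (n+i) p := fun n i p => ciInf_le (hbb n p) i
  have hXusc : ∀ n, UpperSemicontinuous (X n) := fun n =>
    upperSemicontinuous_ciInf (hbb n) fun i => husc _
  have hXξ : ∀ n ω, ENNReal.ofReal (X n (ω, qv T hT ω)) ≤ ξ ω := by
    intro n ω
    rw [hrep]
    refine le_liminf_of_le (by isBoundedDefault) ?_
    filter_upwards [eventually_ge_atTop n] with k hk
    obtain ⟨i, rfl⟩ := Nat.exists_eq_add_of_le hk
    exact ENNReal.ofReal_le_ofReal (hXle n i _)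
  obtain ⟨K, hK, hKX, hKe, hKs⟩ := compacts hT hA
  have step : ∀ n, ∃ H G : SimpleStrategy T,
      (∀ t ∈ Icc (0:ℝ) T, ∀ ω ∈ BigOmega T hT, 0 ≤ lam + integ T H (Sproc T hT) t ω + integ T G (SS T hT) t ω) ∧
      ∀ ω ∈ BigOmega T hT, (ω, qv T hT ω) ∈ K n →
        X n (ω, qv T hT ω) ≤ lam + (integ T H (Sproc T hT) T ω + integ T G (SS T hT) T ω) := by
    intro n
    obtain ⟨C, hC⟩ := hbdd n
    obtain ⟨g, ⟨N, α, β, hh, rfl⟩, hg⟩ := hedge_exists hT hA (hK n) (hKX n) (hXusc n) (hX0 n)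
      (fun p => (hXle n 0 p).trans ((le_abs_self _).trans (hC p))) (hXξ n) hlam
    obtain ⟨H, G, h1, h2⟩ := hedge_strategy hT hh hl0
    refine ⟨H, G, h1, fun ω hω hωK => ?_⟩
    rw [h2 ω hω fun r hr => ?_]
    · exact (hg _ hωK).le
    · exact (hX0 n _).trans (hg _ (hKs n _ hωK r hr)).le
  choose H G h1 h2 using step
  have hΞ : ∀ ω ∈ Ξ, ω ∈ BigOmega T hT ∧ (ω, qv T hT ω) ∈ Xibar := fun ω hω => by
    rw [hA.xi_eq] at hω; exact hω
  refine ⟨H, G, fun n t ht ω hω => h1 n t ht ω (hΞ ω hω).1, fun ω hω => ?_⟩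
  obtain ⟨hωO, hωX⟩ := hΞ ω hω
  set p : PathPair T := (ω, qv T hT ω) with hp
  set a : ℕ → ℝ := fun n => integ T (H n) (Sproc T hT) T ω + integ T (G n) (SS T hT) T ω with ha
  have hev : ∀ᶠ n in atTop, X n p ≤ lam + a n := by
    filter_upwards [hKe p hωX] with n hn
    exact h2 n ω hωO hn
  show (ξ ω : EReal) ≤ (lam : EReal) + liminf (fun n => ((a n : ℝ) : EReal)) atTop
  refine EReal.ge_of_forall_gt_iff_ge.1 fun z hz => ?_
  have hzX : ∀ᶠ n in atTop, z ≤ X n p := by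
    by_cases h0 : z < 0
    · exact Eventually.of_forall fun n => h0.le.trans (hX0 n p)
    push Not at h0
    have hz' : ENNReal.ofReal z < ξ ω := by
      rw [← EReal.coe_ennreal_lt_coe_ennreal_iff, EReal.coe_ennreal_ofReal, max_eq_left h0]
      exact hz
    rw [hrep] at hz'
    obtain ⟨N, hN⟩ := eventually_atTop.1 (eventually_lt_of_lt_liminf hz')
    filter_upwards [eventually_ge_atTop N] with n hn
    refine le_ciInf fun i => ?_
    have := hN (n+i) (by omega)
    exact ((ENNReal.ofReal_lt_ofReal_iff_of_nonneg h0).1 this).le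
  have hfin : ((z - lam : ℝ) : EReal) ≤ liminf (fun n => ((a n : ℝ) : EReal)) atTop := by
    refine le_liminf_of_le (by isBoundedDefault) ?_
    filter_upwards [hzX, hev] with n h3 h4
    exact EReal.coe_le_coe_iff.2 (by linarith)
  calc (z : EReal) = (lam : EReal) + ((z - lam : ℝ) : EReal) := by
        rw [← EReal.coe_add]; congr 1; ring
    _ ≤ _ := by gcongr

lemma strong_duality (hA : AssumptionA T hT Ξ Xibar) (ξ : Path T → ℝ≥0∞) (ξbar : ℕ → PathPair T → ℝ)
    (hbdd : ∀ n, ∃ C, ∀ p, |ξbar n p| ≤ C) (husc : ∀ n, UpperSemicontinuous (ξbar n))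
    (hnonneg : ∀ n p, 0 ≤ ξbar n p)
    (hrep : ∀ ω, ξ ω = liminf (fun n => ENNReal.ofReal (ξbar n (ω, qv T hT ω))) atTop) :
    Phi T hT Ξ (fun ω => (ξ ω : EReal)) ≤ (supMart T hT Ξ ξ : EReal) := by
  refine EReal.le_of_forall_lt_iff_le.1 fun z hz => ?_
  refine sInf_le ⟨z, strong_real hT hA ξ ξbar hbdd husc hnonneg hrep ?_, rfl⟩
  rw [← EReal.coe_ennreal_lt_coe_ennreal_iff, EReal.coe_ennreal_ofReal]
  exact hz.trans_le (EReal.coe_le_coe_iff.2 (le_max_left _ _))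
end Final


/-- **Theorem 2.2 (superhedging duality for prediction sets closed under stopping).**
If `Ξ` satisfies Assumption A, then for every claim `ξ : C[0,T] → [0,∞]` of the form
`ξ(ω) = liminf_n ξ̄_n(ω, ⟨ω⟩)` with `ξ̄_n : C[0,T] × C[0,T] → [0,∞)` bounded and upper
semicontinuous, the superhedging price `Φ(ξ)` equals `sup_{Q ∈ M(Ξ)} E_Q[ξ]`. -/
theorem superhedging_duality_stopped (T : ℝ) (hT : 0 ≤ T)
    (Ξ : Set (Path T)) (Xibar : Set (PathPair T)) (hA : AssumptionA T hT Ξ Xibar)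
    (ξ : Path T → ℝ≥0∞) (ξbar : ℕ → PathPair T → ℝ)
    (hbdd : ∀ n, ∃ C : ℝ, ∀ p, |ξbar n p| ≤ C)
    (husc : ∀ n, UpperSemicontinuous (ξbar n))
    (hnonneg : ∀ n p, 0 ≤ ξbar n p)
    (hrep : ∀ ω : Path T, ξ ω =
      Filter.liminf (fun n => ENNReal.ofReal (ξbar n (ω, qv T hT ω))) Filter.atTop) :
    Phi T hT Ξ (fun ω => (ξ ω : EReal)) = (supMart T hT Ξ ξ : EReal) := by
  exact le_antisymm (strong_duality hT hA ξ ξbar hbdd husc hnonneg hrep) (weak_duality hT hA ξ)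

end PathwiseSuperhedging
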